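/- Let p be a prime. Then |A(p)·A(p)| ≥ p − C·p^(13/14)·(log p)^(4/7) for some absolute constant C > 0 (i.e. there exists C > 0 such that for all primes p, the set of products of two factorials modulo p has size at least p − C·p^(13/14)·(log p)^(4/7)). -/

import Mathlib

/-- For a prime `p`, `A(p) = {n! mod p : 1 ≤ n ≤ p-1} ⊆ ZMod p`. -/
def factorialResidues (p : ℕ) : Finset (ZMod p) :=
  (Finset.Icc 1 (p - 1)).image (fun n => (n.factorial : ZMod p))

open Finset

structure IsLinearFiltration {F R : Type*} [Field F] [CommRing R] [Algebra F R]
    (L : ℕ → Submodule F R) (e γ : ℕ) : Prop where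
  mono : Monotone L
  mul_mem : ∀ {m n : ℕ} {a b : R}, a ∈ L m → b ∈ L n → a * b ∈ L (m + n)
  exists_mem : ∀ a : R, ∃ n, a ∈ L n
  finite : ∀ n, Module.Finite F (L n)
  le_finrank : ∀ n, e * (n + 1) ≤ Module.finrank F (L n) + γ
  finrank_le : ∀ n, Module.finrank F (L n) ≤ e * (n + 1)

section Vanishing

variable {F R : Type*} [Field F] [CommRing R] [Algebra F R]

def VanishesToOrder (δ : Derivation F R R) (Q : R →ₐ[F] F) : ℕ → R → Prop
  | 0, _ => True
  | n + 1, a => Q a = 0 ∧ VanishesToOrder δ Q n (δ a)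

variable {δ : Derivation F R R} {Q : R →ₐ[F] F}

namespace VanishesToOrder

theorem iff_forall {n : ℕ} {a : R} :
    VanishesToOrder δ Q n a ↔ ∀ m < n, Q (δ^[m] a) = 0 := by
  induction n generalizing a with
  | zero => simp [VanishesToOrder]
  | succ n ih =>
    rw [VanishesToOrder, ih]
    constructor
    · rintro ⟨h0, h⟩ m hm
      cases m with
      | zero => simpa using h0
      | succ m => simpa using h m (by omega)
    · intro h
      exact ⟨by simpa using h 0 (by omega), fun m hm => by simpa using h (m + 1) (by omega)⟩

theorem of_succ {n : ℕ} {a : R} (h : VanishesToOrder δ Q (n + 1) a) :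
    VanishesToOrder δ Q n a :=
  iff_forall.2 fun m hm => iff_forall.1 h m (by omega)

theorem add {n : ℕ} {a b : R} (ha : VanishesToOrder δ Q n a) (hb : VanishesToOrder δ Q n b) :
    VanishesToOrder δ Q n (a + b) := by
  induction n generalizing a b with
  | zero => trivial
  | succ n ih =>
    refine ⟨by rw [map_add, ha.1, hb.1, add_zero], ?_⟩
    rw [map_add]
    exact ih ha.2 hb.2

theorem mul_right {n : ℕ} {a : R} (b : R) (ha : VanishesToOrder δ Q n a) :
    VanishesToOrder δ Q n (a * b) := by
  induction n generalizing a b with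
  | zero => trivial
  | succ n ih =>
    refine ⟨by rw [map_mul, ha.1, zero_mul], ?_⟩
    rw [Derivation.leibniz, smul_eq_mul, smul_eq_mul, mul_comm b]
    exact (ih _ ha.of_succ).add (ih _ ha.2)

theorem mul_left {n : ℕ} {a : R} (b : R) (ha : VanishesToOrder δ Q n a) :
    VanishesToOrder δ Q n (b * a) := by
  rw [mul_comm]; exact ha.mul_right b

theorem mul_of_eq_zero {n : ℕ} {a b : R} (ha : VanishesToOrder δ Q n a) (hb : Q b = 0) :
    VanishesToOrder δ Q (n + 1) (a * b) := by
  induction n generalizing a b with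
  | zero => exact ⟨by rw [map_mul, hb, mul_zero], trivial⟩
  | succ n ih =>
    refine ⟨by rw [map_mul, hb, mul_zero], ?_⟩
    rw [Derivation.leibniz, smul_eq_mul, smul_eq_mul, mul_comm b]
    exact (ha.mul_right _).add (ih ha.2 hb)

theorem pow_of_eq_zero {b : R} (hb : Q b = 0) (n : ℕ) :
    VanishesToOrder δ Q n (b ^ n) := by
  induction n with
  | zero => trivial
  | succ n ih => rw [pow_succ]; exact ih.mul_of_eq_zero hb

end VanishesToOrder

theorem eval_iterate_derivation_pow_mul {τ : R} (hτ : Q τ = 0) (n : ℕ) (u : R) :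
    Q (δ^[n] (τ ^ n * u)) = n.factorial * Q (δ τ) ^ n * Q u := by
  induction n generalizing u with
  | zero => simp
  | succ n ih =>
    have h : δ (τ ^ (n + 1) * u) = τ ^ n * ((n + 1 : ℕ) * δ τ * u + τ * δ u) := by
      rw [Derivation.leibniz, Derivation.leibniz_pow]
      simp only [smul_eq_mul, nsmul_eq_mul, Nat.add_sub_cancel]
      ring
    rw [Function.iterate_succ_apply, h, ih]
    simp only [map_add, map_mul, map_natCast, hτ, Nat.factorial_succ]
    push_cast
    ring

theorem iterate_derivation_finset_sum {ι : Type*} (s : Finset ι) (f : ι → R) (n : ℕ) :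
    δ^[n] (∑ i ∈ s, f i) = ∑ i ∈ s, δ^[n] (f i) := by
  induction n generalizing f with
  | zero => simp
  | succ n ih => simp only [Function.iterate_succ_apply, map_sum, ih]

theorem iterate_derivation_mul_of_eq_zero {b : R} (hb : δ b = 0) (a : R) (n : ℕ) :
    δ^[n] (a * b) = δ^[n] a * b := by
  induction n generalizing a with
  | zero => simp
  | succ n ih =>
    rw [Function.iterate_succ_apply, Derivation.leibniz, hb, smul_zero, zero_add, smul_eq_mul,
      mul_comm b, ih, Function.iterate_succ_apply]

theorem iterate_derivation_mem {L : ℕ → Submodule F R} {Δ : ℕ}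
    (hδL : ∀ n, ∀ a ∈ L n, δ a ∈ L (n + Δ)) (m n : ℕ) {a : R} (ha : a ∈ L n) :
    δ^[m] a ∈ L (n + m * Δ) := by
  induction m generalizing n a with
  | zero => simpa using ha
  | succ m ih =>
    rw [Function.iterate_succ_apply, show n + (m + 1) * Δ = n + Δ + m * Δ by ring]
    exact ih _ (hδL _ _ ha)

theorem iterate_derivation_smul (c : F) (a : R) (n : ℕ) : δ^[n] (c • a) = c • δ^[n] a := by
  induction n generalizing a with
  | zero => rfl
  | succ n ih =>
    rw [Function.iterate_succ_apply, Derivation.map_smul, ih, Function.iterate_succ_apply]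

variable (δ) in
/-- The jets of order `M` at the points of `S`. -/
noncomputable def jetMap (S : Finset (R →ₐ[F] F)) (M : ℕ) : R →ₗ[F] (S × Fin M → F) :=
  LinearMap.pi fun i => i.1.1.toLinearMap ∘ₗ (δ.toLinearMap ^ (i.2 : ℕ))

theorem jetMap_apply (S : Finset (R →ₐ[F] F)) (M : ℕ) (a : R) (i : S × Fin M) :
    jetMap δ S M a i = i.1.1 (δ^[i.2] a) := by
  simp [jetMap, Module.End.pow_apply]

theorem jetMap_surjective {p : ℕ} [Fact p.Prime] [CharP F p] {t : R}
    {S : Finset (R →ₐ[F] F)} {M : ℕ} (hS : ∀ Q ∈ S, M ≤ 1 ∨ Q (δ t) ≠ 0) (hM : M ≤ p) :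
    Function.Surjective (jetMap δ S M) := by
  classical
  rw [← LinearMap.range_eq_top]
  by_contra hne
  obtain ⟨f, hf0, hf⟩ := Submodule.exists_le_ker_of_lt_top _ (lt_top_iff_ne_top.2 hne)
  have hfz : ∀ a, f (jetMap δ S M a) = 0 := fun a => hf (LinearMap.mem_range_self _ a)
  have hfsum : ∀ v, f v = ∑ i, v i * f (Pi.single i 1) := by
    intro v
    conv_lhs => rw [← Finset.univ_sum_single v]
    rw [map_sum]
    refine Finset.sum_congr rfl fun i _ => ?_
    rw [show (Pi.single i (v i) : S × Fin M → F) = v i • Pi.single i 1 by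
      rw [← Pi.single_smul, smul_eq_mul, mul_one], map_smul, smul_eq_mul]
  obtain ⟨i₁, hi₁⟩ : ∃ i, f (Pi.single i 1) ≠ 0 := by
    by_contra! h
    exact hf0 (LinearMap.ext fun v => by rw [hfsum]; simp [h])
  obtain ⟨m₀, hm₀, hmax⟩ := Finset.exists_max_image
    (univ.filter fun m : Fin M => f (Pi.single (i₁.1, m) 1) ≠ 0) (fun m => m)
    ⟨i₁.2, by simpa using hi₁⟩
  simp only [mem_filter, mem_univ, true_and] at hm₀ hmax
  set Q₀ := i₁.1 with hQ₀
  have hsep : ∀ Q : R →ₐ[F] F, ∃ s : R, Q ≠ Q₀.1 → Q s = 0 ∧ Q₀.1 s ≠ 0 := by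
    intro Q
    by_cases hQ : Q = Q₀.1
    · exact ⟨0, fun h => absurd hQ h⟩
    · obtain ⟨r, hr⟩ : ∃ r, Q r ≠ Q₀.1 r := by
        by_contra! h
        exact hQ (AlgHom.ext h)
      refine ⟨r - algebraMap F R (Q r), fun _ => ⟨by simp, ?_⟩⟩
      simpa [sub_eq_zero] using hr.symm
  choose s hs using hsep
  set τ : R := t - algebraMap F R (Q₀.1 t) with hτ
  set u : R := ∏ Q ∈ S.erase Q₀.1, s Q ^ M with hu
  have hτ0 : Q₀.1 τ = 0 := by simp [hτ]
  have hδτ : δ τ = δ t := by simp [hτ]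
  have hu0 : Q₀.1 u ≠ 0 := by
    rw [hu, map_prod]
    refine Finset.prod_ne_zero_iff.2 fun Q hQ => ?_
    rw [map_pow]
    exact pow_ne_zero _ (hs Q (Finset.ne_of_mem_erase hQ)).2
  have key := hfz (τ ^ (m₀ : ℕ) * u)
  rw [hfsum, Finset.sum_eq_single (Q₀, m₀)] at key
  · rw [jetMap_apply, eval_iterate_derivation_pow_mul hτ0, hδτ] at key
    have hpow : Q₀.1 (δ t) ^ (m₀ : ℕ) ≠ 0 := by
      rcases hS _ Q₀.2 with h | h
      · rw [show (m₀ : ℕ) = 0 by have := m₀.2; omega, pow_zero]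
        exact one_ne_zero
      · exact pow_ne_zero _ h
    refine mul_ne_zero (mul_ne_zero (mul_ne_zero ?_ hpow) hu0) hm₀ key
    rw [Ne, CharP.cast_eq_zero_iff F p, (Fact.out : p.Prime).dvd_factorial]
    have := m₀.2
    omega
  · rintro ⟨Q, m⟩ - hQm
    rw [jetMap_apply]
    by_cases hQ : Q = Q₀
    · subst hQ
      rcases lt_trichotomy m m₀ with h | h | h
      · rw [VanishesToOrder.iff_forall.1
          ((VanishesToOrder.pow_of_eq_zero hτ0 (m₀ : ℕ)).mul_right u) m h, zero_mul]
      · exact absurd (by rw [h]) hQm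
      · have : f (Pi.single (Q₀, m) 1) = 0 := by
          by_contra h'
          exact absurd (hmax m h') (not_le.2 h)
        rw [this, mul_zero]
    · have hQ' : Q.1 ≠ Q₀.1 := fun h => hQ (Subtype.ext h)
      have hmem : Q.1 ∈ S.erase Q₀.1 := Finset.mem_erase.2 ⟨hQ', Q.2⟩
      have hv : VanishesToOrder δ Q.1 M (τ ^ (m₀ : ℕ) * u) := by
        rw [hu, ← Finset.mul_prod_erase _ _ hmem]
        exact ((VanishesToOrder.pow_of_eq_zero (hs _ hQ').1 M).mul_right _).mul_left _
      rw [VanishesToOrder.iff_forall.1 hv m m.2, zero_mul]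
  · simp

theorem card_mul_le_of_vanishing [IsDomain R] {p : ℕ} [Fact p.Prime] [CharP F p]
    {L : ℕ → Submodule F R} {e γ : ℕ} (hL : IsLinearFiltration L e γ) {t : R}
    {S : Finset (R →ₐ[F] F)} {M : ℕ} (hS : ∀ Q ∈ S, M ≤ 1 ∨ Q (δ t) ≠ 0) (hM : M ≤ p)
    {h : ℕ} {H : R} (hH : H ∈ L h) (hH0 : H ≠ 0)
    (hv : ∀ Q ∈ S, ∀ m < M, Q (δ^[m] H) = 0) :
    #S * M ≤ e * h + γ := by
  classical
  have hsurj := jetMap_surjective (δ := δ) hS hM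
  choose pre hpre using fun i : S × Fin M => hsurj (Pi.single i 1)
  choose d hd using fun i => hL.exists_mem (pre i)
  set N := h + ∑ i, d i with hN
  have hle : ∀ i, d i ≤ N := fun i => by
    have := Finset.single_le_sum (f := d) (fun _ _ => Nat.zero_le _) (Finset.mem_univ i)
    omega
  have := hL.finite N
  have := hL.finite (N - h)
  set Λ : L N →ₗ[F] (S × Fin M → F) := jetMap δ S M ∘ₗ (L N).subtype with hΛ
  have hΛs : LinearMap.range Λ = ⊤ := by
    rw [eq_top_iff]
    intro v _
    refine ⟨⟨∑ i, v i • pre i, Submodule.sum_mem _ fun i _ =>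
      Submodule.smul_mem _ _ (hL.mono (hle i) (hd i))⟩, ?_⟩
    simp only [hΛ, LinearMap.comp_apply, Submodule.subtype_apply, map_sum, map_smul, hpre]
    conv_rhs => rw [← Finset.univ_sum_single v]
    refine Finset.sum_congr rfl fun i _ => ?_
    rw [← Pi.single_smul, smul_eq_mul, mul_one]
  have hrn := LinearMap.finrank_range_add_finrank_ker Λ
  rw [hΛs, finrank_top, Module.finrank_pi, Fintype.card_prod, Fintype.card_coe,
    Fintype.card_fin] at hrn
  let μ : L (N - h) →ₗ[F] L N := LinearMap.codRestrict (L N)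
    (LinearMap.mulLeft F H ∘ₗ (L (N - h)).subtype) (fun a => by
      have := hL.mul_mem hH a.2
      rwa [show h + (N - h) = N by omega] at this)
  have hμ : ∀ a, μ a ∈ LinearMap.ker Λ := by
    intro a
    rw [LinearMap.mem_ker]
    ext i
    have h1 : VanishesToOrder δ i.1.1 M (H * a) :=
      (VanishesToOrder.iff_forall.2 (hv _ i.1.2)).mul_right _
    have h2 : Λ (μ a) i = i.1.1 (δ^[i.2] (H * a)) := jetMap_apply S M (H * a : R) i
    rw [h2, Pi.zero_apply]
    exact VanishesToOrder.iff_forall.1 h1 _ i.2.2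
  have hinj : Function.Injective (LinearMap.codRestrict (LinearMap.ker Λ) μ hμ) := by
    intro a b hab
    have : H * (a : R) = H * b := 
      congrArg (fun x : LinearMap.ker Λ => ((x : L N) : R)) hab
    exact Subtype.ext (mul_left_cancel₀ hH0 this)
  have h1 := LinearMap.finrank_le_finrank_of_injective hinj
  have h2 := hL.le_finrank (N - h)
  have h3 := hL.finrank_le N
  have h4 : e * (N + 1) = e * (N - h + 1) + e * h := by
    rw [← Nat.mul_add]; congr 1; omega
  omega

end Vanishing

section Stepanov

variable {F R R' : Type*} [Field F] [CommRing R] [Algebra F R] [CommRing R'] [Algebra F R']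

theorem eq_zero_of_sum_mul_frobenius_eq_zero [IsDomain R] {p : ℕ} [Fact p.Prime] [CharP F p]
    {L : ℕ → Submodule F R} {e γ : ℕ} (hL : IsLinearFiltration L e γ) {δ : Derivation F R R}
    {t : R} (ht : δ t ≠ 0) (hpt : ∀ H : R, H ≠ 0 → ∃ Q : R →ₐ[F] F, Q H ≠ 0)
    {A r : ℕ} (hA : e * A + γ < p) {a : Fin r → R} (ha : ∀ j, a j ∈ L A)
    (hai : LinearIndependent F a) {c : Fin r → R} (hc : ∀ j, δ (c j) = 0)
    (hsum : ∑ j, a j * c j = 0) : ∀ j, c j = 0 := by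
  by_contra! h
  obtain ⟨j₀, hj₀⟩ := h
  obtain ⟨Q, hQ⟩ := hpt _ (mul_ne_zero ht hj₀)
  rw [map_mul] at hQ
  have hH0 : ∑ j, Q (c j) • a j ≠ 0 := fun h =>
    right_ne_zero_of_mul hQ (Fintype.linearIndependent_iff.1 hai _ h j₀)
  have := card_mul_le_of_vanishing hL (S := {Q}) (δ := δ) (t := t) (p := p) (M := p) (h := A)
    (H := ∑ j, Q (c j) • a j) (by simpa using Or.inr (left_ne_zero_of_mul hQ)) le_rfl
    (Submodule.sum_mem _ fun j _ => Submodule.smul_mem _ _ (ha j)) hH0 (by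
      intro Q' hQ' m _
      rw [Finset.mem_singleton.1 hQ']
      have h1 := congrArg (fun x => Q (δ^[m] x)) hsum
      simp only [iterate_derivation_finset_sum, iterate_derivation_mul_of_eq_zero (hc _),
        map_sum, map_mul] at h1
      simp only [iterate_derivation_finset_sum, iterate_derivation_smul, map_sum, map_smul,
        smul_eq_mul, mul_comm (Q (c _))]
      rw [h1, ← map_zero Q]
      congr 1
      exact iterate_derivation_finset_sum (δ := δ) (∅ : Finset ℕ) (fun _ => 0) m)
  simp at this
  omega

/-- The auxiliary function of Stepanov's method: a nonzero element of small filtration degree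
vanishing to order `M` at all the points under consideration. -/
theorem exists_stepanov_auxiliary [IsDomain R] {p : ℕ} [Fact p.Prime] [CharP F p]
    {L : ℕ → Submodule F R} {e γ : ℕ} (hL : IsLinearFiltration L e γ) {δ : Derivation F R R}
    {Δ : ℕ} (hδL : ∀ n, ∀ a ∈ L n, δ a ∈ L (n + Δ)) {t : R} (ht : δ t ≠ 0)
    (hpt : ∀ H : R, H ≠ 0 → ∃ Q : R →ₐ[F] F, Q H ≠ 0)
    {Φ : R →ₐ[F] R} (hΦ : Function.Injective Φ) (hδΦ : ∀ a, δ (Φ a) = 0)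
    (hΦL : ∀ n, ∀ a ∈ L n, Φ a ∈ L (p * n))
    {L' : ℕ → Submodule F R'} {ρ : ℕ} (hL' : Monotone L')
    (hfin' : ∀ n, Module.Finite F (L' n))
    (hrank' : ∀ n, Module.finrank F (L' n) ≤ ρ * (e * (n + 1)))
    (ι ψ : R →ₐ[F] R')
    (hιψ : ∀ (m n : ℕ) (a b : R), a ∈ L m → b ∈ L n → ι a * ψ b ∈ L' (m + n))
    {A B M : ℕ} (hA : e * A + γ < p)
    (hdim : M * (ρ * (e * (A + B + M * Δ + 1))) <
      Module.finrank F (L A) * Module.finrank F (L B)) :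
    ∃ H ∈ L (A + p * B), H ≠ 0 ∧ ∀ (Q : R →ₐ[F] F) (Q' : R' →ₐ[F] F),
      (∀ a, Q' (ι a) = Q a) → (∀ a, Q' (ψ a) = Q (Φ a)) → ∀ m < M, Q (δ^[m] H) = 0 := by
  have := hL.finite A
  have := hL.finite B
  set r := Module.finrank F (L A) with hr
  let bA := Module.finBasis F (L A)
  set a : Fin r → R := fun j => (bA j : R) with ha
  have hai : LinearIndependent F a := bA.linearIndependent.map' (L A).subtype (by simp)
  have haL : ∀ j, a j ∈ L A := fun j => (bA j).2
  set N := A + B + M * Δ with hN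
  have hfinN := hfin' N
  let Θ : (Fin r → L B) →ₗ[F] (Fin M → L' N) := LinearMap.pi fun m =>
    LinearMap.codRestrict (L' N)
      (∑ j, LinearMap.mulLeft F (ι (δ^[m] (a j))) ∘ₗ ψ.toLinearMap ∘ₗ (L B).subtype ∘ₗ
        LinearMap.proj j) (by
      intro b
      simp only [LinearMap.sum_apply]
      refine Submodule.sum_mem _ fun j _ => ?_
      refine hL' (?_ : A + m * Δ + B ≤ N)
        (hιψ _ _ _ _ (iterate_derivation_mem hδL m A (haL j)) (b j).2)
      have : (m : ℕ) * Δ ≤ M * Δ := Nat.mul_le_mul_right _ m.2.le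
      omega)
  have hker : LinearMap.ker Θ ≠ ⊥ := by
    apply LinearMap.ker_ne_bot_of_finrank_lt
    rw [Module.finrank_pi_fintype, Module.finrank_pi_fintype]
    simp only [Finset.sum_const, Finset.card_univ, Fintype.card_fin, smul_eq_mul]
    exact lt_of_le_of_lt (Nat.mul_le_mul_left _ (hrank' N)) hdim
  obtain ⟨b, hb, hb0⟩ := (Submodule.ne_bot_iff _).1 hker
  have hbm : ∀ m < M, ∑ j, ι (δ^[m] (a j)) * ψ (b j) = 0 := by
    intro m hm
    have h1 := congrArg (fun f : Fin M → L' N => ((f ⟨m, hm⟩ : L' N) : R')) (LinearMap.mem_ker.1 hb)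
    simpa [Θ, LinearMap.sum_apply] using h1
  have hpB : ∀ j, Φ (b j) ∈ L (p * B) := fun j => hΦL _ _ (b j).2
  refine ⟨∑ j, a j * Φ (b j), Submodule.sum_mem _ fun j _ => hL.mul_mem (haL j) (hpB j), ?_, ?_⟩
  · intro h0
    have h1 := eq_zero_of_sum_mul_frobenius_eq_zero hL ht hpt hA haL hai
      (fun j => hδΦ (b j)) h0
    refine hb0 (funext fun j => Subtype.ext (hΦ ?_))
    rw [h1 j]
    simp
  · intro Q Q' h1 h2 m hm
    have h3 := congrArg Q' (hbm m hm)
    simp only [map_sum, map_mul, map_zero, h1, h2] at h3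
    simp only [iterate_derivation_finset_sum, iterate_derivation_mul_of_eq_zero (hδΦ _),
      map_sum, map_mul]
    exact h3

theorem stepanov_dimension_count {p e γ ρ Δ G M β₀ A B r s : ℕ}
    (hG : γ + ρ ^ 2 + ρ * (e * Δ) + e + 1 ≤ G) (hM1 : M * M ≤ p) (hM3 : 6 * G * ρ ≤ M)
    (hpG : 36 * (G * G) ≤ p) (hγp : 2 * γ + 1 ≤ p) (hβ₀ : β₀ = γ + ρ ^ 2 + ρ * (e * Δ) + 1)
    (hA1 : e * A ≤ p - 1 - γ) (hA2 : p - 1 - γ < e * (A + 1))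
    (hB1 : e * B ≤ ρ * M + β₀ - 1) (hB2 : ρ * M + β₀ - 1 < e * (B + 1))
    (hr : e * (A + 1) ≤ r + γ) (hs : e * (B + 1) ≤ s + γ) :
    M * (ρ * (e * (A + B + M * Δ + 1))) < r * s := by
  have hp0 : 0 < p := by omega
  obtain ⟨Y, hY⟩ : ∃ Y, Y = e * (B + 1) := ⟨_, rfl⟩
  obtain ⟨β, hβ⟩ : ∃ β, Y = ρ * M + β := Nat.exists_eq_add_of_le (by omega)
  have hβG : β ≤ G := by
    have : e * (B + 1) = e * B + e := by ring
    omega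
  have hββ : β₀ ≤ β := by omega
  have e1 : M * (ρ * (e * (A + B + M * Δ + 1))) =
      ρ * M * (e * A) + ρ * M * Y + ρ * (e * Δ) * (M * M) := by rw [hY]; ring
  have e2 : ρ * M * (e * A) ≤ ρ * M * p := Nat.mul_le_mul_left _ (by omega)
  have e3 : ρ * (e * Δ) * (M * M) ≤ ρ * (e * Δ) * p := Nat.mul_le_mul_left _ hM1
  have e4 : ρ * M * Y ≤ ρ ^ 2 * p + ρ * M * G := by
    rw [hβ]
    nlinarith [Nat.mul_le_mul_left (ρ ^ 2) hM1, Nat.mul_le_mul_left (ρ * M) hβG]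
  have hγG : γ ≤ G := by omega
  have e5 : 2 * γ * Y ≤ 2 * G * (ρ * M + G) := by
    rw [hβ]
    exact Nat.mul_le_mul (by omega) (by omega)
  have e6 : 6 * G * ρ * M ≤ p := le_trans (Nat.mul_le_mul_right _ hM3) hM1
  have hr' : p ≤ r + 2 * γ := by omega
  have hs' : Y ≤ s + γ := by omega
  obtain ⟨p', hp'⟩ : ∃ p', p = p' + 2 * γ := Nat.exists_eq_add_of_le' (by omega)
  obtain ⟨Y', hY'⟩ : ∃ Y', Y = Y' + γ := Nat.exists_eq_add_of_le' (by omega)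
  have e7 : p' * Y' ≤ r * s := Nat.mul_le_mul (by omega) (by omega)
  have e8 : p * Y ≤ p' * Y' + 2 * γ * Y + γ * p := by
    rw [hY', hp']; ring_nf; omega
  have e9 : p * Y = ρ * M * p + β * p := by rw [hβ]; ring
  have e10 : (γ + ρ ^ 2 + ρ * (e * Δ) + 1) * p ≤ β * p := 
    Nat.mul_le_mul_right _ (hβ₀ ▸ hββ)
  have e11 : p = p' + 2 * γ := hp'
  nlinarith only [e1, e2, e3, e4, e5, e6, e7, e8, e9, e10, hpG, hp0]

theorem stepanov_card_le [IsDomain R] {p : ℕ} [Fact p.Prime] [CharP F p]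
    {L : ℕ → Submodule F R} {e γ : ℕ} (he : 1 ≤ e) (hL : IsLinearFiltration L e γ)
    {δ : Derivation F R R}
    {Δ : ℕ} (hδL : ∀ n, ∀ a ∈ L n, δ a ∈ L (n + Δ)) {t : R} (ht1 : δ t ∈ L (1 + Δ))
    (ht : δ t ≠ 0)
    (hpt : ∀ H : R, H ≠ 0 → ∃ Q : R →ₐ[F] F, Q H ≠ 0)
    {Φ : R →ₐ[F] R} (hΦ : Function.Injective Φ) (hδΦ : ∀ a, δ (Φ a) = 0)
    (hΦL : ∀ n, ∀ a ∈ L n, Φ a ∈ L (p * n))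
    {L' : ℕ → Submodule F R'} {ρ : ℕ} (hρ : 1 ≤ ρ) (hL' : Monotone L')
    (hfin' : ∀ n, Module.Finite F (L' n))
    (hrank' : ∀ n, Module.finrank F (L' n) ≤ ρ * (e * (n + 1)))
    (ι ψ : R →ₐ[F] R')
    (hιψ : ∀ (m n : ℕ) (a b : R), a ∈ L m → b ∈ L n → ι a * ψ b ∈ L' (m + n))
    {S : Finset (R →ₐ[F] F)}
    (hS : ∀ Q ∈ S, ∃ Q' : R' →ₐ[F] F, (∀ a, Q' (ι a) = Q a) ∧ ∀ a, Q' (ψ a) = Q (Φ a))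
    {G : ℕ} (hG : γ + ρ ^ 2 + ρ * (e * Δ) + e + 1 ≤ G) (hp : (6 * G * ρ) ^ 2 ≤ p) :
    #S ≤ ρ * p + 4 * G * Nat.sqrt p := by
  classical
  set M := Nat.sqrt p with hM
  have hM1 : M * M ≤ p := Nat.sqrt_le p
  have hM2 : p ≤ M * M + M + M := Nat.sqrt_le_add p
  have hM3 : 6 * G * ρ ≤ M := Nat.le_sqrt'.2 hp
  have hG1 : 1 ≤ G := by omega
  have hM4 : 6 * G ≤ M := le_trans (Nat.le_mul_of_pos_right _ hρ) hM3
  set β₀ := γ + ρ ^ 2 + ρ * (e * Δ) + 1 with hβ₀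
  set A := (p - 1 - γ) / e with hA
  set B := (ρ * M + β₀ - 1) / e with hB
  have hpG : 36 * (G * G) ≤ p := by nlinarith only [hM1, hM4]
  have hGG : G ≤ G * G := Nat.le_mul_self G
  have hγp : 2 * γ + 1 ≤ p := by omega
  have hA1 : e * A ≤ p - 1 - γ := Nat.mul_div_le _ _
  have hA2 : p - 1 - γ < e * (A + 1) := by
    rw [hA]; exact Nat.lt_mul_div_succ _ he
  have hB1 : e * B ≤ ρ * M + β₀ - 1 := Nat.mul_div_le _ _
  have hB2 : ρ * M + β₀ - 1 < e * (B + 1) := by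
    rw [hB]; exact Nat.lt_mul_div_succ _ he
  have hdim : M * (ρ * (e * (A + B + M * Δ + 1))) <
      Module.finrank F (L A) * Module.finrank F (L B) := by
    exact stepanov_dimension_count hG hM1 hM3 hpG (by omega) hβ₀ hA1 hA2 hB1 hB2
      (hL.le_finrank A) (hL.le_finrank B)
  obtain ⟨H, hHL, hH0, hH⟩ := exists_stepanov_auxiliary hL hδL ht hpt hΦ hδΦ hΦL hL' hfin' hrank'
    ι ψ hιψ (by omega) hdim
  have hgood : #{Q ∈ S | Q (δ t) ≠ 0} * M ≤ e * (A + p * B) + γ := by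
    refine card_mul_le_of_vanishing hL (δ := δ) (t := t) (p := p)
      (fun Q hQ => Or.inr (Finset.mem_filter.1 hQ).2) ((Nat.le_mul_self M).trans hM1) hHL hH0 ?_
    intro Q hQ
    obtain ⟨Q', h1, h2⟩ := hS Q (Finset.mem_filter.1 hQ).1
    exact hH Q Q' h1 h2
  have hbad : #{Q ∈ S | ¬ Q (δ t) ≠ 0} * 1 ≤ e * (1 + Δ) + γ := by
    refine card_mul_le_of_vanishing hL (δ := δ) (t := t) (p := p)
      (fun Q _ => Or.inl le_rfl) (Fact.out : p.Prime).one_lt.le ht1 ht ?_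
    intro Q hQ m hm
    rw [Nat.lt_one_iff.1 hm]
    simpa using (Finset.mem_filter.1 hQ).2
  rw [← Finset.card_filter_add_card_filter_not (fun Q : R →ₐ[F] F => Q (δ t) ≠ 0)]
  have hbad' : #{Q ∈ S | ¬ Q (δ t) ≠ 0} ≤ G := by
    have : e * Δ ≤ ρ * (e * Δ) := Nat.le_mul_of_pos_left _ hρ
    have : e * (1 + Δ) = e + e * Δ := by ring
    omega
  have hgood' : #{Q ∈ S | Q (δ t) ≠ 0} ≤ ρ * p + (M + 2) * G := by
    refine Nat.le_of_mul_le_mul_right (c := M) ?_ (by omega)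
    refine hgood.trans ?_
    have f1 : e * (A + p * B) + γ ≤ p * (1 + e * B) := by
      have : e * (A + p * B) = e * A + p * (e * B) := by ring
      have : p * (1 + e * B) = p + p * (e * B) := by ring
      omega
    have f2 : p * (1 + e * B) ≤ p * (ρ * M + G) := Nat.mul_le_mul_left _ (by omega)
    nlinarith only [f1, f2, Nat.mul_le_mul_right G hM2]
  have : (M + 2) * G + G ≤ 4 * G * M := by nlinarith only [hM4, hG1, Nat.mul_le_mul_left G hM4]
  omega

end Stepanov

section Curve

open MvPolynomial

variable {F : Type*} [Field F]

theorem totalDegree_pderiv_le {σ : Type*} (i : σ) (f : MvPolynomial σ F) :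
    (pderiv i f).totalDegree ≤ f.totalDegree := by
  classical
  refine Finset.sup_le fun m hm => ?_
  have h1 : coeff (m + Finsupp.single i 1) f ≠ 0 := by
    rw [mem_support_iff, coeff_pderiv] at hm
    exact left_ne_zero_of_mul hm
  refine le_trans ?_ (le_totalDegree (mem_support_iff.2 h1))
  rw [Finsupp.sum_add_index' (fun _ => rfl) (fun _ _ _ => rfl)]
  exact Nat.le_add_right _ _

theorem totalDegree_aeval_le {σ τ : Type*} {g : σ → MvPolynomial τ F}
    (hg : ∀ i, (g i).totalDegree ≤ 1) (f : MvPolynomial σ F) :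
    (aeval g f).totalDegree ≤ f.totalDegree := by
  classical
  rw [aeval_def, eval₂_eq]
  refine totalDegree_finsetSum_le fun d hd => ?_
  refine (totalDegree_mul _ _).trans ?_
  rw [algebraMap_eq, totalDegree_C, zero_add]
  refine (totalDegree_finsetProd _ _).trans ?_
  refine le_trans (Finset.sum_le_sum (g := fun i => d i) fun i _ => ?_) (le_totalDegree hd)
  refine (totalDegree_pow _ _).trans ?_
  simpa using Nat.mul_le_mul_left (d i) (hg i)

/-- The ideal of the curve `q₁ = q₂ = 0` in affine three-space. -/
noncomputable def curveIdeal (q₁ q₂ : MvPolynomial (Fin 3) F) : Ideal (MvPolynomial (Fin 3) F) :=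
  Ideal.span {q₁, q₂}

abbrev CurveRing (q₁ q₂ : MvPolynomial (Fin 3) F) : Type _ :=
  MvPolynomial (Fin 3) F ⧸ curveIdeal q₁ q₂

noncomputable abbrev curveMk (q₁ q₂ : MvPolynomial (Fin 3) F) :
    MvPolynomial (Fin 3) F →ₐ[F] CurveRing q₁ q₂ :=
  Ideal.Quotient.mkₐ F (curveIdeal q₁ q₂)

/-- Filtration of the coordinate ring by the degree of polynomial representatives. -/
noncomputable def curveFiltration (q₁ q₂ : MvPolynomial (Fin 3) F) (n : ℕ) :
    Submodule F (CurveRing q₁ q₂) :=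
  (restrictTotalDegree (Fin 3) F n).map (curveMk q₁ q₂).toLinearMap

variable {q₁ q₂ : MvPolynomial (Fin 3) F}

theorem curveMk_mem {n : ℕ} {f : MvPolynomial (Fin 3) F} (hf : f.totalDegree ≤ n) :
    curveMk q₁ q₂ f ∈ curveFiltration q₁ q₂ n :=
  ⟨f, (mem_restrictTotalDegree _ _ _).2 hf, rfl⟩

theorem exists_of_mem_curveFiltration {n : ℕ} {a : CurveRing q₁ q₂}
    (ha : a ∈ curveFiltration q₁ q₂ n) :
    ∃ f : MvPolynomial (Fin 3) F, f.totalDegree ≤ n ∧ curveMk q₁ q₂ f = a := by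
  obtain ⟨f, hf, rfl⟩ := ha
  exact ⟨f, (mem_restrictTotalDegree _ _ _).1 hf, rfl⟩

theorem curveMk_surjective : Function.Surjective (curveMk q₁ q₂) :=
  Ideal.Quotient.mk_surjective

theorem curveMk_eq_zero {f : MvPolynomial (Fin 3) F} :
    curveMk q₁ q₂ f = 0 ↔ f ∈ curveIdeal q₁ q₂ := Ideal.Quotient.eq_zero_iff_mem

theorem curveFiltration_mono : Monotone (curveFiltration q₁ q₂) := by
  intro m n hmn a ha
  obtain ⟨f, hf, rfl⟩ := exists_of_mem_curveFiltration ha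
  exact curveMk_mem (hf.trans hmn)

theorem curveFiltration_mul_mem {m n : ℕ} {a b : CurveRing q₁ q₂}
    (ha : a ∈ curveFiltration q₁ q₂ m) (hb : b ∈ curveFiltration q₁ q₂ n) :
    a * b ∈ curveFiltration q₁ q₂ (m + n) := by
  obtain ⟨f, hf, rfl⟩ := exists_of_mem_curveFiltration ha
  obtain ⟨g, hg, rfl⟩ := exists_of_mem_curveFiltration hb
  rw [← map_mul]
  exact curveMk_mem ((totalDegree_mul _ _).trans (add_le_add hf hg))

theorem curveFiltration_exists_mem (a : CurveRing q₁ q₂) :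
    ∃ n, a ∈ curveFiltration q₁ q₂ n := by
  obtain ⟨f, rfl⟩ := curveMk_surjective a
  exact ⟨_, curveMk_mem le_rfl⟩

instance curveFiltration_finite (n : ℕ) : Module.Finite F (curveFiltration q₁ q₂ n) := by
  unfold curveFiltration; infer_instance

/-- The monomial `x ^ i * y ^ j * z ^ m`. -/
def tripleMonomial {R : Type*} [CommRing R] (v : Fin 3 → R) (k : ℕ × ℕ × ℕ) : R :=
  v 0 ^ k.1 * v 1 ^ k.2.1 * v 2 ^ k.2.2

/-- Exponents of the normal monomials of total degree at most `n`. -/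
def normalExponents (d₁ d₂ n : ℕ) : Set (ℕ × ℕ × ℕ) :=
  {k | k.2.1 < d₁ ∧ k.2.2 < d₂ ∧ k.1 + k.2.1 + k.2.2 ≤ n}

/-- `q₁` is monic in the second variable, `q₂` in the third, and both have total degree
equal to the degree in that variable. -/
structure IsTriangular (q₁ q₂ : MvPolynomial (Fin 3) F) (d₁ d₂ : ℕ) : Prop where
  deg₁ : q₁.totalDegree ≤ d₁
  deg₂ : q₂.totalDegree ≤ d₂
  lead₁ : X 1 ^ d₁ - q₁ ∈ Submodule.span F
    (tripleMonomial X '' {k | k.2.1 < d₁ ∧ k.2.2 = 0 ∧ k.1 + k.2.1 ≤ d₁})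
  lead₂ : X 2 ^ d₂ - q₂ ∈ Submodule.span F
    (tripleMonomial X '' {k | k.2.2 < d₂ ∧ k.1 + k.2.1 + k.2.2 ≤ d₂})

theorem tripleMonomial_mul {R : Type*} [CommRing R] (v : Fin 3 → R) (k l : ℕ × ℕ × ℕ) :
    tripleMonomial v k * tripleMonomial v l = tripleMonomial v (k + l) := by
  simp only [tripleMonomial, Prod.fst_add, Prod.snd_add, pow_add]; ring

theorem map_tripleMonomial {R R' : Type*} [CommRing R] [CommRing R'] [Algebra F R] [Algebra F R']
    (φ : R →ₐ[F] R') (v : Fin 3 → R) (k : ℕ × ℕ × ℕ) :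
    φ (tripleMonomial v k) = tripleMonomial (φ ∘ v) k := by
  simp [tripleMonomial]

theorem mul_mem_span_tripleMonomial {R : Type*} [CommRing R] [Algebra F R] {v : Fin 3 → R}
    {s : Set (ℕ × ℕ × ℕ)} {W : Submodule F R} {k : ℕ × ℕ × ℕ} {a : R}
    (ha : a ∈ Submodule.span F (tripleMonomial v '' s))
    (h : ∀ l ∈ s, tripleMonomial v (k + l) ∈ W) : tripleMonomial v k * a ∈ W := by
  have : Submodule.span F (tripleMonomial v '' s) ≤
      W.comap (LinearMap.mulLeft F (tripleMonomial v k)) := by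
    rw [Submodule.span_le]
    rintro _ ⟨l, hl, rfl⟩
    simpa [tripleMonomial_mul] using h l hl
  exact this ha

theorem tripleMonomial_mem_normal {R : Type*} [CommRing R] [Algebra F R] {v : Fin 3 → R}
    {d₁ d₂ : ℕ}
    (h₁ : v 1 ^ d₁ ∈ Submodule.span F
      (tripleMonomial v '' {k | k.2.1 < d₁ ∧ k.2.2 = 0 ∧ k.1 + k.2.1 ≤ d₁}))
    (h₂ : v 2 ^ d₂ ∈ Submodule.span F
      (tripleMonomial v '' {k | k.2.2 < d₂ ∧ k.1 + k.2.1 + k.2.2 ≤ d₂}))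
    {n : ℕ} (k : ℕ × ℕ × ℕ) (hk : k.1 + k.2.1 + k.2.2 ≤ n) :
    tripleMonomial v k ∈ Submodule.span F (tripleMonomial v '' normalExponents d₁ d₂ n) := by
  have step₁ : ∀ j i m : ℕ, m < d₂ → i + j + m ≤ n → tripleMonomial v (i, j, m) ∈
      Submodule.span F (tripleMonomial v '' normalExponents d₁ d₂ n) := by
    intro j
    induction j using Nat.strong_induction_on with
    | _ j ih =>
      intro i m hm hn
      rcases lt_or_ge j d₁ with hj | hj
      · exact Submodule.subset_span ⟨_, ⟨hj, hm, hn⟩, rfl⟩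
      · have e : tripleMonomial v (i, j, m) = tripleMonomial v (i, j - d₁, m) * v 1 ^ d₁ := by
          have : v 1 ^ j = v 1 ^ (j - d₁) * v 1 ^ d₁ := by rw [← pow_add]; congr 1; omega
          simp only [tripleMonomial, this]; ring
        rw [e]
        refine mul_mem_span_tripleMonomial h₁ ?_
        rintro ⟨a, b, c⟩ ⟨hb, hc, hab⟩
        simp only at hb hc hab
        subst hc
        exact ih (j - d₁ + b) (by omega) (i + a) m hm (by omega)
  have step₂ : ∀ m i j : ℕ, i + j + m ≤ n → tripleMonomial v (i, j, m) ∈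
      Submodule.span F (tripleMonomial v '' normalExponents d₁ d₂ n) := by
    intro m
    induction m using Nat.strong_induction_on with
    | _ m ih =>
      intro i j hn
      rcases lt_or_ge m d₂ with hm | hm
      · exact step₁ _ _ _ hm hn
      · have e : tripleMonomial v (i, j, m) = tripleMonomial v (i, j, m - d₂) * v 2 ^ d₂ := by
          have : v 2 ^ m = v 2 ^ (m - d₂) * v 2 ^ d₂ := by rw [← pow_add]; congr 1; omega
          simp only [tripleMonomial, this]; ring
        rw [e]
        refine mul_mem_span_tripleMonomial h₂ ?_
        rintro ⟨a, b, c⟩ ⟨hc, habc⟩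
        simp only at hc habc
        exact ih (m - d₂ + c) (by omega) (i + a) (j + b) (by omega)
  exact step₂ _ _ _ hk

theorem curveFiltration_le_span {d₁ d₂ : ℕ} (h : IsTriangular q₁ q₂ d₁ d₂) (n : ℕ) :
    curveFiltration q₁ q₂ n ≤ Submodule.span F
      (tripleMonomial (curveMk q₁ q₂ ∘ X) '' normalExponents d₁ d₂ n) := by
  intro a ha
  obtain ⟨f, hf, rfl⟩ := exists_of_mem_curveFiltration ha
  have key : ∀ (s : Set (ℕ × ℕ × ℕ)) (g q : MvPolynomial (Fin 3) F), q ∈ curveIdeal q₁ q₂ →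
      g - q ∈ Submodule.span F (tripleMonomial X '' s) →
      curveMk q₁ q₂ g ∈ Submodule.span F (tripleMonomial (curveMk q₁ q₂ ∘ X) '' s) := by
    intro s g q hq hg
    have h1 := Submodule.mem_map_of_mem (f := (curveMk q₁ q₂).toLinearMap) hg
    rw [Submodule.map_span, ← Set.image_comp] at h1
    have h2 : (curveMk q₁ q₂).toLinearMap (g - q) = curveMk q₁ q₂ g := by
      rw [AlgHom.toLinearMap_apply, map_sub, curveMk_eq_zero.2 hq, sub_zero]
    have h3 : (curveMk q₁ q₂).toLinearMap ∘ tripleMonomial X =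
        tripleMonomial (curveMk q₁ q₂ ∘ X) := funext fun k => map_tripleMonomial (curveMk q₁ q₂) X k
    rwa [h2, h3] at h1
  have h₁ := key _ _ q₁ (Ideal.subset_span (by simp)) h.lead₁
  have h₂ := key _ _ q₂ (Ideal.subset_span (by simp)) h.lead₂
  rw [map_pow] at h₁ h₂
  rw [f.as_sum, map_sum]
  refine Submodule.sum_mem _ fun d hd => ?_
  have e : curveMk q₁ q₂ (monomial d (coeff d f)) =
      coeff d f • tripleMonomial (curveMk q₁ q₂ ∘ X) (d 0, d 1, d 2) := by
    rw [← map_tripleMonomial, ← map_smul, monomial_eq, Finsupp.prod_fintype _ _ (by simp),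
      Fin.prod_univ_three, smul_eq_C_mul]
    rfl
  rw [e]
  refine Submodule.smul_mem _ _ (tripleMonomial_mem_normal h₁ h₂ _ ?_)
  refine le_trans ?_ hf
  refine le_trans (le_of_eq ?_) (le_totalDegree hd)
  rw [Finsupp.sum_fintype _ _ (by simp), Fin.sum_univ_three]

theorem normalExponents_subset (d₁ d₂ n : ℕ) :
    normalExponents d₁ d₂ n ⊆ ↑(range (n + 1) ×ˢ range d₁ ×ˢ range d₂) := by
  rintro ⟨i, j, m⟩ ⟨h1, h2, h3⟩
  simp only at h1 h2 h3
  simp only [coe_product, Set.mem_prod, Finset.mem_coe, Finset.mem_range]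
  omega

theorem curveFiltration_finrank_le {d₁ d₂ : ℕ} (h : IsTriangular q₁ q₂ d₁ d₂) (n : ℕ) :
    Module.finrank F (curveFiltration q₁ q₂ n) ≤ d₁ * d₂ * (n + 1) := by
  classical
  set T := (range (n + 1) ×ˢ range d₁ ×ˢ range d₂).image
    (tripleMonomial (curveMk q₁ q₂ ∘ X)) with hT
  have h1 : curveFiltration q₁ q₂ n ≤ Submodule.span F (T : Set (CurveRing q₁ q₂)) := by
    refine (curveFiltration_le_span h n).trans (Submodule.span_mono ?_)
    rw [hT, coe_image]
    exact Set.image_mono (normalExponents_subset _ _ _)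
  refine (Submodule.finrank_mono h1).trans ((finrank_span_finset_le_card T).trans ?_)
  refine Finset.card_image_le.trans ?_
  simp only [card_product, card_range]
  exact le_of_eq (by ring)

end Curve

section CurveField

open MvPolynomial

variable {F : Type*} [Field F] {q₁ q₂ : MvPolynomial (Fin 3) F}

/-- A generic point of the curve `q₁ = q₂ = 0`: a solution in an extension field at which the
normal monomials are linearly independent and which is a smooth point. -/
structure IsGenericCurvePoint (q₁ q₂ : MvPolynomial (Fin 3) F) (d₁ d₂ : ℕ) {Ω : Type*} [Field Ω]
    [Algebra F Ω] (v : Fin 3 → Ω) : Prop where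
  zero₁ : aeval v q₁ = 0
  zero₂ : aeval v q₂ = 0
  indep : LinearIndepOn F (tripleMonomial v) {k | k.2.1 < d₁ ∧ k.2.2 < d₂}
  smooth : aeval v (pderiv 1 q₁ * pderiv 2 q₂ - pderiv 2 q₁ * pderiv 1 q₂) ≠ 0

theorem left_mem_curveIdeal : q₁ ∈ curveIdeal q₁ q₂ := Ideal.subset_span (by simp)

theorem right_mem_curveIdeal : q₂ ∈ curveIdeal q₁ q₂ := Ideal.subset_span (by simp)

theorem curveIdeal_le_ker {A : Type*} [CommRing A] (φ : MvPolynomial (Fin 3) F →+* A)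
    (h₁ : φ q₁ = 0) (h₂ : φ q₂ = 0) : curveIdeal q₁ q₂ ≤ RingHom.ker φ := by
  rw [curveIdeal, Ideal.span_le]
  rintro f (rfl | rfl)
  · exact h₁
  · exact h₂

/-- Algebra homomorphisms out of the coordinate ring from solutions of the equations. -/
noncomputable def curveLift {A : Type*} [CommRing A] [Algebra F A] (v : Fin 3 → A)
    (h₁ : aeval v q₁ = 0) (h₂ : aeval v q₂ = 0) : CurveRing q₁ q₂ →ₐ[F] A :=
  Ideal.Quotient.liftₐ _ (aeval v)
    (fun _ ha => curveIdeal_le_ker (aeval v : MvPolynomial (Fin 3) F →ₐ[F] A).toRingHom h₁ h₂ ha)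

theorem curveLift_mk {A : Type*} [CommRing A] [Algebra F A] (v : Fin 3 → A)
    (h₁ : aeval v q₁ = 0) (h₂ : aeval v q₂ = 0) (f : MvPolynomial (Fin 3) F) :
    curveLift v h₁ h₂ (curveMk q₁ q₂ f) = aeval v f := rfl

theorem curveLift_tripleMonomial {A : Type*} [CommRing A] [Algebra F A] (v : Fin 3 → A)
    (h₁ : aeval v q₁ = 0) (h₂ : aeval v q₂ = 0) (k : ℕ × ℕ × ℕ) :
    curveLift v h₁ h₂ (tripleMonomial (curveMk q₁ q₂ ∘ X) k) = tripleMonomial v k := by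
  rw [← map_tripleMonomial, curveLift_mk, map_tripleMonomial]
  congr 1
  funext i
  exact aeval_X _ _

section Generic

variable {d₁ d₂ : ℕ} {Ω : Type*} [Field Ω] [Algebra F Ω] {v : Fin 3 → Ω}

theorem IsGenericCurvePoint.lift_injective (ht : IsTriangular q₁ q₂ d₁ d₂)
    (hv : IsGenericCurvePoint q₁ q₂ d₁ d₂ v) :
    Function.Injective (curveLift v hv.zero₁ hv.zero₂) := by
  rw [injective_iff_map_eq_zero]
  intro a ha
  obtain ⟨n, hn⟩ := curveFiltration_exists_mem a
  have h1 := curveFiltration_le_span ht n hn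
  obtain ⟨l, hl, rfl⟩ := (Finsupp.mem_span_image_iff_linearCombination F).1 h1
  have h2 : Finsupp.linearCombination F (tripleMonomial v) l = 0 := by
    have h3 := Finsupp.apply_linearCombination F (curveLift v hv.zero₁ hv.zero₂).toLinearMap
      (tripleMonomial (curveMk q₁ q₂ ∘ X)) l
    rw [AlgHom.toLinearMap_apply, ha] at h3
    rw [h3]
    congr 1
    congr 1
    funext k
    exact (curveLift_tripleMonomial v hv.zero₁ hv.zero₂ k).symm
  have hsub : normalExponents d₁ d₂ n ⊆ {k : ℕ × ℕ × ℕ | k.2.1 < d₁ ∧ k.2.2 < d₂} :=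
    fun k hk => ⟨hk.1, hk.2.1⟩
  have h3 := (linearIndepOn_iff.1 hv.indep) l (Finsupp.supported_mono hsub hl) h2
  rw [h3, map_zero]

theorem IsGenericCurvePoint.isDomain (ht : IsTriangular q₁ q₂ d₁ d₂)
    (hv : IsGenericCurvePoint q₁ q₂ d₁ d₂ v) : IsDomain (CurveRing q₁ q₂) :=
  (hv.lift_injective ht).isDomain (curveLift v hv.zero₁ hv.zero₂).toRingHom

theorem tripleMonomial_mem_curveFiltration {n : ℕ} {k : ℕ × ℕ × ℕ}
    (hk : k.1 + k.2.1 + k.2.2 ≤ n) :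
    tripleMonomial (curveMk q₁ q₂ ∘ X) k ∈ curveFiltration q₁ q₂ n := by
  rw [← map_tripleMonomial]
  refine curveMk_mem ?_
  refine (totalDegree_mul _ _).trans (le_trans (add_le_add (totalDegree_mul _ _) le_rfl) ?_)
  simpa [totalDegree_X_pow] using hk

theorem IsGenericCurvePoint.le_finrank (hv : IsGenericCurvePoint q₁ q₂ d₁ d₂ v) (n : ℕ) :
    d₁ * d₂ * (n + 1) ≤
      Module.finrank F (curveFiltration q₁ q₂ n) + d₁ * d₂ * (d₁ + d₂) := by
  rcases lt_or_ge n (d₁ + d₂) with hn | hn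
  · exact (Nat.mul_le_mul_left _ hn).trans (Nat.le_add_left _ _)
  obtain ⟨N, rfl⟩ := Nat.exists_eq_add_of_le' hn
  let w : Fin (N + 1) × Fin d₁ × Fin d₂ → curveFiltration q₁ q₂ (N + (d₁ + d₂)) := fun k =>
    ⟨tripleMonomial (curveMk q₁ q₂ ∘ X) (k.1, k.2.1, k.2.2),
      tripleMonomial_mem_curveFiltration (by
        have := k.1.2; have := k.2.1.2; have := k.2.2.2; simp only; omega)⟩
  have hw : LinearIndependent F w := by
    apply LinearIndependent.of_comp (Submodule.subtype _)
    apply LinearIndependent.of_comp (curveLift v hv.zero₁ hv.zero₂).toLinearMap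
    let f : Fin (N + 1) × Fin d₁ × Fin d₂ → {k : ℕ × ℕ × ℕ | k.2.1 < d₁ ∧ k.2.2 < d₂} :=
      fun k => ⟨(k.1, k.2.1, k.2.2), k.2.1.2, k.2.2.2⟩
    have hf : Function.Injective f := by
      rintro ⟨a, b, c⟩ ⟨a', b', c'⟩ h
      simp only [f, Subtype.mk.injEq, Prod.mk.injEq] at h
      ext <;> simp [h]
    have hfw : (curveLift v hv.zero₁ hv.zero₂).toLinearMap ∘
        ((curveFiltration q₁ q₂ (N + (d₁ + d₂))).subtype ∘ w) =
        (fun k : {k : ℕ × ℕ × ℕ | k.2.1 < d₁ ∧ k.2.2 < d₂} => tripleMonomial v k) ∘ f :=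
      funext fun k => curveLift_tripleMonomial v hv.zero₁ hv.zero₂ _
    rw [hfw]
    exact LinearIndependent.comp hv.indep f hf
  have := hw.fintype_card_le_finrank
  simp only [Fintype.card_prod, Fintype.card_fin] at this
  have e : d₁ * d₂ * (N + (d₁ + d₂) + 1) = (N + 1) * (d₁ * d₂) + d₁ * d₂ * (d₁ + d₂) := by ring
  rw [e]
  exact Nat.add_le_add_right this _

theorem IsGenericCurvePoint.isLinearFiltration (ht : IsTriangular q₁ q₂ d₁ d₂)
    (hv : IsGenericCurvePoint q₁ q₂ d₁ d₂ v) :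
    IsLinearFiltration (curveFiltration q₁ q₂) (d₁ * d₂) (d₁ * d₂ * (d₁ + d₂)) where
  mono := curveFiltration_mono
  mul_mem := curveFiltration_mul_mem
  exists_mem := curveFiltration_exists_mem
  finite := fun n => curveFiltration_finite n
  le_finrank := hv.le_finrank
  finrank_le := curveFiltration_finrank_le ht

end Generic

/-- The derivation of affine space tangent to the level sets of `q₁` and `q₂`. -/
noncomputable def jacobianDerivation (q₁ q₂ : MvPolynomial (Fin 3) F) :
    Derivation F (MvPolynomial (Fin 3) F) (MvPolynomial (Fin 3) F) :=
  (pderiv 1 q₁ * pderiv 2 q₂ - pderiv 2 q₁ * pderiv 1 q₂) • pderiv 0 +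
  (pderiv 2 q₁ * pderiv 0 q₂ - pderiv 0 q₁ * pderiv 2 q₂) • pderiv 1 +
  (pderiv 0 q₁ * pderiv 1 q₂ - pderiv 1 q₁ * pderiv 0 q₂) • pderiv 2

theorem jacobianDerivation_apply (f : MvPolynomial (Fin 3) F) :
    jacobianDerivation q₁ q₂ f =
      (pderiv 1 q₁ * pderiv 2 q₂ - pderiv 2 q₁ * pderiv 1 q₂) * pderiv 0 f +
      (pderiv 2 q₁ * pderiv 0 q₂ - pderiv 0 q₁ * pderiv 2 q₂) * pderiv 1 f +
      (pderiv 0 q₁ * pderiv 1 q₂ - pderiv 1 q₁ * pderiv 0 q₂) * pderiv 2 f := by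
  simp [jacobianDerivation]

theorem jacobianDerivation_mem {f : MvPolynomial (Fin 3) F} (hf : f ∈ curveIdeal q₁ q₂) :
    jacobianDerivation q₁ q₂ f ∈ curveIdeal q₁ q₂ := by
  rw [curveIdeal, Ideal.mem_span_pair] at hf
  obtain ⟨a, b, rfl⟩ := hf
  have h1 : jacobianDerivation q₁ q₂ q₁ = 0 := by rw [jacobianDerivation_apply]; ring
  have h2 : jacobianDerivation q₁ q₂ q₂ = 0 := by rw [jacobianDerivation_apply]; ring
  rw [map_add, Derivation.leibniz, Derivation.leibniz, h1, h2, smul_zero, smul_zero, zero_add,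
    zero_add, smul_eq_mul, smul_eq_mul]
  exact Ideal.add_mem _ (Ideal.mul_mem_right _ _ left_mem_curveIdeal)
    (Ideal.mul_mem_right _ _ right_mem_curveIdeal)

noncomputable def curveDerivation (q₁ q₂ : MvPolynomial (Fin 3) F) :
    Derivation F (CurveRing q₁ q₂) (CurveRing q₁ q₂) :=
  Derivation.liftOfSurjective (f := curveMk q₁ q₂) curveMk_surjective
    (d := jacobianDerivation q₁ q₂)
    (fun _ hf => curveMk_eq_zero.2 (jacobianDerivation_mem (curveMk_eq_zero.1 hf)))

theorem curveDerivation_mk (f : MvPolynomial (Fin 3) F) :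
    curveDerivation q₁ q₂ (curveMk q₁ q₂ f) = curveMk q₁ q₂ (jacobianDerivation q₁ q₂ f) :=
  Derivation.liftOfSurjective_apply (f := curveMk q₁ q₂) curveMk_surjective
    (d := jacobianDerivation q₁ q₂)
    (fun _ hf => curveMk_eq_zero.2 (jacobianDerivation_mem (curveMk_eq_zero.1 hf))) f

theorem totalDegree_jacobianDerivation_le {d₁ d₂ : ℕ} (h₁ : q₁.totalDegree ≤ d₁)
    (h₂ : q₂.totalDegree ≤ d₂) (f : MvPolynomial (Fin 3) F) :
    (jacobianDerivation q₁ q₂ f).totalDegree ≤ f.totalDegree + (d₁ + d₂) := by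
  have hm : ∀ i j, (pderiv i q₁ * pderiv j q₂).totalDegree ≤ d₁ + d₂ := fun i j =>
    (totalDegree_mul _ _).trans (add_le_add ((totalDegree_pderiv_le _ _).trans h₁)
      ((totalDegree_pderiv_le _ _).trans h₂))
  have ht : ∀ i j k l m, ((pderiv i q₁ * pderiv j q₂ - pderiv k q₁ * pderiv l q₂) *
      pderiv m f).totalDegree ≤ f.totalDegree + (d₁ + d₂) := fun i j k l m => by
    refine (totalDegree_mul _ _).trans ?_
    rw [add_comm f.totalDegree]
    exact add_le_add ((totalDegree_sub _ _).trans (max_le (hm _ _) (hm _ _)))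
      (totalDegree_pderiv_le _ _)
  rw [jacobianDerivation_apply]
  exact (totalDegree_add _ _).trans
    (max_le ((totalDegree_add _ _).trans (max_le (ht _ _ _ _ _) (ht _ _ _ _ _))) (ht _ _ _ _ _))

theorem curveDerivation_mem {d₁ d₂ : ℕ} (ht : IsTriangular q₁ q₂ d₁ d₂) (n : ℕ)
    (a : CurveRing q₁ q₂) (ha : a ∈ curveFiltration q₁ q₂ n) :
    curveDerivation q₁ q₂ a ∈ curveFiltration q₁ q₂ (n + (d₁ + d₂)) := by
  obtain ⟨f, hf, rfl⟩ := exists_of_mem_curveFiltration ha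
  rw [curveDerivation_mk]
  exact curveMk_mem ((totalDegree_jacobianDerivation_le ht.deg₁ ht.deg₂ f).trans
    (Nat.add_le_add_right hf _))

section Frobenius

variable {p : ℕ} [Fact p.Prime] [CharP F p]

theorem expand_eq_pow_of_map_frobenius_eq {q : MvPolynomial (Fin 3) F}
    (hq : map (frobenius F p) q = q) : expand p q = q ^ p := by
  conv_lhs => rw [← hq]
  rw [← map_expand, map_frobenius_expand]

variable (p) in
/-- The relative Frobenius of a curve defined over the prime field. -/
noncomputable def curveFrobenius (h₁ : map (frobenius F p) q₁ = q₁)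
    (h₂ : map (frobenius F p) q₂ = q₂) : CurveRing q₁ q₂ →ₐ[F] CurveRing q₁ q₂ :=
  Ideal.Quotient.liftₐ _ ((curveMk q₁ q₂).comp (expand p)) fun _ ha =>
    curveIdeal_le_ker ((curveMk q₁ q₂).comp (expand p)).toRingHom
      (by
        change curveMk q₁ q₂ (expand p q₁) = 0
        rw [expand_eq_pow_of_map_frobenius_eq h₁, map_pow,
          curveMk_eq_zero.2 left_mem_curveIdeal, zero_pow (Fact.out : p.Prime).ne_zero])
      (by
        change curveMk q₁ q₂ (expand p q₂) = 0
        rw [expand_eq_pow_of_map_frobenius_eq h₂, map_pow,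
          curveMk_eq_zero.2 right_mem_curveIdeal, zero_pow (Fact.out : p.Prime).ne_zero]) ha

variable (h₁ : map (frobenius F p) q₁ = q₁) (h₂ : map (frobenius F p) q₂ = q₂)

theorem curveFrobenius_mk (f : MvPolynomial (Fin 3) F) :
    curveFrobenius p h₁ h₂ (curveMk q₁ q₂ f) = curveMk q₁ q₂ (expand p f) := rfl

theorem curveFrobenius_injective [IsDomain (CurveRing q₁ q₂)] [PerfectRing F p] :
    Function.Injective (curveFrobenius p h₁ h₂) := by
  rw [injective_iff_map_eq_zero]
  intro a ha
  obtain ⟨f, rfl⟩ := curveMk_surjective a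
  set g := map ((frobeniusEquiv F p).symm : F →+* F) f with hg
  have hfg : map (frobenius F p) g = f := by
    rw [hg, MvPolynomial.map_map, show (frobenius F p).comp ((frobeniusEquiv F p).symm : F →+* F) =
      RingHom.id F from RingHom.ext fun c => by simp, MvPolynomial.map_id]
  have h3 : curveMk q₁ q₂ g ^ p = 0 := by
    rw [← map_pow, ← map_frobenius_expand, map_expand, hfg, ← curveFrobenius_mk h₁ h₂, ha]
  have h4 : g ∈ curveIdeal q₁ q₂ := curveMk_eq_zero.1 (pow_eq_zero_iff
    (Fact.out : p.Prime).ne_zero |>.1 h3)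
  rw [curveIdeal, Ideal.mem_span_pair] at h4
  obtain ⟨b, c, hbc⟩ := h4
  rw [curveMk_eq_zero, ← hfg, ← hbc, map_add, map_mul, map_mul, h₁, h₂]
  exact Ideal.add_mem _ (Ideal.mul_mem_left _ _ left_mem_curveIdeal)
    (Ideal.mul_mem_left _ _ right_mem_curveIdeal)

theorem curveDerivation_frobenius (a : CurveRing q₁ q₂) :
    curveDerivation q₁ q₂ (curveFrobenius p h₁ h₂ a) = 0 := by
  obtain ⟨f, rfl⟩ := curveMk_surjective a
  rw [curveFrobenius_mk, curveDerivation_mk]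
  convert map_zero (curveMk q₁ q₂)
  induction f using MvPolynomial.induction_on with
  | C c => rw [expand_C]; exact Derivation.map_algebraMap _ c
  | add f g hf hg => rw [map_add, map_add, hf, hg, add_zero]
  | mul_X f i hf =>
    rw [map_mul, Derivation.leibniz, hf, expand_X, Derivation.leibniz_pow]
    simp

theorem curveFrobenius_mem (n : ℕ) (a : CurveRing q₁ q₂) (ha : a ∈ curveFiltration q₁ q₂ n) :
    curveFrobenius p h₁ h₂ a ∈ curveFiltration q₁ q₂ (p * n) := by
  obtain ⟨f, hf, rfl⟩ := exists_of_mem_curveFiltration ha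
  rw [curveFrobenius_mk]
  refine curveMk_mem ?_
  rw [totalDegree_expand, mul_comm]
  exact Nat.mul_le_mul_left _ hf

end Frobenius

theorem exists_curve_point [IsAlgClosed F] [IsDomain (CurveRing q₁ q₂)] (H : CurveRing q₁ q₂)
    (hH : H ≠ 0) : ∃ Q : CurveRing q₁ q₂ →ₐ[F] F, Q H ≠ 0 := by
  have : IsJacobsonRing (CurveRing q₁ q₂) := inferInstance
  have h1 : H ∉ Ideal.jacobson (⊥ : Ideal (CurveRing q₁ q₂)) := by
    rw [IsJacobsonRing.out this (Ideal.isRadical_iff_quotient_reduced _ |>.2 inferInstance)]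
    simpa using hH
  rw [Ideal.jacobson, Ideal.mem_sInf] at h1
  push Not at h1
  obtain ⟨m, ⟨-, hm⟩, hHm⟩ := h1
  let K := CurveRing q₁ q₂ ⧸ m
  let : Field K := Ideal.Quotient.field m
  have : Algebra.FiniteType F K := inferInstance
  have : Module.Finite F K := finite_of_finite_type_of_isJacobsonRing F K
  have hb := IsAlgClosed.algebraMap_bijective_of_isIntegral (k := F) (K := K)
  let E := AlgEquiv.ofBijective (Algebra.ofId F K) hb
  refine ⟨E.symm.toAlgHom.comp (Ideal.Quotient.mkₐ F m), fun h => hHm ?_⟩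
  rw [← Ideal.Quotient.eq_zero_iff_mem]
  have h2 : E.symm (Ideal.Quotient.mkₐ F m H) = 0 := h
  rwa [map_eq_zero_iff _ E.symm.injective] at h2

/-- **Stepanov's bound** for a curve over the prime field, with an auxiliary ring `R'` describing
the points. -/
theorem card_curve_points_le [IsAlgClosed F] {p : ℕ} [Fact p.Prime] [CharP F p]
    {d₁ d₂ : ℕ} (hd₁ : 1 ≤ d₁) (hd₂ : 1 ≤ d₂) (ht : IsTriangular q₁ q₂ d₁ d₂)
    {Ω : Type*} [Field Ω] [Algebra F Ω] {v : Fin 3 → Ω} (hv : IsGenericCurvePoint q₁ q₂ d₁ d₂ v)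
    (h₁ : map (frobenius F p) q₁ = q₁) (h₂ : map (frobenius F p) q₂ = q₂)
    {r₁ r₂ : MvPolynomial (Fin 3) F} {ρ e₁ e₂ : ℕ} (hρ : 1 ≤ ρ) (ht' : IsTriangular r₁ r₂ e₁ e₂)
    (he : e₁ * e₂ = ρ * (d₁ * d₂)) {u w : Fin 3 → MvPolynomial (Fin 3) F}
    (hu : ∀ i, (u i).totalDegree ≤ 1) (hw : ∀ i, (w i).totalDegree ≤ 1)
    (hu₁ : aeval u q₁ ∈ curveIdeal r₁ r₂) (hu₂ : aeval u q₂ ∈ curveIdeal r₁ r₂)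
    (hw₁ : aeval w q₁ ∈ curveIdeal r₁ r₂) (hw₂ : aeval w q₂ ∈ curveIdeal r₁ r₂)
    {S : Finset (Fin 3 → F)} (hS : ∀ P ∈ S, aeval P q₁ = 0 ∧ aeval P q₂ = 0 ∧
      ∃ P' : Fin 3 → F, aeval P' r₁ = 0 ∧ aeval P' r₂ = 0 ∧ (∀ i, aeval P' (u i) = P i) ∧
        ∀ i, aeval P' (w i) = P i ^ p)
    {G : ℕ} (hG : d₁ * d₂ * (d₁ + d₂) + ρ ^ 2 + ρ * (d₁ * d₂ * (d₁ + d₂)) + d₁ * d₂ + 1 ≤ G)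
    (hp : (6 * G * ρ) ^ 2 ≤ p) :
    #S ≤ ρ * p + 4 * G * Nat.sqrt p := by
  classical
  have := hv.isDomain ht
  have : PerfectRing F p := inferInstance
  let ι : CurveRing q₁ q₂ →ₐ[F] CurveRing r₁ r₂ := curveLift (fun i => curveMk r₁ r₂ (u i))
    (by rw [← comp_aeval_apply]; exact curveMk_eq_zero.2 hu₁)
    (by rw [← comp_aeval_apply]; exact curveMk_eq_zero.2 hu₂)
  let ψ : CurveRing q₁ q₂ →ₐ[F] CurveRing r₁ r₂ := curveLift (fun i => curveMk r₁ r₂ (w i))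
    (by rw [← comp_aeval_apply]; exact curveMk_eq_zero.2 hw₁)
    (by rw [← comp_aeval_apply]; exact curveMk_eq_zero.2 hw₂)
  have hι : ∀ f, ι (curveMk q₁ q₂ f) = curveMk r₁ r₂ (aeval u f) := fun f => by
    rw [curveLift_mk, comp_aeval_apply]
  have hψ : ∀ f, ψ (curveMk q₁ q₂ f) = curveMk r₁ r₂ (aeval w f) := fun f => by
    rw [curveLift_mk, comp_aeval_apply]
  let T : S → (CurveRing q₁ q₂ →ₐ[F] F) := fun P =>
    curveLift P.1 (hS P.1 P.2).1 (hS P.1 P.2).2.1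
  have hTinj : Function.Injective T := by
    intro P P' h
    refine Subtype.ext (funext fun i => ?_)
    have := congrArg (fun φ => φ (curveMk q₁ q₂ (X i))) h
    simpa only [T, curveLift_mk, aeval_X] using this
  have hcard : #(univ.image T) = #S := by
    rw [Finset.card_image_of_injective _ hTinj, Finset.card_univ, Fintype.card_coe]
  rw [← hcard]
  refine stepanov_card_le (γ := d₁ * d₂ * (d₁ + d₂)) (e := d₁ * d₂) (Δ := d₁ + d₂)
    (L := curveFiltration q₁ q₂) (L' := curveFiltration r₁ r₂) (t := curveMk q₁ q₂ (X 0))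
    (δ := curveDerivation q₁ q₂) (Φ := curveFrobenius p h₁ h₂)
    (Nat.mul_pos hd₁ hd₂) (hv.isLinearFiltration ht) (curveDerivation_mem ht)
    (curveDerivation_mem ht _ _ (curveMk_mem (totalDegree_X _).le)) ?_ exists_curve_point
    (curveFrobenius_injective h₁ h₂) (curveDerivation_frobenius h₁ h₂)
    (curveFrobenius_mem h₁ h₂) hρ curveFiltration_mono (fun n => curveFiltration_finite n) ?_
    ι ψ ?_ ?_ hG hp
  · intro h0
    have h3 := congrArg (curveLift v hv.zero₁ hv.zero₂) h0
    rw [curveDerivation_mk, curveLift_mk, map_zero, jacobianDerivation_apply, pderiv_X_self,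
      pderiv_X_of_ne (by decide), pderiv_X_of_ne (by decide), mul_one, mul_zero, mul_zero,
      add_zero, add_zero] at h3
    exact hv.smooth h3
  · intro n
    rw [← mul_assoc, ← he]
    exact curveFiltration_finrank_le ht' n
  · intro m n a b ha hb
    obtain ⟨f, hf, rfl⟩ := exists_of_mem_curveFiltration ha
    obtain ⟨g, hg, rfl⟩ := exists_of_mem_curveFiltration hb
    rw [hι, hψ]
    exact curveFiltration_mul_mem (curveMk_mem ((totalDegree_aeval_le hu _).trans hf))
      (curveMk_mem ((totalDegree_aeval_le hw _).trans hg))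
  · intro Q hQ
    obtain ⟨⟨P, hP⟩, -, rfl⟩ := Finset.mem_image.1 hQ
    obtain ⟨hP1, hP2, P', hP1', hP2', huP, hwP⟩ := hS P hP
    refine ⟨curveLift P' hP1' hP2', fun a => ?_, fun a => ?_⟩
    · obtain ⟨f, rfl⟩ := curveMk_surjective a
      rw [hι, curveLift_mk, curveLift_mk, comp_aeval_apply, funext huP]
    · obtain ⟨f, rfl⟩ := curveMk_surjective a
      rw [hψ, curveLift_mk, curveFrobenius_mk, curveLift_mk, comp_aeval_apply, funext hwP,
        expand, ← aeval_eq_bind₁, comp_aeval_apply]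
      simp only [map_pow, aeval_X]

end CurveField

section Valuation

variable {F : Type*} [Field F] {Ω : Type*} [Field Ω] [Algebra F Ω]

theorem exists_valuationSubring_one_lt {x : Ω} (hx : Transcendental F x) :
    ∃ B : ValuationSubring Ω, 1 < B.valuation x ∧ B.valuation.IsTrivialOn F := by
  have hx0 : x ≠ 0 := fun h => hx (h ▸ isAlgebraic_zero)
  have hx' : Transcendental F x⁻¹ := fun h => hx (IsAlgebraic.inv_iff.1 h)
  let A : Subalgebra F Ω := Algebra.adjoin F {x⁻¹}
  let a : A.toSubring := ⟨x⁻¹, Algebra.subset_adjoin rfl⟩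
  have hI : Ideal.span {a} ≠ ⊤ := by
    intro h
    rw [Ideal.span_singleton_eq_top] at h
    obtain ⟨⟨b, hb⟩, hab⟩ := h.exists_right_inv
    have hab' : x⁻¹ * b = 1 := congrArg Subtype.val hab
    change b ∈ Algebra.adjoin F {x⁻¹} at hb
    rw [Algebra.adjoin_singleton_eq_range_aeval] at hb
    obtain ⟨f, rfl⟩ := hb
    refine hx' ⟨Polynomial.X * f - 1, ?_, ?_⟩
    · intro h0
      have := congrArg (Polynomial.eval 0) h0
      simp at this
    · rw [map_sub, map_mul, Polynomial.aeval_X, map_one]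
      exact sub_eq_zero.2 hab'
  obtain ⟨B, hB, hBI⟩ := Ideal.image_subset_nonunits_valuationSubring _ hI
  refine ⟨B, ?_, ⟨fun c hc => ?_⟩⟩
  · have h1 : x⁻¹ ∈ B.nonunits := hBI ⟨a, Ideal.subset_span rfl, rfl⟩
    rw [ValuationSubring.mem_nonunits_iff, map_inv₀] at h1
    exact (inv_lt_one₀ (zero_lt_iff.2 ((Valuation.ne_zero_iff _).2 hx0))).1 h1
  · have key : ∀ c : F, B.valuation (algebraMap F Ω c) ≤ 1 := fun c =>
      (B.valuation_le_one_iff _).2 (hB (A.algebraMap_mem c))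
    refine le_antisymm (key c) ?_
    have h2 := key c⁻¹
    rw [map_inv₀, map_inv₀] at h2
    exact (inv_le_one₀ (zero_lt_iff.2 ((Valuation.ne_zero_iff _).2
      ((map_ne_zero _).2 hc)))).1 h2

variable {Γ : Type*} [LinearOrderedCommGroupWithZero Γ] {v : Valuation Ω Γ} [hv : v.IsTrivialOn F]

theorem linearIndepOn_of_injOn_valuation {ι : Type*} {m : ι → Ω} {s : Set ι}
    (h0 : ∀ i ∈ s, m i ≠ 0) (hs : Set.InjOn (fun i => v (m i)) s) : LinearIndepOn F m s := by
  classical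
  rw [linearIndepOn_iff]
  intro l hl hsum
  by_contra hne
  obtain ⟨i, hi, hmax⟩ := Finset.exists_max_image l.support (fun i => v (m i))
    (Finsupp.support_nonempty_iff.2 hne)
  have hmem : ∀ j ∈ l.support, j ∈ s := fun j hj => hl hj
  have hval : ∀ j ∈ l.support, v (l j • m j) = v (m j) := fun j hj => by
    rw [Algebra.smul_def, map_mul, hv.eq_one _ (Finsupp.mem_support_iff.1 hj), one_mul]
  rw [Finsupp.linearCombination_apply, Finsupp.sum, ← Finset.add_sum_erase _ _ hi] at hsum
  have hlt : v (∑ j ∈ l.support.erase i, l j • m j) < v (l i • m i) := by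
    refine v.map_sum_lt ?_ fun j hj => ?_
    · rw [hval i hi]; exact (Valuation.ne_zero_iff _).2 (h0 i (hmem i hi))
    · have hj' := Finset.mem_of_mem_erase hj
      rw [hval i hi, hval j hj']
      refine lt_of_le_of_ne (hmax j hj') fun h => Finset.ne_of_mem_erase hj ?_
      exact hs (hmem j hj') (hmem i hi) h
  have := v.map_add_eq_of_lt_left hlt
  rw [hsum, map_zero] at this
  rw [hval i hi] at this
  exact (Valuation.ne_zero_iff _).2 (h0 i (hmem i hi)) this.symm

theorem valuation_aeval_le_one {f : Polynomial F} {y : Ω} (hy : v y ≤ 1) :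
    v (Polynomial.aeval y f) ≤ 1 := by
  rw [Polynomial.aeval_eq_sum_range]
  refine v.map_sum_le fun i _ => ?_
  rw [Algebra.smul_def, map_mul, map_pow]
  exact mul_le_one' (Valuation.IsTrivialOn.valuation_algebraMap_le_one v _)
    (pow_le_one' hy i)

theorem valuation_pow_eq_of_aeval_eq {f g : Polynomial F} {x y : Ω} (hg : 1 ≤ g.natDegree)
    (hf : 1 ≤ f.natDegree) (hx : 1 < v x) (h : Polynomial.aeval y g = Polynomial.aeval x f) :
    1 < v y ∧ v y ^ g.natDegree = v x ^ f.natDegree := by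
  have hf0 : f ≠ 0 := by rintro rfl; simp at hf
  have hg0 : g ≠ 0 := by rintro rfl; simp at hg
  have h1 := Polynomial.valuation_aeval_eq_valuation_X_pow_natDegree_of_one_lt_valuation_X x hx hf0
  have hy : 1 < v y := by
    by_contra! hy
    have := valuation_aeval_le_one (F := F) (f := g) hy
    rw [h, h1] at this
    exact this.not_gt (one_lt_pow₀ hx (by omega))
  refine ⟨hy, ?_⟩
  rw [← h1, ← h,
    Polynomial.valuation_aeval_eq_valuation_X_pow_natDegree_of_one_lt_valuation_X y hy hg0]

theorem linearIndepOn_tripleMonomial_of_valuation {w : Fin 3 → Ω} {k l k' l' : ℕ}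
    (hx : 1 < v (w 0)) (hl : 1 ≤ l) (hl' : 1 ≤ l') (hy : v (w 1) ^ l = v (w 0) ^ k)
    (hz : v (w 2) ^ l' = v (w 0) ^ k') (hc : Nat.Coprime l (k * l'))
    (hc' : Nat.Coprime l' (k' * l)) :
    LinearIndepOn F (tripleMonomial w) {k | k.2.1 < l ∧ k.2.2 < l'} := by
  have hv0 : v (w 0) ≠ 0 := (zero_lt_one.trans hx).ne'
  have hne : ∀ i, w i ≠ 0 := by
    have hy0 : v (w 1) ≠ 0 := by
      intro h; rw [h, zero_pow (by omega)] at hy; exact pow_ne_zero _ hv0 hy.symm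
    have hz0 : v (w 2) ≠ 0 := by
      intro h; rw [h, zero_pow (by omega)] at hz; exact pow_ne_zero _ hv0 hz.symm
    intro i
    fin_cases i
    exacts [(Valuation.ne_zero_iff _).1 hv0, (Valuation.ne_zero_iff _).1 hy0,
      (Valuation.ne_zero_iff _).1 hz0]
  refine linearIndepOn_of_injOn_valuation (v := v) (fun i _ => ?_) ?_
  · exact mul_ne_zero (mul_ne_zero (pow_ne_zero _ (hne 0)) (pow_ne_zero _ (hne 1)))
      (pow_ne_zero _ (hne 2))
  rintro ⟨a, b, c⟩ ⟨hb, hcl⟩ ⟨a', b', c'⟩ ⟨hb', hcl'⟩ h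
  simp only at hb hcl hb' hcl'
  have key : ∀ a b c : ℕ, v (tripleMonomial w (a, b, c)) ^ (l * l') =
      v (w 0) ^ (l * l' * a + k * l' * b + k' * l * c) := by
    intro a b c
    simp only [tripleMonomial, map_mul, map_pow, mul_pow]
    calc _ = v (w 0) ^ (l * l' * a) * (v (w 1) ^ l) ^ (l' * b) * (v (w 2) ^ l') ^ (l * c) := by
          simp only [← pow_mul]
          congr 1
          · congr 1
            · congr 1; ring
            · congr 1; ring
          · congr 1; ring
      _ = _ := by
          rw [hy, hz, ← pow_mul, ← pow_mul, ← pow_add, ← pow_add]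
          congr 1; ring
  have h1 : l * l' * a + k * l' * b + k' * l * c = l * l' * a' + k * l' * b' + k' * l * c' := by
    apply pow_right_injective₀ (zero_lt_one.trans hx) hx.ne'
    simp only [← key]
    exact congrArg (· ^ (l * l')) h
  have hbb : b = b' := by
    have h2 : k * l' * b ≡ k * l' * b' [MOD l] := by
      have : l * (l' * a + k' * c) + k * l' * b = l * (l' * a' + k' * c') + k * l' * b' := by
        nlinarith only [h1]
      have h3 := congrArg (· % l) this
      simpa [Nat.ModEq, Nat.mul_add_mod] using h3
    have h3 := Nat.ModEq.cancel_left_of_coprime (by simpa using hc) h2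
    exact Nat.ModEq.eq_of_lt_of_lt h3 hb hb'
  have hcc : c = c' := by
    have h2 : k' * l * c ≡ k' * l * c' [MOD l'] := by
      have : l' * (l * a + k * b) + k' * l * c = l' * (l * a' + k * b') + k' * l * c' := by
        nlinarith only [h1]
      have h3 := congrArg (· % l') this
      simpa [Nat.ModEq, Nat.mul_add_mod] using h3
    have h3 := Nat.ModEq.cancel_left_of_coprime (by simpa using hc') h2
    exact Nat.ModEq.eq_of_lt_of_lt h3 hcl hcl'
  subst hbb hcc
  have : a = a' := by
    have h4 : l * l' * a = l * l' * a' := by omega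
    exact Nat.eq_of_mul_eq_mul_left (Nat.mul_pos hl hl') h4
  rw [this]

end Valuation

section CurvePoints

variable {F : Type*} [Field F]

open MvPolynomial

theorem mem_span_tripleMonomial_of_totalDegree_le {f : MvPolynomial (Fin 3) F} {n : ℕ}
    (hf : f.totalDegree ≤ n) :
    f ∈ Submodule.span F (tripleMonomial X '' {k | k.1 + k.2.1 + k.2.2 ≤ n}) := by
  rw [f.as_sum]
  refine Submodule.sum_mem _ fun d hd => ?_
  have e : monomial d (coeff d f) = coeff d f • tripleMonomial X (d 0, d 1, d 2) := by
    rw [monomial_eq, Finsupp.prod_fintype _ _ (by simp), Fin.prod_univ_three, smul_eq_C_mul]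
    rfl
  rw [e]
  refine Submodule.smul_mem _ _ (Submodule.subset_span ⟨_, ?_, rfl⟩)
  refine le_trans ?_ hf
  refine le_trans (le_of_eq ?_) (le_totalDegree hd)
  rw [Finsupp.sum_fintype _ _ (by simp), Fin.sum_univ_three]

theorem totalDegree_polynomial_aeval_le {u : MvPolynomial (Fin 3) F} (hu : u.totalDegree ≤ 1)
    (f : Polynomial F) : (Polynomial.aeval u f).totalDegree ≤ f.natDegree := by
  rw [Polynomial.aeval_eq_sum_range]
  refine totalDegree_finsetSum_le fun i hi => ?_
  refine (totalDegree_smul_le _ _).trans ((totalDegree_pow _ _).trans ?_)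
  have := Finset.mem_range.1 hi
  nlinarith only [hu, this]

theorem pow_sub_aeval_mem_span {R : Type*} [CommRing R] [Algebra F R] {v : Fin 3 → R} (i : Fin 3)
    {g : Polynomial F} (hg : g.Monic) {s : Set (ℕ × ℕ × ℕ)} (e : ℕ → ℕ × ℕ × ℕ)
    (he : ∀ n, tripleMonomial v (e n) = v i ^ n) (hs : ∀ n < g.natDegree, e n ∈ s) :
    v i ^ g.natDegree - Polynomial.aeval (v i) g ∈ Submodule.span F (tripleMonomial v '' s) := by
  rw [Polynomial.aeval_eq_sum_range, Finset.sum_range_succ, hg.coeff_natDegree, one_smul,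
    sub_add_cancel_right, ]
  refine Submodule.neg_mem _ (Submodule.sum_mem _ fun n hn => Submodule.smul_mem _ _ ?_)
  exact Submodule.subset_span ⟨e n, hs n (Finset.mem_range.1 hn), he n⟩

/-- The equation `g(Y) = f(X)` in the variables `X, Y, Z`. -/
noncomputable def curveEquation (f g : Polynomial F) : MvPolynomial (Fin 3) F :=
  Polynomial.aeval (X 1) g - Polynomial.aeval (X 0) f

/-- The equation `g(Z) = f(X - Y + Z - τ)` in the variables `X, Y, Z`. -/
noncomputable def shiftEquation (f g : Polynomial F) (τ : F) : MvPolynomial (Fin 3) F :=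
  Polynomial.aeval (X 2) g - Polynomial.aeval (X 0 - X 1 + X 2 - C τ) f

variable {f g f' g' : Polynomial F}

theorem totalDegree_curveEquation_le (h : f.natDegree ≤ g.natDegree) :
    (curveEquation f g).totalDegree ≤ g.natDegree :=
  (totalDegree_sub _ _).trans (max_le (totalDegree_polynomial_aeval_le (totalDegree_X _).le g)
    ((totalDegree_polynomial_aeval_le (totalDegree_X _).le f).trans h))

theorem curveEquation_lead (hg : g.Monic) (h : f.natDegree ≤ g.natDegree) (h1 : 1 ≤ g.natDegree) :
    X 1 ^ g.natDegree - curveEquation f g ∈ Submodule.span F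
      (tripleMonomial X '' {k | k.2.1 < g.natDegree ∧ k.2.2 = 0 ∧ k.1 + k.2.1 ≤ g.natDegree}) := by
  rw [curveEquation, ← sub_add]
  refine Submodule.add_mem _ (pow_sub_aeval_mem_span 1 hg (fun n => (0, n, 0))
    (by simp [tripleMonomial]) fun n hn => ⟨hn, rfl, by simpa using hn.le⟩) ?_
  rw [Polynomial.aeval_eq_sum_range]
  refine Submodule.sum_mem _ fun n hn => Submodule.smul_mem _ _ (Submodule.subset_span
    ⟨(n, 0, 0), ⟨h1, rfl, ?_⟩, by simp [tripleMonomial]⟩)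
  have := Finset.mem_range.1 hn
  simp only; omega

theorem isTriangular_curve (hg : g.Monic) (h : f.natDegree ≤ g.natDegree) (h1 : 1 ≤ g.natDegree) :
    IsTriangular (curveEquation f g) (X 2 - 1) g.natDegree 1 where
  deg₁ := totalDegree_curveEquation_le h
  deg₂ := (totalDegree_sub _ _).trans (max_le (totalDegree_X _).le (by simp))
  lead₁ := curveEquation_lead hg h h1
  lead₂ := Submodule.subset_span ⟨(0, 0, 0), by simp, by simp [tripleMonomial]⟩

theorem totalDegree_shift_le (τ : F) :
    (X 0 - X 1 + X 2 - C τ : MvPolynomial (Fin 3) F).totalDegree ≤ 1 := by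
  refine (totalDegree_sub _ _).trans (max_le ((totalDegree_add _ _).trans (max_le
    ((totalDegree_sub _ _).trans (max_le ?_ ?_)) ?_)) ?_) <;> simp

theorem isTriangular_shift (hg : g.Monic) (h : f.natDegree ≤ g.natDegree) (h1 : 1 ≤ g.natDegree)
    (hg' : g'.Monic) (h' : f'.natDegree < g'.natDegree) (τ : F) :
    IsTriangular (curveEquation f g) (shiftEquation f' g' τ) g.natDegree g'.natDegree where
  deg₁ := totalDegree_curveEquation_le h
  deg₂ := (totalDegree_sub _ _).trans (max_le
    (totalDegree_polynomial_aeval_le (totalDegree_X _).le g')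
    ((totalDegree_polynomial_aeval_le (totalDegree_shift_le τ) f').trans h'.le))
  lead₁ := curveEquation_lead hg h h1
  lead₂ := by
    rw [shiftEquation, ← sub_add]
    refine Submodule.add_mem _ (pow_sub_aeval_mem_span 2 hg' (fun n => (0, 0, n))
      (by simp [tripleMonomial]) fun n hn => ⟨hn, by simpa using hn.le⟩) ?_
    refine Submodule.span_mono (Set.image_mono ?_) (mem_span_tripleMonomial_of_totalDegree_le
      (totalDegree_polynomial_aeval_le (totalDegree_shift_le τ) f'))
    rintro ⟨a, b, c⟩ h
    simp only [Set.mem_ofPred_eq] at h ⊢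
    omega

theorem map_polynomial_aeval_eq {φ : F →+* F} {u : MvPolynomial (Fin 3) F} (hu : map φ u = u)
    (hf : f.map φ = f) : map φ (Polynomial.aeval u f) = Polynomial.aeval u f := by
  rw [Polynomial.aeval_eq_sum_range, map_sum]
  refine Finset.sum_congr rfl fun i _ => ?_
  rw [smul_eq_C_mul, map_mul, map_pow, map_C, hu]
  conv_rhs => rw [← hf, Polynomial.coeff_map]

theorem map_curveEquation {φ : F →+* F} (hf : f.map φ = f) (hg : g.map φ = g) :
    map φ (curveEquation f g) = curveEquation f g := by
  rw [curveEquation, map_sub, map_polynomial_aeval_eq (map_X _ _) hf,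
    map_polynomial_aeval_eq (map_X _ _) hg]

theorem map_shiftEquation {φ : F →+* F} (hf : f.map φ = f) (hg : g.map φ = g) {τ : F}
    (hτ : φ τ = τ) : map φ (shiftEquation f g τ) = shiftEquation f g τ := by
  rw [shiftEquation, map_sub, map_polynomial_aeval_eq (map_X _ _) hg,
    map_polynomial_aeval_eq (by simp [hτ]) hf]

theorem aeval_polynomial_aeval {R : Type*} [CommRing R] [Algebra F R] (w : Fin 3 → R)
    (u : MvPolynomial (Fin 3) F) (f : Polynomial F) :
    aeval w (Polynomial.aeval u f) = Polynomial.aeval (aeval w u) f :=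
  (Polynomial.aeval_algHom_apply (aeval w) u f).symm

theorem aeval_curveEquation {R : Type*} [CommRing R] [Algebra F R] (w : Fin 3 → R) :
    aeval w (curveEquation f g) = Polynomial.aeval (w 1) g - Polynomial.aeval (w 0) f := by
  rw [curveEquation, map_sub, aeval_polynomial_aeval, aeval_polynomial_aeval, aeval_X, aeval_X]

theorem aeval_shiftEquation {R : Type*} [CommRing R] [Algebra F R] (w : Fin 3 → R) (τ : F) :
    aeval w (shiftEquation f g τ) = Polynomial.aeval (w 2) g -
      Polynomial.aeval (w 0 - w 1 + w 2 - algebraMap F R τ) f := by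
  rw [shiftEquation, map_sub, aeval_polynomial_aeval, aeval_polynomial_aeval]
  simp

theorem pderiv_polynomial_aeval (i : Fin 3) (u : MvPolynomial (Fin 3) F) (f : Polynomial F) :
    pderiv i (Polynomial.aeval u f) = Polynomial.aeval u f.derivative * pderiv i u := by
  have := Derivation.map_aeval (pderiv i : Derivation F (MvPolynomial (Fin 3) F) _) f u
  rw [this, smul_eq_mul]

theorem valuation_aeval_derivative {Ω : Type*} [Field Ω] [Algebra F Ω] {Γ : Type*}
    [LinearOrderedCommGroupWithZero Γ] {v : Valuation Ω Γ} [hv : v.IsTrivialOn F] {y : Ω}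
    (hy : 1 < v y) (hg : g.Monic) (h1 : 1 ≤ g.natDegree) (h0 : (g.natDegree : F) ≠ 0) :
    v (Polynomial.aeval y g.derivative) = v y ^ (g.natDegree - 1) := by
  have hc : g.derivative.coeff (g.natDegree - 1) ≠ 0 := by
    rw [Polynomial.coeff_derivative, Nat.sub_add_cancel h1, hg.coeff_natDegree, one_mul,
      ← Nat.cast_add_one, Nat.sub_add_cancel h1]
    exact h0
  have hd : g.derivative.natDegree = g.natDegree - 1 :=
    le_antisymm (Polynomial.natDegree_derivative_le g) (Polynomial.le_natDegree_of_ne_zero hc)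
  have hne : g.derivative ≠ 0 := by rintro h; rw [h] at hc; simp at hc
  rw [Polynomial.valuation_aeval_eq_valuation_X_pow_natDegree_of_one_lt_valuation_X y hy hne, hd]

theorem exists_transcendental_isAlgClosed (F : Type*) [Field F] :
    ∃ x : AlgebraicClosure (RatFunc F), Transcendental F x := by
  refine ⟨algebraMap (RatFunc F) _ RatFunc.X, fun h => ?_⟩
  exact RatFunc.transcendental_X (K := F)
    ((isAlgebraic_algebraMap_iff (algebraMap (RatFunc F) (AlgebraicClosure _)).injective).1 h)

theorem exists_aeval_eq_eval {Ω : Type*} [Field Ω] [IsAlgClosed Ω] [Algebra F Ω] (hg : g.Monic)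
    {h : Polynomial Ω} (hh : h.natDegree < g.natDegree) :
    ∃ y : Ω, Polynomial.aeval y g = Polynomial.eval y h := by
  have hdeg : h.degree < (g.map (algebraMap F Ω)).degree := by
    refine Polynomial.degree_lt_degree ?_
    rwa [hg.natDegree_map]
  have hd : (g.map (algebraMap F Ω) - h).degree ≠ 0 := by
    rw [Polynomial.degree_sub_eq_left_of_degree_lt hdeg,
      Polynomial.degree_eq_natDegree (hg.map _).ne_zero, hg.natDegree_map]
    exact_mod_cast (Nat.zero_lt_of_lt hh).ne'
  obtain ⟨y, hy⟩ := IsAlgClosed.exists_root _ hd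
  refine ⟨y, ?_⟩
  rw [Polynomial.IsRoot, Polynomial.eval_sub, Polynomial.eval_map_algebraMap] at hy
  exact sub_eq_zero.1 hy

theorem exists_genericPoint_curve (hf : 1 ≤ f.natDegree) (hg : g.Monic)
    (h1 : 1 ≤ g.natDegree) (hc : Nat.Coprime g.natDegree f.natDegree)
    (h0 : (g.natDegree : F) ≠ 0) :
    ∃ v : Fin 3 → AlgebraicClosure (RatFunc F),
      IsGenericCurvePoint (curveEquation f g) (X 2 - 1) g.natDegree 1 v := by
  obtain ⟨x, hx⟩ := exists_transcendental_isAlgClosed F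
  obtain ⟨B, hxB, hB⟩ := exists_valuationSubring_one_lt hx
  obtain ⟨y, hy⟩ := exists_aeval_eq_eval (Ω := AlgebraicClosure (RatFunc F)) hg
    (h := Polynomial.C (Polynomial.aeval x f)) (by rw [Polynomial.natDegree_C]; exact h1)
  rw [Polynomial.eval_C] at hy
  obtain ⟨hy1, hyx⟩ := valuation_pow_eq_of_aeval_eq h1 hf hxB hy
  refine ⟨![x, y, 1], ?_, by simp, ?_, ?_⟩
  · rw [aeval_curveEquation]; exact sub_eq_zero.2 hy
  · exact linearIndepOn_tripleMonomial_of_valuation (v := B.valuation) (k := f.natDegree) (k' := 0)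
      hxB h1 le_rfl hyx (by simp) (by simpa using hc) (by simp)
  · have e1 : pderiv 1 (curveEquation f g) = Polynomial.aeval (X 1) g.derivative := by
      rw [curveEquation, map_sub, pderiv_polynomial_aeval, pderiv_polynomial_aeval, pderiv_X_self,
        pderiv_X_of_ne (by decide)]
      ring
    have e2 : pderiv 2 (X 2 - 1 : MvPolynomial (Fin 3) F) = 1 := by
      rw [map_sub, pderiv_X_self, pderiv_one, sub_zero]
    have e3 : pderiv 1 (X 2 - 1 : MvPolynomial (Fin 3) F) = 0 := by
      rw [map_sub, pderiv_X_of_ne (by decide), pderiv_one, sub_zero]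
    rw [e1, e2, e3, mul_one, mul_zero, sub_zero, aeval_polynomial_aeval, aeval_X,
      ← Valuation.ne_zero_iff B.valuation]
    change B.valuation (Polynomial.aeval y g.derivative) ≠ 0
    rw [valuation_aeval_derivative hy1 hg h1 h0]
    exact pow_ne_zero _ (zero_lt_one.trans hy1).ne'

theorem exists_genericPoint_shift (hf : 1 ≤ f.natDegree) (hg : g.Monic)
    (h : f.natDegree < g.natDegree) (h0 : (g.natDegree : F) ≠ 0)
    (hf' : 1 ≤ f'.natDegree) (hg' : g'.Monic)
    (h' : f'.natDegree < g'.natDegree) (h0' : (g'.natDegree : F) ≠ 0)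
    (hc : Nat.Coprime g.natDegree (f.natDegree * g'.natDegree))
    (hc' : Nat.Coprime g'.natDegree (f'.natDegree * g.natDegree)) (τ : F) :
    ∃ v : Fin 3 → AlgebraicClosure (RatFunc F),
      IsGenericCurvePoint (curveEquation f g) (shiftEquation f' g' τ)
        g.natDegree g'.natDegree v := by
  obtain ⟨x, hx⟩ := exists_transcendental_isAlgClosed F
  obtain ⟨B, hxB, hB⟩ := exists_valuationSubring_one_lt hx
  have h1 : 1 ≤ g.natDegree := hf.trans h.le
  have h1' : 1 ≤ g'.natDegree := hf'.trans h'.le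
  have hx0 : (0 : B.ValueGroup) < B.valuation x := zero_lt_one.trans hxB
  obtain ⟨y, hy⟩ := exists_aeval_eq_eval (Ω := AlgebraicClosure (RatFunc F)) hg
    (h := Polynomial.C (Polynomial.aeval x f)) (by rw [Polynomial.natDegree_C]; exact h1)
  rw [Polynomial.eval_C] at hy
  obtain ⟨hy1, hyx⟩ := valuation_pow_eq_of_aeval_eq h1 hf hxB hy
  have hylt : B.valuation y < B.valuation x := by
    refine lt_of_pow_lt_pow_left₀ g.natDegree hx0.le ?_
    rw [hyx]
    exact pow_lt_pow_right₀ hxB h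
  have hτ : B.valuation (algebraMap F _ τ) < B.valuation x :=
    (Valuation.IsTrivialOn.valuation_algebraMap_le_one _ _).trans_lt hxB
  obtain ⟨z, hz⟩ := exists_aeval_eq_eval (Ω := AlgebraicClosure (RatFunc F)) hg'
    (h := (f'.map (algebraMap F _)).comp
      (Polynomial.X + Polynomial.C (x - y - algebraMap F _ τ))) (by
        rw [Polynomial.natDegree_comp, Polynomial.natDegree_X_add_C, mul_one,
          Polynomial.natDegree_map]
        exact h')
  rw [Polynomial.eval_comp, Polynomial.eval_map_algebraMap] at hz
  simp only [Polynomial.eval_add, Polynomial.eval_X, Polynomial.eval_C] at hz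
  have hc0 : B.valuation (x - y - algebraMap F _ τ) = B.valuation x := by
    have e : B.valuation (x - y) = B.valuation x := Valuation.map_sub_eq_of_lt_left _ hylt
    rw [Valuation.map_sub_eq_of_lt_left _ (by rwa [e]), e]
  have hf0' : f' ≠ 0 := by rintro rfl; simp at hf'
  have hzlt : B.valuation z < B.valuation x := by
    by_contra! hxz
    have hz1 := hxB.trans_le hxz
    have e1 := Polynomial.valuation_aeval_eq_valuation_X_pow_natDegree_of_one_lt_valuation_X
      (A := F) z hz1 hg'.ne_zero
    have hs : B.valuation (z + (x - y - algebraMap F _ τ)) ≤ B.valuation z :=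
      (Valuation.map_add _ _ _).trans (max_le le_rfl (by rwa [hc0]))
    have hs2 : B.valuation (Polynomial.aeval (z + (x - y - algebraMap F _ τ)) f') ≤
        B.valuation z ^ f'.natDegree := by
      rcases lt_or_ge 1 (B.valuation (z + (x - y - algebraMap F _ τ))) with h2 | h2
      · rw [Polynomial.valuation_aeval_eq_valuation_X_pow_natDegree_of_one_lt_valuation_X
          (A := F) _ h2 hf0']
        exact pow_le_pow_left₀ zero_le hs _
      · exact (valuation_aeval_le_one h2).trans (one_le_pow₀ hz1.le)
    rw [← hz, e1] at hs2
    exact hs2.not_gt (pow_lt_pow_right₀ hz1 h')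
  have hc1 : B.valuation (z + (x - y - algebraMap F _ τ)) = B.valuation x := by
    rw [Valuation.map_add_eq_of_lt_right _ (by rwa [hc0]), hc0]
  have hx1' : 1 < B.valuation (z + (x - y - algebraMap F _ τ)) := by rwa [hc1]
  obtain ⟨hz1, hzx⟩ := valuation_pow_eq_of_aeval_eq h1' hf' hx1' hz
  rw [hc1] at hzx
  have earg : x - y + z - algebraMap F _ τ = z + (x - y - algebraMap F _ τ) := by ring
  refine ⟨![x, y, z], ?_, ?_, ?_, ?_⟩
  · rw [aeval_curveEquation]; exact sub_eq_zero.2 hy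
  · rw [aeval_shiftEquation]
    change Polynomial.aeval z g' - Polynomial.aeval (x - y + z - algebraMap F _ τ) f' = 0
    rw [earg, hz, sub_self]
  · exact linearIndepOn_tripleMonomial_of_valuation (v := B.valuation) hxB h1 h1' hyx hzx hc hc'
  · have e1 : pderiv 1 (curveEquation f g) = Polynomial.aeval (X 1) g.derivative := by
      rw [curveEquation, map_sub, pderiv_polynomial_aeval, pderiv_polynomial_aeval, pderiv_X_self,
        pderiv_X_of_ne (by decide)]
      ring
    have e2 : pderiv 2 (curveEquation f g) = 0 := by
      rw [curveEquation, map_sub, pderiv_polynomial_aeval, pderiv_polynomial_aeval,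
        pderiv_X_of_ne (by decide), pderiv_X_of_ne (by decide)]
      ring
    have e3 : pderiv 2 (shiftEquation f' g' τ) = Polynomial.aeval (X 2) g'.derivative -
        Polynomial.aeval (X 0 - X 1 + X 2 - C τ) f'.derivative := by
      rw [shiftEquation, map_sub, pderiv_polynomial_aeval, pderiv_polynomial_aeval]
      simp only [map_sub, map_add, pderiv_X_self, pderiv_C,
        pderiv_X_of_ne (show (0 : Fin 3) ≠ 2 by decide),
        pderiv_X_of_ne (show (1 : Fin 3) ≠ 2 by decide)]
      ring
    rw [e1, e2, e3, zero_mul, sub_zero, map_mul, map_sub, aeval_polynomial_aeval,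
      aeval_polynomial_aeval, aeval_polynomial_aeval, ← Valuation.ne_zero_iff B.valuation, map_mul]
    have e4 : aeval ![x, y, z] (X 0 - X 1 + X 2 - C τ : MvPolynomial (Fin 3) F) =
        z + (x - y - algebraMap F _ τ) := by
      rw [← earg]; simp
    rw [e4, aeval_X, aeval_X]
    change B.valuation (Polynomial.aeval y g.derivative) *
      B.valuation (Polynomial.aeval z g'.derivative - _) ≠ 0
    have d1 := valuation_aeval_derivative hz1 hg' h1' h0'
    have d2 : B.valuation (Polynomial.aeval (z + (x - y - algebraMap F _ τ)) f'.derivative) ≤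
        B.valuation x ^ (f'.natDegree - 1) := by
      rcases eq_or_ne f'.derivative 0 with h2 | h2
      · rw [h2, map_zero, map_zero]; exact zero_le
      · rw [Polynomial.valuation_aeval_eq_valuation_X_pow_natDegree_of_one_lt_valuation_X
          (A := F) _ hx1' h2, hc1]
        exact pow_le_pow_right₀ hxB.le (Polynomial.natDegree_derivative_le f')
    have d3 : B.valuation x ^ (f'.natDegree - 1) < B.valuation z ^ (g'.natDegree - 1) := by
      have hz0 := zero_lt_one.trans hz1
      have e5 : B.valuation z ^ (g'.natDegree - 1) * B.valuation z =
          B.valuation x ^ (f'.natDegree - 1) * B.valuation x := by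
        rw [← pow_succ, ← pow_succ, Nat.sub_add_cancel h1', Nat.sub_add_cancel hf', hzx]
      refine lt_of_mul_lt_mul_right (a := B.valuation z) ?_ hz0.le
      rw [e5]
      exact mul_lt_mul_of_pos_left hzlt (pow_pos hx0 _)
    rw [Valuation.map_sub_eq_of_lt_left _ (by rw [d1]; exact d2.trans_lt d3), d1,
      valuation_aeval_derivative hy1 hg h1 h0]
    exact mul_ne_zero (pow_ne_zero _ (zero_lt_one.trans hy1).ne')
      (pow_ne_zero _ (zero_lt_one.trans hz1).ne')

end CurvePoints

section DividedDifference

variable {F : Type*} [Field F]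

/-- The divided difference `(f(a) - f(b)) / (a - b)` as a polynomial expression in `a` and `b`. -/
noncomputable def dividedDifference {R : Type*} [CommRing R] [Algebra F R] (f : Polynomial F)
    (a b : R) : R :=
  ∑ n ∈ range (f.natDegree + 1), f.coeff n • ∑ i ∈ range n, a ^ i * b ^ (n - 1 - i)

theorem dividedDifference_mul {R : Type*} [CommRing R] [Algebra F R] (f : Polynomial F)
    (a b : R) :
    dividedDifference f a b * (a - b) = Polynomial.aeval a f - Polynomial.aeval b f := by
  rw [dividedDifference, Finset.sum_mul, Polynomial.aeval_eq_sum_range,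
    Polynomial.aeval_eq_sum_range, ← Finset.sum_sub_distrib]
  refine Finset.sum_congr rfl fun n _ => ?_
  rw [smul_mul_assoc, geom_sum₂_mul, smul_sub]

theorem map_dividedDifference {R R' : Type*} [CommRing R] [Algebra F R] [CommRing R'] [Algebra F R']
    (φ : R →ₐ[F] R') (f : Polynomial F) (a b : R) :
    φ (dividedDifference f a b) = dividedDifference f (φ a) (φ b) := by
  simp [dividedDifference, map_sum, map_smul]

open MvPolynomial

theorem totalDegree_dividedDifference_le (f : Polynomial F) (i j : Fin 3) :
    (dividedDifference f (X i) (X j) : MvPolynomial (Fin 3) F).totalDegree ≤ f.natDegree - 1 := by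
  refine totalDegree_finsetSum_le fun n hn => (totalDegree_smul_le _ _).trans ?_
  refine totalDegree_finsetSum_le fun m hm => (totalDegree_mul _ _).trans ?_
  rw [totalDegree_X_pow, totalDegree_X_pow]
  have := Finset.mem_range.1 hn
  have := Finset.mem_range.1 hm
  omega

theorem pow_sub_dividedDifference_mem_span {f : Polynomial F} (hf : f.Monic) (h1 : 1 ≤ f.natDegree)
    (i j : Fin 3) {s : Set (ℕ × ℕ × ℕ)} (e : ℕ → ℕ → ℕ × ℕ × ℕ)
    (he : ∀ m n, tripleMonomial X (e m n) = (X i : MvPolynomial (Fin 3) F) ^ m * X j ^ n)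
    (hs : ∀ m n, n < f.natDegree - 1 → m + n ≤ f.natDegree - 1 → e m n ∈ s) :
    (X j : MvPolynomial (Fin 3) F) ^ (f.natDegree - 1) - dividedDifference f (X i) (X j) ∈
      Submodule.span F (tripleMonomial X '' s) := by
  have hmem : ∀ m n, n < f.natDegree - 1 → m + n ≤ f.natDegree - 1 →
      (X i : MvPolynomial (Fin 3) F) ^ m * X j ^ n ∈ Submodule.span F (tripleMonomial X '' s) :=
    fun m n h h' => Submodule.subset_span ⟨e m n, hs m n h h', he m n⟩
  obtain ⟨d, hd⟩ := Nat.exists_eq_add_of_le' h1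
  rw [dividedDifference, Finset.sum_range_succ, hf.coeff_natDegree, one_smul]
  rw [hd] at hmem ⊢
  rw [Nat.add_sub_cancel] at hmem ⊢
  have e2 : ∀ A B : MvPolynomial (Fin 3) F, X j ^ d - (A + (B + X j ^ d)) = -(A + B) :=
    fun A B => by ring
  rw [Finset.sum_range_succ' (fun m => X i ^ m * X j ^ (d - m)), pow_zero, one_mul, Nat.sub_zero,
    e2, add_comm]
  refine Submodule.neg_mem _ (Submodule.add_mem _ (Submodule.sum_mem _ fun m hm => ?_)
    (Submodule.sum_mem _ fun n hn => Submodule.smul_mem _ _ (Submodule.sum_mem _ fun m hm => ?_)))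
  · have := Finset.mem_range.1 hm
    exact hmem _ _ (by omega) (by omega)
  · have := Finset.mem_range.1 hm
    have := Finset.mem_range.1 hn
    exact hmem _ _ (by omega) (by omega)

theorem isTriangular_normal {f g : Polynomial F} (hg : g.Monic) (h : f.natDegree ≤ g.natDegree)
    (h1 : 1 ≤ g.natDegree) :
    IsTriangular (curveEquation f g) (dividedDifference g (X 1) (X 2)) g.natDegree
      (g.natDegree - 1) where
  deg₁ := totalDegree_curveEquation_le h
  deg₂ := totalDegree_dividedDifference_le g 1 2
  lead₁ := curveEquation_lead hg h h1
  lead₂ := pow_sub_dividedDifference_mem_span hg h1 1 2 (fun m n => (0, m, n))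
    (by simp [tripleMonomial]) (fun m n h h' => ⟨h, by simpa only [zero_add] using h'⟩)

theorem isTriangular_diagonal {f : Polynomial F} (hf : f.Monic) (h1 : 1 ≤ f.natDegree) :
    IsTriangular (dividedDifference f (X 0) (X 1) : MvPolynomial (Fin 3) F) (X 2 - 1)
      (f.natDegree - 1) 1 where
  deg₁ := totalDegree_dividedDifference_le f 0 1
  deg₂ := (totalDegree_sub _ _).trans (max_le (totalDegree_X _).le (by simp))
  lead₁ := pow_sub_dividedDifference_mem_span hf h1 0 1 (fun m n => (m, n, 0))
    (by simp [tripleMonomial]) (fun m n h h' => ⟨h, rfl, h'⟩)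
  lead₂ := Submodule.subset_span ⟨(0, 0, 0), by simp, by simp [tripleMonomial]⟩

theorem map_dividedDifference_X {φ : F →+* F} {f : Polynomial F} (hf : f.map φ = f) (i j : Fin 3) :
    map φ (dividedDifference f (X i) (X j)) = dividedDifference f (X i) (X j) := by
  have hc : ∀ n, φ (f.coeff n) = f.coeff n := fun n => by
    conv_rhs => rw [← hf, Polynomial.coeff_map]
  simp only [dividedDifference, map_sum, smul_eq_C_mul, map_mul, map_pow, map_C, map_X, hc]

end DividedDifference

section Counting

variable {p : ℕ} [hpF : Fact p.Prime]

open MvPolynomial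

theorem card_rational_points_le {F : Type*} [Field F] [IsAlgClosed F] [CharP F p]
    {q₁ q₂ : MvPolynomial (Fin 3) F} {d₁ d₂ : ℕ} (hd₁ : 1 ≤ d₁) (hd₂ : 1 ≤ d₂)
    (ht : IsTriangular q₁ q₂ d₁ d₂)
    {Ω : Type*} [Field Ω] [Algebra F Ω] {v : Fin 3 → Ω} (hv : IsGenericCurvePoint q₁ q₂ d₁ d₂ v)
    (h₁ : map (frobenius F p) q₁ = q₁) (h₂ : map (frobenius F p) q₂ = q₂)
    {S : Finset (Fin 3 → F)} (hS : ∀ P ∈ S, aeval P q₁ = 0 ∧ aeval P q₂ = 0 ∧ ∀ i, P i ^ p = P i)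
    {G : ℕ} (hG : 2 * (d₁ * d₂ * (d₁ + d₂)) + d₁ * d₂ + 2 ≤ G) (hp : (6 * G) ^ 2 ≤ p) :
    #S ≤ p + 4 * G * Nat.sqrt p := by
  have := card_curve_points_le (ρ := 1) (u := X) (w := X) (r₁ := q₁) (r₂ := q₂) (S := S) (G := G)
    hd₁ hd₂ ht hv h₁ h₂ le_rfl ht
    (one_mul _).symm (fun i => (totalDegree_X i).le) (fun i => (totalDegree_X i).le)
    (by rw [aeval_X_left_apply]; exact left_mem_curveIdeal)
    (by rw [aeval_X_left_apply]; exact right_mem_curveIdeal)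
    (by rw [aeval_X_left_apply]; exact left_mem_curveIdeal)
    (by rw [aeval_X_left_apply]; exact right_mem_curveIdeal)
    (fun P hP => ⟨(hS P hP).1, (hS P hP).2.1, P, (hS P hP).1, (hS P hP).2.1,
      fun i => aeval_X _ _, fun i => by rw [aeval_X, (hS P hP).2.2]⟩) (by omega) (by simpa using hp)
  simpa using this

variable {f g f' g' : Polynomial (ZMod p)}

/-- The image of a polynomial over the prime field in the algebraic closure. -/
noncomputable abbrev liftPoly (f : Polynomial (ZMod p)) :
    Polynomial (AlgebraicClosure (ZMod p)) :=
  f.map (algebraMap (ZMod p) (AlgebraicClosure (ZMod p)))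

theorem liftPoly_map_frobenius (f : Polynomial (ZMod p)) :
    (liftPoly f).map (frobenius (AlgebraicClosure (ZMod p)) p) = liftPoly f := by
  rw [liftPoly, Polynomial.map_map]
  congr 1
  exact RingHom.ext_zmod _ _

theorem algebraMap_pow_char (x : ZMod p) :
    algebraMap (ZMod p) (AlgebraicClosure (ZMod p)) x ^ p = algebraMap (ZMod p) _ x := by
  rw [← map_pow, ZMod.pow_card]

theorem aeval_liftPoly_algebraMap (f : Polynomial (ZMod p)) (x : ZMod p) :
    Polynomial.aeval (algebraMap (ZMod p) (AlgebraicClosure (ZMod p)) x) (liftPoly f) =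
      algebraMap (ZMod p) _ (f.eval x) := by
  rw [Polynomial.coe_aeval_eq_eval, Polynomial.eval_map, Polynomial.eval₂_at_apply]

omit hpF in
theorem lt_of_sq_le {n G q : ℕ} (h : n + 1 ≤ G) (hq : (6 * G) ^ 2 ≤ q) : n < q := by
  have : G ≤ G * G := Nat.le_mul_of_pos_left _ (by omega)
  have : (6 * G) ^ 2 = 36 * (G * G) := by ring
  omega

omit hpF in
theorem natCast_ne_zero_of_lt {F : Type*} [Field F] [CharP F p] {n : ℕ} (h1 : 1 ≤ n) (h : n < p) :
    (n : F) ≠ 0 := by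
  rw [Ne, CharP.cast_eq_zero_iff F p]
  exact fun hd => (Nat.le_of_dvd h1 hd).not_gt h

theorem card_curve_le (hf : 1 ≤ f.natDegree) (hg : g.Monic) (h : f.natDegree ≤ g.natDegree)
    (hc : Nat.Coprime g.natDegree f.natDegree) {G : ℕ}
    (hG : 2 * (g.natDegree * (g.natDegree + 1)) + g.natDegree + 2 ≤ G)
    (hp : (6 * G) ^ 2 ≤ p) :
    #{P : ZMod p × ZMod p | g.eval P.2 = f.eval P.1} ≤ p + 4 * G * Nat.sqrt p := by
  classical
  have hlt : g.natDegree < p := lt_of_sq_le (by omega) hp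
  have h1 := hf.trans h
  have ef : (liftPoly f).natDegree = f.natDegree := Polynomial.natDegree_map _
  have eg : (liftPoly g).natDegree = g.natDegree := Polynomial.natDegree_map _
  obtain ⟨v, hv⟩ := exists_genericPoint_curve (f := liftPoly f) (g := liftPoly g)
    (by rwa [ef]) (hg.map _) (by rwa [eg]) (by rwa [ef, eg])
    (natCast_ne_zero_of_lt (by rwa [eg]) (by rwa [eg]))
  let ι := algebraMap (ZMod p) (AlgebraicClosure (ZMod p))
  have hι : Function.Injective ι := ι.injective
  let E : ZMod p × ZMod p → (Fin 3 → AlgebraicClosure (ZMod p)) := fun P => ![ι P.1, ι P.2, 1]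
  have hE : Function.Injective E := fun P Q hPQ => Prod.ext
    (hι (congrFun hPQ 0)) (hι (congrFun hPQ 1))
  rw [← Finset.card_image_of_injective _ hE]
  refine card_rational_points_le (by rwa [eg]) le_rfl
    (isTriangular_curve (hg.map _) (by rwa [ef, eg]) (by rwa [eg])) hv
    (map_curveEquation (liftPoly_map_frobenius f) (liftPoly_map_frobenius g)) (by simp) ?_
    (by simpa [eg] using hG) hp
  intro P hP
  obtain ⟨⟨x, y⟩, hxy, rfl⟩ := Finset.mem_image.1 hP
  simp only [Finset.mem_filter_univ] at hxy
  refine ⟨?_, by simp [E], fun i => ?_⟩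
  · rw [aeval_curveEquation]
    change Polynomial.aeval (ι y) _ - Polynomial.aeval (ι x) _ = 0
    rw [aeval_liftPoly_algebraMap, aeval_liftPoly_algebraMap, hxy, sub_self]
  · fin_cases i
    exacts [algebraMap_pow_char x, algebraMap_pow_char y, one_pow p]

theorem card_shift_le (hf : 1 ≤ f.natDegree) (hg : g.Monic) (h : f.natDegree < g.natDegree)
    (hf' : 1 ≤ f'.natDegree) (hg' : g'.Monic) (h' : f'.natDegree < g'.natDegree)
    (hc : Nat.Coprime g.natDegree (f.natDegree * g'.natDegree))
    (hc' : Nat.Coprime g'.natDegree (f'.natDegree * g.natDegree)) {G : ℕ}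
    (hG : 2 * (g.natDegree * g'.natDegree * (g.natDegree + g'.natDegree)) +
      g.natDegree * g'.natDegree + 2 ≤ G) (hp : (6 * G) ^ 2 ≤ p) (τ : ZMod p) :
    #{P : (ZMod p × ZMod p) × (ZMod p × ZMod p) | g.eval P.1.2 = f.eval P.1.1 ∧
      g'.eval P.2.2 = f'.eval P.2.1 ∧ (P.1.1 - P.1.2) - (P.2.1 - P.2.2) = τ} ≤
      p + 4 * G * Nat.sqrt p := by
  classical
  have h1 := hf.trans h.le
  have h1' := hf'.trans h'.le
  have hlt : g.natDegree < p := by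
    have : g.natDegree ≤ g.natDegree * g'.natDegree := Nat.le_mul_of_pos_right _ h1'
    exact lt_of_sq_le (by omega) hp
  have hlt' : g'.natDegree < p := by
    have : g'.natDegree ≤ g.natDegree * g'.natDegree := Nat.le_mul_of_pos_left _ h1
    exact lt_of_sq_le (by omega) hp
  have ef : (liftPoly f).natDegree = f.natDegree := Polynomial.natDegree_map _
  have eg : (liftPoly g).natDegree = g.natDegree := Polynomial.natDegree_map _
  have ef' : (liftPoly f').natDegree = f'.natDegree := Polynomial.natDegree_map _
  have eg' : (liftPoly g').natDegree = g'.natDegree := Polynomial.natDegree_map _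
  let ι := algebraMap (ZMod p) (AlgebraicClosure (ZMod p))
  have hι : Function.Injective ι := ι.injective
  obtain ⟨v, hv⟩ := exists_genericPoint_shift (f := liftPoly f) (g := liftPoly g)
    (f' := liftPoly f') (g' := liftPoly g')
    (by rwa [ef]) (hg.map _) (by rwa [ef, eg])
    (natCast_ne_zero_of_lt (by rwa [eg]) (by rwa [eg]))
    (by rwa [ef']) (hg'.map _) (by rwa [ef', eg'])
    (natCast_ne_zero_of_lt (by rwa [eg']) (by rwa [eg'])) (by rwa [ef, eg, eg'])
    (by rwa [ef', eg, eg']) (ι τ)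
  let E : (ZMod p × ZMod p) × (ZMod p × ZMod p) → (Fin 3 → AlgebraicClosure (ZMod p)) :=
    fun P => ![ι P.1.1, ι P.1.2, ι P.2.2]
  rw [← Finset.card_image_of_injOn (f := E)]
  · refine card_rational_points_le (by rwa [eg]) (by rwa [eg'])
      (isTriangular_shift (hg.map _) (by rw [ef, eg]; exact h.le) (by rwa [eg]) (hg'.map _)
        (by rwa [ef', eg']) (ι τ)) hv
      (map_curveEquation (liftPoly_map_frobenius f) (liftPoly_map_frobenius g))
      (map_shiftEquation (liftPoly_map_frobenius f') (liftPoly_map_frobenius g')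
        (algebraMap_pow_char τ)) ?_ (by simpa only [eg, eg'] using hG) hp
    intro P hP
    obtain ⟨⟨⟨x, y⟩, ⟨x', y'⟩⟩, hxy, rfl⟩ := Finset.mem_image.1 hP
    simp only [Finset.mem_filter_univ] at hxy
    obtain ⟨hxy, hxy', hτ⟩ := hxy
    refine ⟨?_, ?_, fun i => ?_⟩
    · rw [aeval_curveEquation]
      change Polynomial.aeval (ι y) _ - Polynomial.aeval (ι x) _ = 0
      rw [aeval_liftPoly_algebraMap, aeval_liftPoly_algebraMap, hxy, sub_self]
    · rw [aeval_shiftEquation]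
      change Polynomial.aeval (ι y') _ - Polynomial.aeval (ι x - ι y + ι y' - ι τ) _ = 0
      have : ι x - ι y + ι y' - ι τ = ι x' := by
        rw [← map_sub, ← map_add, ← map_sub, ← hτ]; congr 1; ring
      rw [this, aeval_liftPoly_algebraMap, aeval_liftPoly_algebraMap, hxy', sub_self]
    · fin_cases i
      exacts [algebraMap_pow_char x, algebraMap_pow_char y, algebraMap_pow_char y']
  · rintro ⟨⟨x, y⟩, ⟨x', y'⟩⟩ hP ⟨⟨a, b⟩, ⟨a', b'⟩⟩ hQ hPQ
    simp only [Finset.coe_filter, Finset.mem_univ, true_and, Set.mem_ofPred_eq] at hP hQ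
    have e0 : x = a := hι (congrFun hPQ 0)
    have e1 : y = b := hι (congrFun hPQ 1)
    have e2 : y' = b' := hι (congrFun hPQ 2)
    have e3 : x' = a' := by linear_combination hQ.2.2 - hP.2.2 + e0 - e1 + e2
    rw [e0, e1, e2, e3]

end Counting

section LowerBound

variable {p : ℕ} [hpF : Fact p.Prime]

theorem exists_algebraMap_of_pow_eq {F : Type*} [Field F] [Algebra (ZMod p) F] {y : F}
    (hy : y ^ p = y) : ∃ b : ZMod p, algebraMap (ZMod p) F b = y := by
  classical
  have h1p : 1 < p := hpF.out.one_lt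
  let r : Polynomial F := Polynomial.X ^ p - Polynomial.X
  have hr0 : r ≠ 0 := FiniteField.X_pow_card_sub_X_ne_zero F h1p
  have hsub : univ.image (algebraMap (ZMod p) F) ⊆ r.roots.toFinset := by
    intro z hz
    obtain ⟨b, -, rfl⟩ := Finset.mem_image.1 hz
    rw [Multiset.mem_toFinset, Polynomial.mem_roots hr0]
    simp [r, ← map_pow, ZMod.pow_card]
  have hcard : #r.roots.toFinset ≤ #(univ.image (algebraMap (ZMod p) F)) := by
    rw [Finset.card_image_of_injective _ (algebraMap (ZMod p) F).injective, Finset.card_univ,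
      ZMod.card]
    refine (Multiset.toFinset_card_le _).trans ((Polynomial.card_roots' _).trans ?_)
    rw [FiniteField.X_pow_card_sub_X_natDegree_eq F h1p]
  have hmem : y ∈ r.roots.toFinset := by
    rw [Multiset.mem_toFinset, Polynomial.mem_roots hr0]
    simp [r, hy]
  rw [← Finset.eq_of_subset_of_card_le hsub hcard] at hmem
  obtain ⟨b, -, hb⟩ := Finset.mem_image.1 hmem
  exact ⟨b, hb⟩

theorem card_fiber_eq {F : Type*} [Field F] [IsAlgClosed F] [DecidableEq F] {g : Polynomial F}
    {c : F} (hg : 1 ≤ g.natDegree)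
    (h : ∀ y, Polynomial.eval y g.derivative = 0 → Polynomial.eval y g ≠ c) :
    #(g - Polynomial.C c).roots.toFinset = g.natDegree := by
  have hne : g - Polynomial.C c ≠ 0 := by
    intro h0
    have := congrArg Polynomial.natDegree h0
    rw [Polynomial.natDegree_sub_C, Polynomial.natDegree_zero] at this
    omega
  have hnd : (g - Polynomial.C c).roots.Nodup := by
    rw [Multiset.nodup_iff_count_le_one]
    intro y
    by_contra! hlt
    rw [Polynomial.count_roots, Polynomial.one_lt_rootMultiplicity_iff_isRoot hne] at hlt
    obtain ⟨h1, h2⟩ := hlt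
    refine h y ?_ ?_
    · simpa [Polynomial.IsRoot] using h2
    · simpa [Polynomial.IsRoot, sub_eq_zero] using h1
  rw [Multiset.toFinset_card_of_nodup hnd,
    ← (IsAlgClosed.splits _).natDegree_eq_card_roots, Polynomial.natDegree_sub_C]

theorem card_branch_le {F : Type*} [Field F] [DecidableEq F] {f g : Polynomial F}
    (hf : 1 ≤ f.natDegree) (hg : g.derivative ≠ 0) (T : Finset F)
    (hT : ∀ x ∈ T, ∃ y, Polynomial.eval y g.derivative = 0 ∧
      Polynomial.eval y g = Polynomial.eval x f) :
    #T ≤ (g.natDegree - 1) * f.natDegree := by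
  have hsub : T ⊆ g.derivative.roots.toFinset.biUnion
      fun y => (f - Polynomial.C (Polynomial.eval y g)).roots.toFinset := by
    intro x hx
    obtain ⟨y, hy, hyx⟩ := hT x hx
    have hne : f - Polynomial.C (Polynomial.eval y g) ≠ 0 := by
      intro h0
      have := congrArg Polynomial.natDegree h0
      rw [Polynomial.natDegree_sub_C, Polynomial.natDegree_zero] at this
      omega
    rw [Finset.mem_biUnion]
    refine ⟨y, ?_, ?_⟩
    · rw [Multiset.mem_toFinset, Polynomial.mem_roots hg]; exact hy
    · rw [Multiset.mem_toFinset, Polynomial.mem_roots hne]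
      simp [hyx]
  refine (Finset.card_le_card hsub).trans ((Finset.card_biUnion_le_card_mul _ _ f.natDegree
    fun y _ => ?_).trans (Nat.mul_le_mul_right _ ?_))
  · refine (Multiset.toFinset_card_le _).trans ((Polynomial.card_roots' _).trans ?_)
    rw [Polynomial.natDegree_sub_C]
  · exact (Multiset.toFinset_card_le _).trans ((Polynomial.card_roots' _).trans
      (Polynomial.natDegree_derivative_le g))

open MvPolynomial

variable {f g : Polynomial (ZMod p)}

theorem card_nonrational_le (hf : 1 ≤ f.natDegree) (hg : g.Monic) (h : f.natDegree ≤ g.natDegree)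
    (h2 : 2 ≤ g.natDegree) (hc : Nat.Coprime g.natDegree f.natDegree) {G : ℕ}
    (hG : g.natDegree * (g.natDegree + 1) + (g.natDegree - 1) ^ 2 +
      (g.natDegree - 1) * (g.natDegree * (g.natDegree + 1)) + g.natDegree + 1 ≤ G)
    (hp : (6 * G * (g.natDegree - 1)) ^ 2 ≤ p)
    (S : Finset (Σ _ : ZMod p, AlgebraicClosure (ZMod p)))
    (hS : ∀ P ∈ S, Polynomial.aeval P.2 (liftPoly g) = algebraMap _ _ (f.eval P.1) ∧
      P.2 ^ p ≠ P.2) :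
    #S ≤ (g.natDegree - 1) * p + 4 * G * Nat.sqrt p := by
  classical
  have h1 := hf.trans h
  have hlt : g.natDegree < p := by
    refine lt_of_sq_le (G := G * (g.natDegree - 1)) ?_ (by rwa [← mul_assoc])
    have : G ≤ G * (g.natDegree - 1) := Nat.le_mul_of_pos_right _ (by omega)
    omega
  have ef : (liftPoly f).natDegree = f.natDegree := Polynomial.natDegree_map _
  have eg : (liftPoly g).natDegree = g.natDegree := Polynomial.natDegree_map _
  obtain ⟨v, hv⟩ := exists_genericPoint_curve (f := liftPoly f) (g := liftPoly g)
    (by rwa [ef]) (hg.map _) (by rwa [eg]) (by rwa [ef, eg])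
    (natCast_ne_zero_of_lt (by rwa [eg]) (by rwa [eg]))
  let ι := algebraMap (ZMod p) (AlgebraicClosure (ZMod p))
  have hι : Function.Injective ι := ι.injective
  let E : (Σ _ : ZMod p, AlgebraicClosure (ZMod p)) → (Fin 3 → AlgebraicClosure (ZMod p)) :=
    fun P => ![ι P.1, P.2, 1]
  have hE : Function.Injective E := by
    rintro ⟨x, y⟩ ⟨x', y'⟩ hPQ
    have e0 : x = x' := hι (congrFun hPQ 0)
    have e1 : y = y' := congrFun hPQ 1
    rw [e0, e1]
  rw [← Finset.card_image_of_injective _ hE]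
  refine card_curve_points_le (by rwa [eg]) le_rfl
    (isTriangular_curve (hg.map _) (by rwa [ef, eg]) (by rwa [eg])) hv
    (map_curveEquation (liftPoly_map_frobenius f) (liftPoly_map_frobenius g)) (by simp)
    (by omega) (isTriangular_normal (f := liftPoly f) (g := liftPoly g) (hg.map _)
      (by rwa [ef, eg]) (by rwa [eg])) ?_
    (u := ![X 0, X 1, 1]) (w := ![X 0, X 2, 1]) ?_ ?_ ?_ ?_ ?_ ?_ ?_ ?_ hp
  · rw [eg, mul_one, mul_comm]
  · intro i; fin_cases i <;> simp
  · intro i; fin_cases i <;> simp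
  · have : aeval ![X 0, X 1, 1] (curveEquation (liftPoly f) (liftPoly g)) =
        curveEquation (liftPoly f) (liftPoly g) := by
      rw [aeval_curveEquation]; rfl
    rw [this]; exact left_mem_curveIdeal
  · have : aeval ![X 0, X 1, 1] (X 2 - 1 : MvPolynomial (Fin 3) (AlgebraicClosure (ZMod p))) =
      (0 : MvPolynomial (Fin 3) (AlgebraicClosure (ZMod p))) := by simp
    rw [this]; exact zero_mem _
  · have : aeval ![X 0, X 2, 1] (curveEquation (liftPoly f) (liftPoly g)) =
        curveEquation (liftPoly f) (liftPoly g) -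
          dividedDifference (liftPoly g) (X 1) (X 2) * (X 1 - X 2) := by
      rw [aeval_curveEquation, dividedDifference_mul, curveEquation]
      simp
    rw [this]
    exact sub_mem left_mem_curveIdeal (Ideal.mul_mem_right _ _ right_mem_curveIdeal)
  · have : aeval ![X 0, X 2, 1] (X 2 - 1 : MvPolynomial (Fin 3) (AlgebraicClosure (ZMod p))) =
      (0 : MvPolynomial (Fin 3) (AlgebraicClosure (ZMod p))) := by simp
    rw [this]; exact zero_mem _
  · intro P hP
    obtain ⟨⟨x, y⟩, hxy, rfl⟩ := Finset.mem_image.1 hP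
    obtain ⟨hy, hyp⟩ := hS _ hxy
    simp only at hy hyp
    have hz : aeval (E ⟨x, y⟩) (curveEquation (liftPoly f) (liftPoly g)) = 0 := by
      rw [aeval_curveEquation]
      change Polynomial.aeval y _ - Polynomial.aeval (ι x) _ = 0
      rw [aeval_liftPoly_algebraMap, hy, sub_self]
    have hyfrob : Polynomial.aeval (y ^ p) (liftPoly g) = algebraMap _ _ (f.eval x) := by
      have e1 := Polynomial.hom_eval₂ (liftPoly g) (RingHom.id _)
        (frobenius (AlgebraicClosure (ZMod p)) p) y
      rw [Polynomial.coe_aeval_eq_eval] at hy ⊢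
      rw [Polynomial.eval₂_id, hy, RingHom.comp_id, ← Polynomial.eval_map,
        liftPoly_map_frobenius, frobenius_def, frobenius_def, algebraMap_pow_char] at e1
      exact e1.symm
    refine ⟨hz, by simp [E], ![ι x, y, y ^ p], ?_, ?_, fun i => ?_, fun i => ?_⟩
    · rw [aeval_curveEquation] at hz ⊢
      exact hz
    · rw [map_dividedDifference, aeval_X, aeval_X]
      have e2 := dividedDifference_mul (liftPoly g) y (y ^ p)
      rw [hyfrob, hy, sub_self] at e2
      exact (mul_eq_zero.1 e2).resolve_right (sub_ne_zero.2 hyp.symm)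
    · fin_cases i <;> simp [E]
    · fin_cases i
      · change aeval _ (X 0) = ι x ^ p
        rw [aeval_X]
        exact (algebraMap_pow_char x).symm
      · simp [E]
      · simp [E]
  · simpa [eg] using hG

theorem le_card_curve_add (hf : 1 ≤ f.natDegree) (hg : g.Monic) (h : f.natDegree ≤ g.natDegree)
    (h2 : 2 ≤ g.natDegree) (hc : Nat.Coprime g.natDegree f.natDegree) {G : ℕ}
    (hG : g.natDegree * (g.natDegree + 1) + (g.natDegree - 1) ^ 2 +
      (g.natDegree - 1) * (g.natDegree * (g.natDegree + 1)) + g.natDegree + 1 ≤ G)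
    (hp : (6 * G * (g.natDegree - 1)) ^ 2 ≤ p) :
    p ≤ #{P : ZMod p × ZMod p | g.eval P.2 = f.eval P.1} +
      g.natDegree * ((g.natDegree - 1) * f.natDegree) + 4 * G * Nat.sqrt p := by
  classical
  have h1 := hf.trans h
  have hlt : g.natDegree < p := by
    refine lt_of_sq_le (G := G * (g.natDegree - 1)) ?_ (by rwa [← mul_assoc])
    have : G ≤ G * (g.natDegree - 1) := Nat.le_mul_of_pos_right _ (by omega)
    omega
  have ef : (liftPoly f).natDegree = f.natDegree := Polynomial.natDegree_map _
  have eg : (liftPoly g).natDegree = g.natDegree := Polynomial.natDegree_map _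
  let ι := algebraMap (ZMod p) (AlgebraicClosure (ZMod p))
  have hι : Function.Injective ι := ι.injective
  have hder : (liftPoly g).derivative ≠ 0 := by
    intro h0
    have e := congrArg (fun q => Polynomial.coeff q (g.natDegree - 1)) h0
    simp only [Polynomial.coeff_derivative, Polynomial.coeff_zero, Nat.sub_add_cancel h1,
      ← Nat.cast_add_one] at e
    rw [← eg, (hg.map _).coeff_natDegree, one_mul] at e
    exact natCast_ne_zero_of_lt (p := p) (by rwa [eg]) (by rwa [eg]) e
  let R : ZMod p → Finset (AlgebraicClosure (ZMod p)) := fun x =>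
    (liftPoly g - Polynomial.C (ι (f.eval x))).roots.toFinset
  have hne : ∀ c, liftPoly g - Polynomial.C c ≠ 0 := by
    intro c h0
    have := congrArg Polynomial.natDegree h0
    rw [Polynomial.natDegree_sub_C, Polynomial.natDegree_zero] at this
    omega
  have hR : ∀ x y, y ∈ R x ↔ Polynomial.aeval y (liftPoly g) = ι (f.eval x) := by
    intro x y
    simp only [R]
    rw [Multiset.mem_toFinset, Polynomial.mem_roots (hne _), Polynomial.coe_aeval_eq_eval,
      Polynomial.IsRoot, Polynomial.eval_sub, Polynomial.eval_C, sub_eq_zero]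
  let bad : Finset (ZMod p) := {x | ∃ y, Polynomial.eval y (liftPoly g).derivative = 0 ∧
    Polynomial.eval y (liftPoly g) = ι (f.eval x)}
  have hbad : #bad ≤ (g.natDegree - 1) * f.natDegree := by
    rw [← Finset.card_image_of_injective _ hι, ← eg, ← ef]
    refine card_branch_le (by rwa [ef]) hder _ fun z hz => ?_
    obtain ⟨x, hx, rfl⟩ := Finset.mem_image.1 hz
    obtain ⟨y, hy, hyx⟩ := (Finset.mem_filter_univ _).1 hx
    refine ⟨y, hy, ?_⟩
    rw [hyx, ← aeval_liftPoly_algebraMap, Polynomial.coe_aeval_eq_eval]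
  have hgood : ∀ x ∉ bad, #(R x) = g.natDegree := by
    intro x hx
    rw [← eg]
    refine card_fiber_eq (by rwa [eg]) fun y hy hyx => hx ?_
    exact (Finset.mem_filter_univ _).2 ⟨y, hy, hyx⟩
  have hsum : g.natDegree * (p - #bad) ≤ ∑ x, #(R x) := by
    calc g.natDegree * (p - #bad) = ∑ x ∈ badᶜ, #(R x) := by
          rw [Finset.sum_congr rfl fun x hx => hgood x (Finset.mem_compl.1 hx), Finset.sum_const,
            Finset.card_compl, ZMod.card, smul_eq_mul, mul_comm]
      _ ≤ _ := Finset.sum_le_univ_sum_of_nonneg fun _ => Nat.zero_le _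
  have hsplit : ∑ x, #(R x) = ∑ x, #{y ∈ R x | y ^ p = y} + ∑ x, #{y ∈ R x | y ^ p ≠ y} := by
    rw [← Finset.sum_add_distrib]
    exact Finset.sum_congr rfl fun x _ => (Finset.card_filter_add_card_filter_not _).symm
  have hrat : ∑ x, #{y ∈ R x | y ^ p = y} ≤ #{P : ZMod p × ZMod p | g.eval P.2 = f.eval P.1} := by
    rw [← Finset.card_sigma]
    refine Finset.card_le_card_of_surjOn (fun P : ZMod p × ZMod p => ⟨P.1, ι P.2⟩) ?_
    rintro ⟨x, y⟩ hxy
    simp only [Finset.coe_sigma, Set.mem_sigma_iff, Finset.coe_filter, Set.mem_ofPred_eq, hR] at hxy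
    obtain ⟨b, rfl⟩ := exists_algebraMap_of_pow_eq hxy.2.2
    refine ⟨(x, b), ?_, rfl⟩
    have := hxy.2.1
    rw [aeval_liftPoly_algebraMap] at this
    simpa using hι this
  have hnon : ∑ x, #{y ∈ R x | y ^ p ≠ y} ≤ (g.natDegree - 1) * p + 4 * G * Nat.sqrt p := by
    rw [← Finset.card_sigma]
    refine card_nonrational_le hf hg h h2 hc hG hp _ ?_
    rintro ⟨x, y⟩ hxy
    simp only [Finset.mem_sigma, Finset.mem_filter, hR] at hxy
    exact hxy.2
  have hpbad : p ≤ (p - #bad) + (g.natDegree - 1) * f.natDegree := by omega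
  obtain ⟨d, hd⟩ := Nat.exists_eq_add_of_le' h1
  rw [hd, Nat.add_sub_cancel] at hpbad hnon ⊢
  rw [hd] at hsum
  nlinarith only [Nat.mul_le_mul_left (d + 1) hpbad, hsum, hsplit, hrat, hnon]

end LowerBound

section CyclicSums

theorem coeff_eq_of_sum_zmodChar_eq_zero {k : ℕ} [Fact k.Prime] {ζ : ℂ} (hζ : IsPrimitiveRoot ζ k)
    {c : ZMod k → ℤ} (h : ∑ m, (c m : ℂ) * ζ ^ m.val = 0) (m n : ZMod k) : c m = c n := by
  have hk : k.Prime := Fact.out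
  let Q : Polynomial ℤ := ∑ m : ZMod k, Polynomial.monomial m.val (c m)
  have hQ : Polynomial.aeval ζ Q = 0 := by
    rw [← h, map_sum]
    exact Finset.sum_congr rfl fun m _ => by simp [Polynomial.aeval_monomial]
  have hcoeff : ∀ m : ZMod k, Q.coeff m.val = c m := fun m => by
    simp only [Q, Polynomial.finsetSum_coeff, Polynomial.coeff_monomial]
    rw [Finset.sum_eq_single m (fun b _ hb => if_neg fun h => hb (ZMod.val_injective k h))
      (fun h => (h (Finset.mem_univ _)).elim), if_pos rfl]
  have hdvd : Polynomial.cyclotomic k ℤ ∣ Q := by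
    rw [Polynomial.cyclotomic_eq_minpoly hζ hk.pos]
    exact minpoly.isIntegrallyClosed_dvd (hζ.isIntegral hk.pos) hQ
  obtain ⟨R, hR⟩ := hdvd
  have hdeg : Q.natDegree ≤ k - 1 := by
    refine Polynomial.natDegree_sum_le_of_forall_le _ _ fun m _ => ?_
    refine (Polynomial.natDegree_monomial_le _).trans ?_
    have := ZMod.val_lt m
    omega
  have hRC : ∃ r, R = Polynomial.C r := by
    by_cases h0 : R = 0
    · exact ⟨0, by rw [h0, map_zero]⟩
    have h1 := Polynomial.natDegree_mul (Polynomial.cyclotomic_ne_zero k ℤ) h0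
    rw [← hR, Polynomial.natDegree_cyclotomic, Nat.totient_prime hk] at h1
    exact ⟨_, Polynomial.eq_C_of_natDegree_eq_zero (by omega)⟩
  obtain ⟨r, rfl⟩ := hRC
  have hr : ∀ m, c m = r := fun m => by
    rw [← hcoeff, hR, Polynomial.coeff_mul_C, Polynomial.cyclotomic_prime]
    simp only [Polynomial.finsetSum_coeff, Polynomial.coeff_X_pow]
    rw [Finset.sum_ite_eq, if_pos (Finset.mem_range.2 (ZMod.val_lt m)), one_mul]
  rw [hr, hr]

theorem eq_compl_zero_of_sum_shift_eq {k : ℕ} [Fact k.Prime] {v : ZMod k → ℤ} {a b : ZMod k}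
    (hv : v a ≠ v b) {Z : Finset (ZMod k)} (hZ : Z.Nonempty) (h0 : 0 ∉ Z) {E C : ℤ}
    (h : ∀ m, ∑ n ∈ Z, v (m + n) = E * v m + C) {m : ZMod k} (hm : m ≠ 0) : m ∈ Z := by
  have hk : k.Prime := Fact.out
  have hζ := Complex.isPrimitiveRoot_exp k hk.ne_zero
  set ζ := Complex.exp (2 * Real.pi * Complex.I / k)
  let e := AddChar.zmodChar k hζ.pow_eq_one
  have he : ∀ m : ZMod k, e m = ζ ^ m.val := fun m => AddChar.zmodChar_apply _ m
  have hsum0 : ∑ m, e m = 0 := by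
    refine AddChar.sum_eq_zero_of_ne_one fun h1 => ?_
    have := he 1
    rw [h1, AddChar.one_apply, ZMod.val_one, pow_one] at this
    exact hζ.ne_one hk.one_lt this.symm
  let W := ∑ m, (v m : ℂ) * e m
  have hW : W ≠ 0 := fun hW => hv (coeff_eq_of_sum_zmodChar_eq_zero hζ
    (by rw [← hW]; exact Finset.sum_congr rfl fun m _ => by rw [he]) a b)
  have h1 : ∑ m, ((∑ n ∈ Z, v (m + n) : ℤ) : ℂ) * e m = (∑ n ∈ Z, e (-n)) * W := by
    simp only [Int.cast_sum, Finset.sum_mul]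
    rw [Finset.sum_comm]
    refine Finset.sum_congr rfl fun n _ => ?_
    rw [Finset.mul_sum, ← Equiv.sum_comp (Equiv.addRight n) (fun m => e (-n) * ((v m : ℂ) * e m))]
    refine Finset.sum_congr rfl fun m _ => ?_
    simp only [Equiv.coe_addRight]
    rw [mul_left_comm, ← AddChar.map_add_eq_mul]
    congr 2
    ring
  have h2 : ∑ m, ((∑ n ∈ Z, v (m + n) : ℤ) : ℂ) * e m = E * W := by
    simp only [h, Int.cast_add, Int.cast_mul, add_mul, Finset.sum_add_distrib]
    rw [← Finset.mul_sum, hsum0, mul_zero, add_zero, Finset.mul_sum]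
    exact Finset.sum_congr rfl fun m _ => by ring
  have h3 : ∑ n ∈ Z, e (-n) = E := mul_right_cancel₀ hW (h1.symm.trans h2)
  let c : ZMod k → ℤ := fun n => (if -n ∈ Z then 1 else 0) - (if n = 0 then E else 0)
  have hc : ∑ n, (c n : ℂ) * ζ ^ n.val = 0 := by
    simp only [← he, c, Int.cast_sub, sub_mul, Finset.sum_sub_distrib]
    rw [sub_eq_zero]
    trans (E : ℂ)
    · rw [← h3, ← Equiv.sum_comp (Equiv.neg _)]
      simp [Finset.sum_ite_mem]
    · rw [Finset.sum_eq_single 0 (by intro b _ hb; simp [hb]) (by simp)]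
      simp
  obtain ⟨n, hn⟩ := hZ
  have hn0 : n ≠ 0 := fun h => h0 (h ▸ hn)
  have h4 := coeff_eq_of_sum_zmodChar_eq_zero hζ hc (-m) (-n)
  by_contra hmZ
  simp [c, hm, hn0, hmZ, hn] at h4

theorem exists_affine_int_of_affine_char {κ : Type*} [Field κ] {p k : ℕ} [CharP κ p]
    (hp : 2 * k ^ 2 < p) {T : ℕ → ℤ} (hT : ∀ i, 1 ≤ i → i ≤ k → 0 ≤ T i ∧ T i ≤ k ^ 2) {α β : κ}
    (h : ∀ i : ℕ, 1 ≤ i → i ≤ k → (T i : κ) = α * i + β) :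
    ∃ E C : ℤ, ∀ i : ℕ, 1 ≤ i → i ≤ k → T i = E * i + C := by
  refine ⟨T 2 - T 1, T 1 - (T 2 - T 1), fun i hi => ?_⟩
  induction i, hi using Nat.le_induction with
  | base => intro _; push_cast; ring
  | succ i hi ih =>
    intro hik
    have h1 := hT 1 le_rfl (by omega)
    have h2 := hT 2 (by omega) (by omega)
    have h3 := hT i hi (by omega)
    have h4 := hT (i + 1) (by omega) hik
    have e : (((T (i + 1) - T i) - (T 2 - T 1) : ℤ) : κ) = 0 := by
      push_cast
      rw [h _ (by omega) hik, h _ hi (by omega), h 1 le_rfl (by omega), h 2 (by omega) (by omega)]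
      push_cast
      ring
    have hd := (CharP.intCast_eq_zero_iff κ p _).1 e
    have hz := Int.eq_zero_of_abs_lt_dvd hd (by
      have : (2 * k ^ 2 : ℤ) < p := by exact_mod_cast hp
      rw [abs_lt]
      constructor <;> linarith)
    have := ih (by omega)
    push_cast
    linear_combination hz + this

theorem eq_compl_zero_of_affine {κ : Type*} [Field κ] {p k : ℕ} [Fact k.Prime] [CharP κ p]
    (hp : 2 * k ^ 2 < p) {v : ZMod k → ℕ} (hinj : Function.Injective v)
    (hv : ∀ m, 1 ≤ v m ∧ v m ≤ k) {Z : Finset (ZMod k)} (hZ : Z.Nonempty) (h0 : 0 ∉ Z) {α β : κ}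
    (h : ∀ m, ∑ n ∈ Z, (v (m + n) : κ) = α * v m + β) {m : ZMod k} (hm : m ≠ 0) : m ∈ Z := by
  have himg : Finset.univ.image v = Finset.Icc 1 k := by
    refine Finset.eq_of_subset_of_card_le (fun i hi => ?_) ?_
    · obtain ⟨m, _, rfl⟩ := Finset.mem_image.1 hi
      exact Finset.mem_Icc.2 (hv m)
    · rw [Finset.card_image_of_injective _ hinj, Finset.card_univ, ZMod.card, Nat.card_Icc]
      omega
  have hsurj : ∀ i, 1 ≤ i → i ≤ k → ∃ m, v m = i := fun i hi hik => by
    have : i ∈ Finset.univ.image v := himg ▸ Finset.mem_Icc.2 ⟨hi, hik⟩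
    obtain ⟨m, _, e⟩ := Finset.mem_image.1 this
    exact ⟨m, e⟩
  have hinv := Function.leftInverse_invFun hinj
  obtain ⟨E, C, hEC⟩ := exists_affine_int_of_affine_char (κ := κ) hp
    (T := fun i => ∑ n ∈ Z, (v (Function.invFun v i + n) : ℤ)) (α := α) (β := β)
    (fun i _ _ => by
      refine ⟨Finset.sum_nonneg fun n _ => by positivity, ?_⟩
      refine (Finset.sum_le_card_nsmul _ _ (k : ℤ) fun n _ => by exact_mod_cast (hv _).2).trans ?_
      have : #Z ≤ k := (Finset.card_le_univ Z).trans (ZMod.card k).le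
      rw [nsmul_eq_mul, sq]
      gcongr)
    (fun i hi hik => by
      obtain ⟨m, rfl⟩ := hsurj i hi hik
      push_cast
      rw [hinv m, h])
  refine eq_compl_zero_of_sum_shift_eq (v := fun m => (v m : ℤ)) (a := 0) (b := 1) ?_ hZ h0
    (E := E) (C := C) (fun m => ?_) hm
  · exact fun h => zero_ne_one (hinj (by exact_mod_cast h))
  · have := hEC (v m) (hv m).1 (hv m).2
    rwa [hinv m] at this

end CyclicSums

section Specialization

open Polynomial

variable {F : Type*} [Field F]

/-- The equation `f(Y) = t` over the rational function field in `t`. -/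
noncomputable def levelPoly (f : Polynomial F) : Polynomial (RatFunc F) :=
  f.map (algebraMap F (RatFunc F)) - C RatFunc.X

theorem levelPoly_monic {f : Polynomial F} (hf : f.Monic) (h1 : 1 ≤ f.natDegree) :
    (levelPoly f).Monic := by
  refine (hf.map _).sub_of_left (degree_C_le.trans_lt ?_)
  rw [degree_map, degree_eq_natDegree hf.ne_zero]
  exact_mod_cast h1

theorem natDegree_levelPoly (f : Polynomial F) : (levelPoly f).natDegree = f.natDegree := by
  rw [levelPoly, natDegree_sub_C, natDegree_map]

theorem irreducible_levelPoly {f : Polynomial F} (hf : f.Monic) (h1 : 1 ≤ f.natDegree) :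
    Irreducible (levelPoly f) := by
  let φ : F[X][X] := f.map C - C X
  have hφ : φ.Monic := by
    refine (hf.map _).sub_of_left (degree_C_le.trans_lt ?_)
    rw [degree_map_eq_of_injective C_injective, degree_eq_natDegree hf.ne_zero]
    exact_mod_cast h1
  have e : levelPoly f = φ.map (algebraMap F[X] (RatFunc F)) := by
    simp only [φ, levelPoly, Polynomial.map_sub, Polynomial.map_map, map_C, RatFunc.algebraMap_X]
    congr 2
  rw [e, ← hφ.irreducible_iff_irreducible_map_fraction_map]
  have e2 : φ = Bivariate.swap (C f - X) := by
    rw [map_sub, Bivariate.swap_C, Bivariate.swap_Y]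
  rw [e2, MulEquiv.irreducible_iff, ← neg_sub]
  exact (Associated.refl _).neg_left.irreducible_iff.2 (irreducible_X_sub_C f)

theorem separable_levelPoly {f : Polynomial F} (hf : f.Monic) (h1 : 1 ≤ f.natDegree)
    (hd : f.derivative ≠ 0) : (levelPoly f).Separable := by
  rw [separable_iff_derivative_ne_zero (irreducible_levelPoly hf h1), levelPoly, derivative_sub,
    derivative_C, sub_zero, derivative_map]
  exact (Polynomial.map_ne_zero_iff (algebraMap F (RatFunc F)).injective).2 hd

/-- The Galois closure of `F(t)(x)` where `f(x) = t`. -/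
abbrev LevelField (f : Polynomial F) : Type _ := (levelPoly f).SplittingField

variable {f : Polynomial F}

theorem eval_levelPoly_map (ξ : LevelField f) :
    ((levelPoly f).map (algebraMap (RatFunc F) (LevelField f))).eval ξ =
      aeval ξ f - algebraMap (RatFunc F) (LevelField f) RatFunc.X := by
  have e : (levelPoly f).map (algebraMap (RatFunc F) (LevelField f)) =
      (f.map (algebraMap F (RatFunc F)) - C RatFunc.X).map
        (algebraMap (RatFunc F) (LevelField f)) := rfl
  rw [e, Polynomial.map_sub, eval_sub, Polynomial.map_map, map_C, eval_C,
    ← IsScalarTower.algebraMap_eq, eval_map_algebraMap]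

theorem mem_rootSet_levelPoly (hf : f.Monic) (h1 : 1 ≤ f.natDegree) {ξ : LevelField f} :
    ξ ∈ (levelPoly f).rootSet (LevelField f) ↔
      aeval ξ f = algebraMap (RatFunc F) (LevelField f) RatFunc.X := by
  rw [mem_rootSet_of_ne (levelPoly_monic hf h1).ne_zero, ← eval_map_algebraMap, eval_levelPoly_map,
    sub_eq_zero]

/-- The conjugates of a root, listed by the powers of an automorphism of prime order. -/
theorem exists_cyclic_roots (hf : f.Monic) (hk : f.natDegree.Prime) (hd : f.derivative ≠ 0) :
    ∃ (σ : LevelField f ≃ₐ[RatFunc F] LevelField f) (ξ : ZMod f.natDegree → LevelField f),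
      Function.Injective ξ ∧ (∀ m, ξ (m + 1) = σ (ξ m)) ∧
      ∀ η, aeval η f = algebraMap (RatFunc F) (LevelField f) RatFunc.X ↔ ∃ m, η = ξ m := by
  classical
  have h1 := hk.one_lt.le
  have := Fact.mk hk
  have hsep := separable_levelPoly hf h1 hd
  have hG : IsGalois (RatFunc F) (LevelField f) := IsGalois.of_separable_splitting_field hsep
  have hdvd : f.natDegree ∣ Nat.card (LevelField f ≃ₐ[RatFunc F] LevelField f) := by
    rw [IsGalois.card_aut_eq_finrank]
    have := (irreducible_levelPoly hf h1).natDegree_dvd_finrank (SplittingField.splits _)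
    rwa [natDegree_levelPoly] at this
  obtain ⟨σ, hσ⟩ := exists_prime_orderOf_dvd_card' _ hdvd
  have hfix : ∃ x ∈ (levelPoly f).rootSet (LevelField f), σ x ≠ x := by
    by_contra! hall
    have : σ = 1 := Polynomial.Gal.ext (p := levelPoly f) hall
    rw [this, orderOf_one] at hσ
    exact hk.one_lt.ne hσ
  obtain ⟨x, hx, hσx⟩ := hfix
  rw [mem_rootSet_levelPoly hf h1] at hx
  have hpow : ∀ n : ℕ, σ^[n] x = (σ ^ n) x := fun n => by
    induction n with
    | zero => rfl
    | succ n ih => rw [Function.iterate_succ_apply', ih, pow_succ', AlgEquiv.mul_apply]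
  have hper : Function.minimalPeriod σ x = f.natDegree := by
    refine ((Nat.dvd_prime hk).1 ?_).resolve_left ?_
    · refine Function.IsPeriodicPt.minimalPeriod_dvd ?_
      rw [Function.IsPeriodicPt, Function.IsFixedPt, hpow, ← hσ, pow_orderOf_eq_one]
      rfl
    · rw [Function.minimalPeriod_eq_one_iff_isFixedPt]
      exact hσx
  let ξ : ZMod f.natDegree → LevelField f := fun m => σ^[m.val] x
  have hinj : Function.Injective ξ := fun m n h => by
    refine ZMod.val_injective _ (Function.iterate_injOn_Iio_minimalPeriod (f := σ) (x := x)
      ?_ ?_ h)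
    · rw [hper]; exact ZMod.val_lt m
    · rw [hper]; exact ZMod.val_lt n
  have hroot : ∀ m, aeval (ξ m) f = algebraMap (RatFunc F) (LevelField f) RatFunc.X := fun m => by
    simp only [ξ, hpow]
    have := congrArg (σ ^ m.val) hx
    rw [AlgEquiv.commutes] at this
    rw [← this]
    exact aeval_algHom_apply (((σ ^ m.val : LevelField f ≃ₐ[RatFunc F] LevelField f) :
      LevelField f →ₐ[RatFunc F] LevelField f).restrictScalars F) x f
  refine ⟨σ, ξ, hinj, fun m => ?_, fun η => ⟨fun hη => ?_, ?_⟩⟩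
  · simp only [ξ]
    have e := Function.iterate_mod_minimalPeriod_eq (f := σ) (x := x) (n := m.val + 1)
    rw [hper] at e
    rw [← Function.iterate_succ_apply' σ, ZMod.val_add, ZMod.val_one, e]
  · have hcard : Finset.univ.image ξ = ((levelPoly f).rootSet (LevelField f)).toFinset := by
      refine Finset.eq_of_subset_of_card_le (fun y hy => ?_) ?_
      · obtain ⟨m, _, rfl⟩ := Finset.mem_image.1 hy
        rw [Set.mem_toFinset, mem_rootSet_levelPoly hf h1]
        exact hroot m
      · rw [Finset.card_image_of_injective _ hinj, Finset.card_univ, ZMod.card, Set.toFinset_card,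
          card_rootSet_eq_natDegree hsep (SplittingField.splits _), natDegree_levelPoly]
    rw [← mem_rootSet_levelPoly hf h1, ← Set.mem_toFinset, ← hcard] at hη
    obtain ⟨m, _, e⟩ := Finset.mem_image.1 hη
    exact ⟨m, e.symm⟩
  · rintro ⟨m, rfl⟩
    exact hroot m

end Specialization

section ConjugateSums

open Polynomial

variable {F : Type*} [Field F]

theorem exists_aeval_eq_of_isIntegralElem {Ω : Type*} [Field Ω] [Algebra F Ω] {x : Ω}
    (φ : RatFunc F →ₐ[F] Ω) (hφ : φ RatFunc.X = x) {r : RatFunc F}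
    (h : ((aeval x : F[X] →ₐ[F] Ω) : F[X] →+* Ω).IsIntegralElem (φ r)) :
    ∃ P : F[X], φ r = aeval x P := by
  have hc : ((aeval x : F[X] →ₐ[F] Ω) : F[X] →+* Ω) =
      (φ : RatFunc F →+* Ω).comp (algebraMap F[X] (RatFunc F)) := by
    refine Polynomial.ringHom_ext (fun a => ?_) ?_
    · simp [RatFunc.algebraMap_C, ← RatFunc.algebraMap_eq_C]
    · simp [RatFunc.algebraMap_X, hφ]
  obtain ⟨Q, hQ, hQ0⟩ := h
  rw [hc] at hQ0
  have hi : IsIntegral F[X] r := by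
    refine ⟨Q, hQ, ?_⟩
    have := hom_eval₂ Q (algebraMap F[X] (RatFunc F)) (φ : RatFunc F →+* Ω) r
    exact (φ : RatFunc F →+* Ω).injective (by rw [this, map_zero]; exact hQ0)
  obtain ⟨P, hP⟩ := IsIntegrallyClosed.isIntegral_iff.1 hi
  refine ⟨P, ?_⟩
  have := RingHom.congr_fun hc P
  rw [RingHom.comp_apply, hP] at this
  exact this.symm

variable {f : Polynomial F}

theorem transcendental_of_mem_levelField {x : LevelField f}
    (hx : aeval x f = algebraMap (RatFunc F) (LevelField f) RatFunc.X) : Transcendental F x := by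
  intro h
  have : IsAlgebraic F (aeval x f) := by
    rw [isAlgebraic_iff_isIntegral] at h ⊢
    have := (aeval (⟨x, h⟩ : integralClosure F (LevelField f)) f).2
    rwa [aeval_subalgebra_coe] at this
  rw [hx] at this
  exact (transcendental_algebraMap_iff (algebraMap (RatFunc F) (LevelField f)).injective).2
    RatFunc.transcendental_X this

theorem exists_ratFunc_of_mem_adjoin {x : LevelField f}
    (hx : aeval x f = algebraMap (RatFunc F) (LevelField f) RatFunc.X) :
    ∃ φ : RatFunc F →ₐ[F] LevelField f, φ RatFunc.X = x ∧
      ∀ u ∈ IntermediateField.adjoin (RatFunc F) {x}, ∃ r, φ r = u := by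
  have hinj : Function.Injective (aeval x : F[X] →ₐ[F] LevelField f) :=
    transcendental_iff_injective.1 (transcendental_of_mem_levelField hx)
  have hφ' : nonZeroDivisors F[X] ≤
      Submonoid.comap (aeval x : F[X] →ₐ[F] LevelField f) (nonZeroDivisors (LevelField f)) :=
    nonZeroDivisors_le_comap_nonZeroDivisors_of_injective _ hinj
  let φ := RatFunc.liftAlgHom (aeval x : F[X] →ₐ[F] LevelField f) hφ'
  have hφp : ∀ P : F[X], φ (algebraMap _ _ P) = aeval x P := fun P => by
    have := RatFunc.liftAlgHom_apply_div (aeval x : F[X] →ₐ[F] LevelField f) hφ' P 1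
    simpa using this
  have hφx : φ RatFunc.X = x := by rw [← RatFunc.algebraMap_X, hφp, aeval_X]
  refine ⟨φ, hφx, fun u hu => ?_⟩
  induction hu using IntermediateField.adjoin_induction with
  | mem y hy => exact ⟨_, hφx.trans (Set.mem_singleton_iff.1 hy).symm⟩
  | algebraMap r =>
    have hp : ∀ P : F[X], algebraMap (RatFunc F) (LevelField f) (algebraMap _ _ P) =
        φ (algebraMap _ _ (P.comp f)) := fun P => by
      rw [hφp, aeval_comp, hx, ← RatFunc.aeval_X_left_eq_algebraMap, aeval_algebraMap_apply]
    refine ⟨algebraMap _ _ (r.num.comp f) / algebraMap _ _ (r.denom.comp f), ?_⟩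
    rw [map_div₀, ← hp, ← hp, ← map_div₀, RatFunc.num_div_denom]
  | add a b _ _ ha hb =>
    obtain ⟨r, rfl⟩ := ha
    obtain ⟨s, rfl⟩ := hb
    exact ⟨r + s, map_add _ _ _⟩
  | inv a _ ha =>
    obtain ⟨r, rfl⟩ := ha
    exact ⟨r⁻¹, map_inv₀ _ _⟩
  | mul a b _ _ ha hb =>
    obtain ⟨r, rfl⟩ := ha
    obtain ⟨s, rfl⟩ := hb
    exact ⟨r * s, map_mul _ _ _⟩

/-- A sum of roots that is invariant under the stabiliser of `x` is an affine function of `x`. -/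
theorem exists_affine_of_invariant (hf : f.Monic) (h1 : 1 ≤ f.natDegree) (hd : f.derivative ≠ 0)
    {x : LevelField f} (hx : aeval x f = algebraMap (RatFunc F) (LevelField f) RatFunc.X)
    {O : Finset (LevelField f)}
    (hO : ∀ y ∈ O, aeval y f = algebraMap (RatFunc F) (LevelField f) RatFunc.X)
    (hinv : ∀ τ : LevelField f ≃ₐ[RatFunc F] LevelField f, τ x = x → τ (∑ y ∈ O, y) = ∑ y ∈ O, y) :
    ∃ α β : F, ∑ y ∈ O, y = algebraMap F _ α * x + algebraMap F _ β := by
  have hsep := separable_levelPoly hf h1 hd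
  have hG : IsGalois (RatFunc F) (LevelField f) := IsGalois.of_separable_splitting_field hsep
  obtain ⟨φ, hφ, hmem⟩ := exists_ratFunc_of_mem_adjoin hx
  have hu : ∑ y ∈ O, y ∈ IntermediateField.adjoin (RatFunc F) {x} := by
    rw [← IsGalois.fixedField_fixingSubgroup (IntermediateField.adjoin (RatFunc F) {x}),
      IntermediateField.mem_fixedField_iff]
    intro τ hτ
    rw [IntermediateField.mem_fixingSubgroup_iff] at hτ
    exact hinv τ (hτ x (IntermediateField.mem_adjoin_simple_self _ x))
  obtain ⟨r, hr⟩ := hmem _ hu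
  have h_integral : ((aeval x : F[X] →ₐ[F] LevelField f) : F[X] →+* LevelField f).IsIntegralElem
      (∑ y ∈ O, y) := by
    have : ∀ y ∈ O, ((aeval x : F[X] →ₐ[F] LevelField f) : F[X] →+* LevelField f).IsIntegralElem
        y := by
      intro y hy
      refine ⟨f.map C - C f, ?_, ?_⟩
      · refine (hf.map _).sub_of_left (degree_C_le.trans_lt ?_)
        rw [degree_map_eq_of_injective C_injective, degree_eq_natDegree hf.ne_zero]
        exact_mod_cast h1
      · rw [eval₂_sub, eval₂_C, eval₂_map, sub_eq_zero]
        have e : ((aeval x : F[X] →ₐ[F] LevelField f) : F[X] →+* LevelField f).comp C =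
            algebraMap F _ := by
          ext a
          simp
        rw [e]
        exact (hO y hy).trans hx.symm
    clear hu hr hinv hO
    classical
    induction O using Finset.induction_on with
    | empty => exact RingHom.isIntegralElem_zero _
    | insert a s ha ih =>
      rw [Finset.sum_insert ha]
      exact (this a (Finset.mem_insert_self _ _)).add _
        (ih fun y hy => this y (Finset.mem_insert_of_mem hy))
  rw [← hr] at h_integral
  obtain ⟨P, hP⟩ := exists_aeval_eq_of_isIntegralElem φ hφ h_integral
  rw [hr] at hP
  obtain ⟨B, hB, hBF⟩ := exists_valuationSubring_one_lt (transcendental_of_mem_levelField hx)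
  have hdeg : P.natDegree ≤ 1 := by
    by_contra! hlt
    have hP0 : P ≠ 0 := by rintro rfl; simp at hlt
    have e1 := Polynomial.valuation_aeval_eq_valuation_X_pow_natDegree_of_one_lt_valuation_X
      (v := B.valuation) x hB hP0
    have e2 : B.valuation (∑ y ∈ O, y) ≤ B.valuation x := by
      refine B.valuation.map_sum_le fun y hy => ?_
      have e3 := (valuation_pow_eq_of_aeval_eq (v := B.valuation) h1 h1 hB
        ((hO y hy).trans hx.symm)).2
      exact ((pow_left_inj₀ zero_le zero_le (by omega)).1 e3).le
    rw [hP, e1] at e2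
    exact e2.not_gt (lt_self_pow₀ hB hlt)
  refine ⟨P.coeff 1, P.coeff 0, ?_⟩
  rw [hP]
  conv_lhs => rw [eq_X_add_C_of_natDegree_le_one hdeg]
  simp

end ConjugateSums

section Conjugacy

open Polynomial

variable {F : Type*} [Field F]

/-- The product `(X + 1)(X + 2)⋯(X + k)`. -/
noncomputable def risingPoly (R : Type*) [CommRing R] (k : ℕ) : Polynomial R :=
  ∏ i ∈ Finset.range k, (X + C ((i + 1 : ℕ) : R))

theorem risingPoly_monic (R : Type*) [CommRing R] (k : ℕ) : (risingPoly R k).Monic :=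
  monic_prod_of_monic _ _ fun _ _ => monic_X_add_C _

theorem natDegree_risingPoly (R : Type*) [CommRing R] [Nontrivial R] (k : ℕ) :
    (risingPoly R k).natDegree = k := by
  rw [risingPoly, natDegree_prod_of_monic _ _ fun _ _ => monic_X_add_C _]
  simp only [natDegree_X_add_C, Finset.sum_const, Finset.card_range, smul_eq_mul, mul_one]

theorem aeval_risingPoly {R A : Type*} [CommRing R] [CommRing A] [Algebra R A] (k : ℕ) (x : A) :
    aeval x (risingPoly R k) = ∏ i ∈ Finset.range k, (x + ((i + 1 : ℕ) : A)) := by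
  simp [risingPoly, map_prod]

theorem risingPoly_map {R S : Type*} [CommRing R] [CommRing S] (φ : R →+* S) (k : ℕ) :
    (risingPoly R k).map φ = risingPoly S k := by
  simp [risingPoly, Polynomial.map_prod]

theorem aeval_sub_eq_prod {f : Polynomial F} (hf : f.Monic) [NeZero f.natDegree]
    {L : Type*} [Field L] [Algebra F L]
    {t : L} {ξ : ZMod f.natDegree → L} (hξ : Function.Injective ξ) (hroot : ∀ m, aeval (ξ m) f = t)
    (y : L) : aeval y f - t = ∏ m, (y - ξ m) := by
  have h1 : (f.map (algebraMap F L) - C t).Monic := by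
    refine (hf.map _).sub_of_left (degree_C_le.trans_lt ?_)
    rw [degree_map, degree_eq_natDegree hf.ne_zero]
    exact_mod_cast Nat.pos_of_ne_zero (NeZero.ne f.natDegree)
  have h2 : f.map (algebraMap F L) - C t = ∏ m, (X - C (ξ m)) := by
    refine eq_of_monic_of_dvd_of_natDegree_le (monic_prod_of_monic _ _ fun _ _ => monic_X_sub_C _)
      h1 (Finset.prod_dvd_of_coprime (fun a _ b _ h => pairwise_coprime_X_sub_C hξ h)
        fun m _ => ?_) ?_
    · rw [dvd_iff_isRoot, IsRoot, eval_sub, eval_map_algebraMap, hroot, eval_C, sub_self]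
    · rw [natDegree_sub_C, natDegree_map, natDegree_prod_of_monic _ _ fun _ _ => monic_X_sub_C _]
      simp [ZMod.card]
  have := congrArg (eval y) h2
  simpa [eval_prod] using this

/-- Specialising `t` to `0` sends the roots of `(X + 1)⋯(X + k) = t` to `-1, …, -k`. -/
theorem exists_specialization.{u} {F : Type u} [Field F] {f : Polynomial F} {p k : ℕ} [CharP F p] [NeZero f.natDegree]
    (hkp : k < p) (hk : f.natDegree = k) (hf : f = risingPoly F k) {ξ : ZMod f.natDegree → LevelField f}
    (hξ : Function.Injective ξ)
    (hroot : ∀ m, aeval (ξ m) f = algebraMap (RatFunc F) (LevelField f) RatFunc.X) :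
    ∃ (κ : Type u) (_ : Field κ) (_ : CharP κ p) (v : ZMod f.natDegree → ℕ),
      Function.Injective v ∧ (∀ m, 1 ≤ v m ∧ v m ≤ f.natDegree) ∧
      ∀ (Z : Finset (ZMod f.natDegree)) (α β : F), (∀ m, ∑ n ∈ Z, ξ (m + n) =
        algebraMap F (LevelField f) α * ξ m + algebraMap F (LevelField f) β) →
        ∃ α' β' : κ, ∀ m, ∑ n ∈ Z, (v (m + n) : κ) = α' * v m + β' := by
  classical
  set t := algebraMap (RatFunc F) (LevelField f) RatFunc.X with ht
  have htr : Transcendental F t := (transcendental_algebraMap_iff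
    (algebraMap (RatFunc F) (LevelField f)).injective).2 RatFunc.transcendental_X
  have htr' : Transcendental F t⁻¹ := fun h => htr (IsAlgebraic.inv_iff.1 h)
  obtain ⟨B, hB, hBF⟩ := exists_valuationSubring_one_lt htr'
  have htB : B.valuation t < 1 := by
    rw [map_inv₀] at hB
    exact (one_lt_inv₀ (zero_lt_iff.2 (by
      rw [Valuation.ne_zero_iff]; rintro h; rw [h] at htr; exact htr isAlgebraic_zero))).1 hB
  have hfm : f.Monic := hf ▸ risingPoly_monic F k
  have h1 : 1 ≤ f.natDegree := Nat.pos_of_ne_zero (NeZero.ne _)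
  have hfe : ∀ y : LevelField f,
      aeval y f = ∏ i ∈ Finset.range k, (y + ((i + 1 : ℕ) : LevelField f)) :=
    fun y => (congrArg (aeval y) hf).trans (aeval_risingPoly k y)
  have hξB : ∀ m, ξ m ∈ B := fun m => by
    rw [← ValuationSubring.valuation_le_one_iff]
    by_contra! hlt
    have e1 := Polynomial.valuation_aeval_eq_valuation_X_pow_natDegree_of_one_lt_valuation_X
      (v := B.valuation) (ξ m) hlt hfm.ne_zero
    rw [hroot] at e1
    exact (htB.trans (e1 ▸ one_lt_pow₀ hlt (by omega))).ne rfl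
  have hFB : ∀ a : F, algebraMap F (LevelField f) a ∈ B := fun a => by
    rw [← ValuationSubring.valuation_le_one_iff]
    exact Valuation.IsTrivialOn.valuation_algebraMap_le_one B.valuation a
  let ι : F →+* B := (algebraMap F (LevelField f)).codRestrict B hFB
  let π := IsLocalRing.residue B
  have hchar : CharP (IsLocalRing.ResidueField B) p :=
    charP_of_injective_ringHom (f := π.comp ι) (π.comp ι).injective p
  let x : ZMod f.natDegree → B := fun m => ⟨ξ m, hξB m⟩
  have hπ : ∀ b : B, π b = 0 ↔ B.valuation b < 1 := fun b => by
    rw [IsLocalRing.residue_eq_zero_iff, ValuationSubring.valuation_lt_one_iff]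
  have hsurj : ∀ i, 1 ≤ i → i ≤ f.natDegree → ∃ m, π (x m) = -(i : IsLocalRing.ResidueField B) := by
    intro i hi hik
    have e1 := aeval_sub_eq_prod hfm hξ hroot (-(i : LevelField f))
    have e2 : aeval (-(i : LevelField f)) f = 0 := by
      rw [hfe]
      refine Finset.prod_eq_zero (i := i - 1) (Finset.mem_range.2 (by omega)) ?_
      rw [Nat.sub_add_cancel hi, neg_add_cancel]
    rw [e2, zero_sub] at e1
    have e3 : π (∏ m, (-(i : B) - x m)) = 0 := by
      rw [hπ]
      have : ((∏ m, (-(i : B) - x m) : B) : LevelField f) = -t := by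
        rw [e1]
        push_cast
        rfl
      rw [this, Valuation.map_neg]
      exact htB
    rw [map_prod, Finset.prod_eq_zero_iff] at e3
    obtain ⟨m, _, hm⟩ := e3
    refine ⟨m, ?_⟩
    rw [map_sub, map_neg, map_natCast, sub_eq_zero] at hm
    exact hm.symm
  have hv : ∀ m, ∃ i, (1 ≤ i ∧ i ≤ f.natDegree) ∧ π (x m) = -(i : IsLocalRing.ResidueField B) := by
    intro m
    have e3 : π (∏ i ∈ Finset.range k, (x m + ((i + 1 : ℕ) : B))) = 0 := by
      rw [hπ]
      have : ((∏ i ∈ Finset.range k, (x m + ((i + 1 : ℕ) : B)) : B) : LevelField f) = t := by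
        rw [← hroot m, hfe]
        push_cast
        rfl
      rw [this]
      exact htB
    rw [map_prod, Finset.prod_eq_zero_iff] at e3
    obtain ⟨i, hi, hm⟩ := e3
    rw [map_add, map_natCast] at hm
    exact ⟨i + 1, ⟨by omega, by have := Finset.mem_range.1 hi; omega⟩, eq_neg_of_add_eq_zero_left hm⟩
  choose v hv1 hv2 using hv
  refine ⟨IsLocalRing.ResidueField B, inferInstance, hchar, v, ?_, hv1, ?_⟩
  · have himage : Finset.univ.image v = Finset.Icc 1 f.natDegree := by
      ext i
      simp only [Finset.mem_image, Finset.mem_univ, true_and, Finset.mem_Icc]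
      refine ⟨fun ⟨m, hm⟩ => hm ▸ hv1 m, fun ⟨h, h'⟩ => ?_⟩
      obtain ⟨m, hm⟩ := hsurj i h h'
      rw [hv2, neg_inj] at hm
      have := (hv1 m).2
      exact ⟨m, CharP.natCast_injOn_Iio (IsLocalRing.ResidueField B) p
        (Set.mem_Iio.2 (by omega)) (Set.mem_Iio.2 (by omega)) hm⟩
    have hcard : (Finset.univ.image v).card = (Finset.univ : Finset (ZMod f.natDegree)).card := by
      rw [himage, Nat.card_Icc, Finset.card_univ, ZMod.card, Nat.add_sub_cancel]
    exact fun a b hab => Finset.card_image_iff.1 hcard (Finset.mem_coe.2 (Finset.mem_univ a))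
      (Finset.mem_coe.2 (Finset.mem_univ b)) hab
  · intro Z α β hrel
    refine ⟨π (ι α), -π (ι β), fun m => ?_⟩
    have e1 : ∑ n ∈ Z, x (m + n) = ι α * x m + ι β := by
      apply Subtype.ext
      push_cast
      exact hrel m
    have e2 := congrArg π e1
    rw [map_sum, map_add, map_mul, hv2] at e2
    simp only [hv2, Finset.sum_neg_distrib] at e2
    linear_combination -e2

end Conjugacy

section DiagonalPoint

open Polynomial

variable {F : Type*} [Field F]

theorem derivative_ne_zero_of_natDegree_lt {p : ℕ} [CharP F p] {f : Polynomial F} (hf : f.Monic)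
    (h1 : 1 ≤ f.natDegree) (hp : f.natDegree < p) : f.derivative ≠ 0 := by
  intro h
  have h2 : f.derivative.coeff (f.natDegree - 1) = 0 := by rw [h, coeff_zero]
  rw [coeff_derivative, Nat.sub_add_cancel h1, hf.coeff_natDegree, one_mul, ← Nat.cast_add_one,
    Nat.sub_add_cancel h1, CharP.cast_eq_zero_iff F p] at h2
  have := Nat.le_of_dvd h1 h2
  omega

/-- The stabiliser of a root of `(X + 1)⋯(X + k) = t` is transitive on the remaining roots. -/
theorem exists_conjugate_roots.{u} {F : Type u} [Field F] {f : Polynomial F} {p : ℕ} [CharP F p]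
    (hk : f.natDegree.Prime) (hp : 2 * f.natDegree ^ 2 < p)
    (hf : f = risingPoly F f.natDegree) :
    ∃ ξ : ZMod f.natDegree → LevelField f, Function.Injective ξ ∧
      (∀ m, aeval (ξ m) f = algebraMap (RatFunc F) (LevelField f) RatFunc.X) ∧
      ∀ m ≠ 0, ∃ τ : LevelField f ≃ₐ[RatFunc F] LevelField f, τ (ξ 0) = ξ 0 ∧ τ (ξ 1) = ξ m := by
  classical
  have hfm : f.Monic := hf ▸ risingPoly_monic F _
  have h1 := hk.one_lt.le
  have hlt : f.natDegree < p := by nlinarith only [hp, h1]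
  have hd := derivative_ne_zero_of_natDegree_lt hfm h1 hlt
  have := Fact.mk hk
  obtain ⟨σ, ξ, hinj, hσ, hroot⟩ := exists_cyclic_roots hfm hk hd
  have hroot' : ∀ m, aeval (ξ m) f = algebraMap (RatFunc F) (LevelField f) RatFunc.X :=
    fun m => (hroot _).2 ⟨m, rfl⟩
  refine ⟨ξ, hinj, hroot', ?_⟩
  let Z : Finset (ZMod f.natDegree) := Finset.univ.filter fun n =>
    ∃ τ : LevelField f ≃ₐ[RatFunc F] LevelField f, τ (ξ 0) = ξ 0 ∧ τ (ξ 1) = ξ n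
  have hZ : ∀ {n}, n ∈ Z ↔ ∃ τ : LevelField f ≃ₐ[RatFunc F] LevelField f,
      τ (ξ 0) = ξ 0 ∧ τ (ξ 1) = ξ n := by simp [Z]
  have hperm : ∀ (τ : LevelField f ≃ₐ[RatFunc F] LevelField f) y,
      aeval y f = algebraMap (RatFunc F) (LevelField f) RatFunc.X →
      aeval (τ y) f = algebraMap (RatFunc F) (LevelField f) RatFunc.X := by
    intro τ y hy
    have := Polynomial.aeval_algHom_apply (τ.toAlgHom.restrictScalars F) y f
    rw [hy] at this
    exact this.trans (τ.commutes _)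
  have hinv : ∀ τ : LevelField f ≃ₐ[RatFunc F] LevelField f, τ (ξ 0) = ξ 0 →
      τ (∑ y ∈ Z.image ξ, y) = ∑ y ∈ Z.image ξ, y := by
    intro τ hτ
    have himage : (Z.image ξ).image τ = Z.image ξ := by
      refine Finset.eq_of_subset_of_card_le (fun y hy => ?_)
        (Finset.card_image_of_injective _ τ.injective).ge
      simp only [Finset.mem_image, exists_exists_and_eq_and] at hy
      obtain ⟨n, hn, rfl⟩ := hy
      obtain ⟨τ', h0, h1'⟩ := hZ.1 hn
      obtain ⟨m, hm⟩ := (hroot _).1 (hperm τ _ (hroot' n))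
      refine Finset.mem_image.2 ⟨m, hZ.2 ⟨τ * τ', ?_, ?_⟩, hm.symm⟩
      · rw [AlgEquiv.mul_apply, h0, hτ]
      · rw [AlgEquiv.mul_apply, h1', hm]
    conv_rhs => rw [← himage]
    rw [map_sum, Finset.sum_image fun a _ b _ h => τ.injective h]
  obtain ⟨α, β, hαβ⟩ := exists_affine_of_invariant hfm h1 hd (hroot' 0) (O := Z.image ξ)
    (fun y hy => by
      obtain ⟨n, _, rfl⟩ := Finset.mem_image.1 hy
      exact hroot' n) hinv
  rw [Finset.sum_image fun a _ b _ h => hinj h] at hαβ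
  have hrel : ∀ j : ℕ, ∑ n ∈ Z, ξ ((j : ZMod f.natDegree) + n) =
      algebraMap F (LevelField f) α * ξ j + algebraMap F (LevelField f) β := by
    intro j
    induction j with
    | zero => simpa using hαβ
    | succ j ih =>
      have hc : ∀ a : F, σ (algebraMap F (LevelField f) a) = algebraMap F (LevelField f) a :=
        (σ.toAlgHom.restrictScalars F).commutes
      have := congrArg σ ih
      rw [map_sum, map_add, map_mul, ← hσ, hc, hc] at this
      simp only [← hσ] at this
      rw [Nat.cast_succ, ← this]
      exact Finset.sum_congr rfl fun n _ => by rw [add_right_comm]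
  obtain ⟨κ, _, _, v, hv, hv1, hv2⟩ :=
    exists_specialization (p := p) hlt rfl hf hinj hroot'
  obtain ⟨α', β', hκ⟩ := hv2 Z α β fun m => by
    have := hrel m.val
    rwa [ZMod.natCast_zmod_val] at this
  intro m hm
  refine hZ.1 (eq_compl_zero_of_affine hp hv hv1 ⟨1, hZ.2 ⟨1, rfl, rfl⟩⟩ ?_ hκ hm)
  intro h0
  obtain ⟨τ, h, h'⟩ := hZ.1 h0
  exact one_ne_zero (hinj (τ.injective (h'.trans h.symm)))

open MvPolynomial in
theorem linearIndepOn_tripleMonomial_of_conjugates {L ι : Type*} [Field L] [Algebra F L] {x y : L}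
    (hx : Transcendental F x) {S : Finset ι} {ξ : ι → L} (hξ : Set.InjOn ξ S)
    (hτ : ∀ m ∈ S, ∃ τ : L ≃ₐ[F] L, τ x = x ∧ τ y = ξ m) {d : ℕ} (hd : d ≤ #S) :
    LinearIndepOn F (tripleMonomial ![x, y, 1]) {k | k.2.1 < d ∧ k.2.2 < 1} := by
  classical
  rw [linearIndepOn_iff]
  intro l hl h0
  rw [Finsupp.mem_supported] at hl
  have h0' : ∑ k ∈ l.support, algebraMap F L (l k) * (x ^ k.1 * y ^ k.2.1) = 0 := by
    rw [← h0, Finsupp.linearCombination_apply, Finsupp.sum]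
    refine Finset.sum_congr rfl fun k _ => ?_
    simp [tripleMonomial, Algebra.smul_def]
  let Q : Polynomial L := ∑ k ∈ l.support, Polynomial.monomial k.2.1 (algebraMap F L (l k) * x ^ k.1)
  have hQ : Q = 0 := by
    have hdeg : Q.degree < #S := by
      rw [degree_lt_iff_coeff_zero]
      intro n hn
      simp only [Q, Polynomial.finsetSum_coeff]
      refine Finset.sum_eq_zero fun k hk => Polynomial.coeff_monomial_of_ne _ ?_
      have := (hl hk).1
      omega
    by_contra hQ0
    have hroots : (S.image ξ).val ⊆ Q.roots := by
      intro z hz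
      obtain ⟨m, hm, rfl⟩ := Finset.mem_image.1 hz
      obtain ⟨τ, h1, h2⟩ := hτ m hm
      rw [Polynomial.mem_roots hQ0, IsRoot]
      simp only [Q, Polynomial.eval_finsetSum, Polynomial.eval_monomial]
      have := congrArg τ h0'
      rw [map_sum, map_zero] at this
      rw [← this]
      refine Finset.sum_congr rfl fun k _ => ?_
      rw [map_mul, map_mul, map_pow, map_pow, τ.commutes, h1, h2, mul_assoc]
    have h1 := card_le_degree_of_subset_roots hroots
    rw [Finset.card_image_of_injOn hξ] at h1
    rw [degree_eq_natDegree hQ0] at hdeg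
    have : Q.natDegree < #S := by exact_mod_cast hdeg
    omega
  ext ⟨i, j, n⟩
  rw [Finsupp.zero_apply]
  by_contra hne
  have hn : n = 0 := by
    have := (hl (Finset.mem_coe.2 (Finsupp.mem_support_iff.2 hne))).2
    simpa using this
  subst hn
  let R : Polynomial F := ∑ k ∈ l.support with k.2.1 = j, Polynomial.monomial k.1 (l k)
  have hR : Polynomial.aeval x R = 0 := by
    have h1 : Q.coeff j = 0 := by rw [hQ, Polynomial.coeff_zero]
    simp only [Q, Polynomial.finsetSum_coeff, Polynomial.coeff_monomial, ← Finset.sum_filter] at h1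
    rw [← h1]
    simp only [R, map_sum, Polynomial.aeval_monomial]
  have hR0 : R = 0 := (injective_iff_map_eq_zero _).1 (transcendental_iff_injective.1 hx) R hR
  have h2 : R.coeff i = 0 := by rw [hR0, Polynomial.coeff_zero]
  simp only [R, Polynomial.finsetSum_coeff, Polynomial.coeff_monomial] at h2
  rw [Finset.sum_eq_single (i, j, 0)] at h2
  · simp at h2
    exact hne h2
  · rintro ⟨i', j', n'⟩ hk hk'
    rw [Finset.mem_filter] at hk
    have h3 := (hl hk.1).2
    have h4 : j' = j := hk.2
    have h5 : n' = 0 := by simpa using h3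
    refine if_neg fun h => hk' ?_
    have h6 : i' = i := h
    rw [h4, h5, h6]
  · intro h
    rw [if_pos rfl]
    by_contra h'
    exact h (Finset.mem_filter.2 ⟨Finsupp.mem_support_iff.2 h', rfl⟩)

open MvPolynomial in
theorem aeval_pderiv_dividedDifference {L : Type*} [Field L] [Algebra F L] {x y : L}
    (f : Polynomial F) (h : Polynomial.aeval x f = Polynomial.aeval y f) (hxy : x ≠ y) :
    MvPolynomial.aeval ![x, y, 1] (pderiv 1 (dividedDifference f (X 0) (X 1) :
      MvPolynomial (Fin 3) F)) * (x - y) = -Polynomial.aeval y f.derivative := by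
  have h1 := congrArg (pderiv 1) (dividedDifference_mul (R := MvPolynomial (Fin 3) F) f (X 0) (X 1))
  rw [Derivation.leibniz, map_sub, map_sub, pderiv_polynomial_aeval, pderiv_polynomial_aeval,
    pderiv_X_self, pderiv_X_of_ne (by decide), smul_eq_mul, smul_eq_mul] at h1
  have h2 := congrArg (MvPolynomial.aeval ![x, y, 1]) h1
  have h3 : MvPolynomial.aeval ![x, y, 1] (dividedDifference f (X 0) (X 1) :
      MvPolynomial (Fin 3) F) = 0 := by
    rw [map_dividedDifference, MvPolynomial.aeval_X, MvPolynomial.aeval_X]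
    have := dividedDifference_mul f x y
    rw [h, sub_self] at this
    exact (mul_eq_zero.1 this).resolve_right (sub_ne_zero.2 hxy)
  simp only [map_add, map_mul, map_sub, h3, zero_mul, mul_zero, zero_sub, mul_one, map_neg,
    aeval_polynomial_aeval, MvPolynomial.aeval_X, map_one] at h2
  simpa [mul_comm] using h2

open MvPolynomial in
theorem exists_genericPoint_diagonal.{u} {F : Type u} [Field F] {p k : ℕ} [CharP F p]
    (hk : k.Prime) (hp : 2 * k ^ 2 < p) :
    ∃ v : Fin 3 → LevelField (risingPoly F k),
      IsGenericCurvePoint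
        (dividedDifference (risingPoly F k) (X 0) (X 1) : MvPolynomial (Fin 3) F) (X 2 - 1) (k - 1) 1 v := by
  classical
  have hdeg := natDegree_risingPoly F k
  set f := risingPoly F k with hf
  have hfm : f.Monic := risingPoly_monic F k
  have hk1 := hk.one_lt
  have := Fact.mk hk
  obtain ⟨ξ, hinj, hroot, hconj⟩ := exists_conjugate_roots (f := f) (p := p) (by rwa [hdeg])
    (by rwa [hdeg]) (by rw [hdeg])
  have : Fact (f.natDegree.Prime) := ⟨by rwa [hdeg]⟩
  have hne : ξ 0 ≠ ξ 1 := fun h => zero_ne_one (hinj h)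
  have he := (hroot 0).trans (hroot 1).symm
  refine ⟨![ξ 0, ξ 1, 1], ?_, by simp, ?_, ?_⟩
  · rw [map_dividedDifference, MvPolynomial.aeval_X, MvPolynomial.aeval_X]
    have := dividedDifference_mul f (ξ 0) (ξ 1)
    rw [he, sub_self] at this
    exact (mul_eq_zero.1 this).resolve_right (sub_ne_zero.2 hne)
  · refine linearIndepOn_tripleMonomial_of_conjugates (S := Finset.univ.erase 0) (ξ := ξ)
      (transcendental_of_mem_levelField (hroot 0)) (hinj.injOn) (fun m hm => ?_) ?_
    · obtain ⟨τ, h1, h2⟩ := hconj m (Finset.ne_of_mem_erase hm)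
      exact ⟨τ.restrictScalars F, h1, h2⟩
    · rw [Finset.card_erase_of_mem (Finset.mem_univ _), Finset.card_univ, ZMod.card, hdeg]
  · have e2 : pderiv 2 (X 2 - 1 : MvPolynomial (Fin 3) F) = 1 := by
      rw [map_sub, pderiv_X_self, pderiv_one, sub_zero]
    have e3 : pderiv 1 (X 2 - 1 : MvPolynomial (Fin 3) F) = 0 := by
      rw [map_sub, pderiv_X_of_ne (by decide), pderiv_one, sub_zero]
    rw [e2, e3, mul_one, mul_zero, sub_zero]
    intro h0
    have h1 := aeval_pderiv_dividedDifference f he hne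
    rw [h0, zero_mul, eq_comm, neg_eq_zero] at h1
    have h2 := (injective_iff_map_eq_zero _).1
      (transcendental_iff_injective.1 (transcendental_of_mem_levelField (hroot 1))) _ h1
    exact derivative_ne_zero_of_natDegree_lt (p := p) hfm (by omega) (by nlinarith only [hp, hk1, hdeg]) h2

end DiagonalPoint

section FactorialCurves

variable {p : ℕ} [hpF : Fact p.Prime]

theorem card_diagonal_le {k : ℕ} (hk : k.Prime) {G : ℕ}
    (hG : 2 * ((k - 1) * k) + (k - 1) + 2 ≤ G) (hp : (6 * G) ^ 2 ≤ p) :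
    #{P : ZMod p × ZMod p | (risingPoly (ZMod p) k).eval P.2 = (risingPoly (ZMod p) k).eval P.1} ≤
      2 * p + 4 * G * Nat.sqrt p := by
  classical
  let F := AlgebraicClosure (ZMod p)
  let ι := algebraMap (ZMod p) F
  have hι : Function.Injective ι := ι.injective
  have hk1 := hk.two_le
  have hk2 : 2 * k ^ 2 < p := by
    obtain ⟨d, rfl⟩ := Nat.exists_eq_add_of_le' hk1
    have h1 : 2 * ((d + 1) * (d + 2)) + (d + 1) + 2 ≤ G := hG
    have h2 : (d + 2) ^ 2 ≤ G := by nlinarith only [h1]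
    have h3 : G ≤ G * G := Nat.le_mul_of_pos_left _ (by omega)
    have h4 : (6 * G) ^ 2 = 36 * (G * G) := by ring
    omega
  obtain ⟨v, hv⟩ := exists_genericPoint_diagonal (F := F) (p := p) hk hk2
  have hlift : liftPoly (risingPoly (ZMod p) k) = risingPoly F k := risingPoly_map _ _
  let E : ZMod p × ZMod p → (Fin 3 → F) := fun P => ![ι P.1, ι P.2, 1]
  have hE : Function.Injective E := fun P Q hPQ => Prod.ext
    (hι (congrFun hPQ 0)) (hι (congrFun hPQ 1))
  let S : Finset (ZMod p × ZMod p) := {P | (risingPoly (ZMod p) k).eval P.2 =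
    (risingPoly (ZMod p) k).eval P.1}
  have hdeg := natDegree_risingPoly F k
  have ht := isTriangular_diagonal (risingPoly_monic F k) (by rw [hdeg]; omega)
  rw [hdeg] at ht
  have hmap : MvPolynomial.map (frobenius F p)
      (dividedDifference (risingPoly F k) (MvPolynomial.X 0) (MvPolynomial.X 1)) =
      (dividedDifference (risingPoly F k) (MvPolynomial.X 0) (MvPolynomial.X 1) :
        MvPolynomial (Fin 3) F) := by
    refine map_dividedDifference_X ?_ 0 1
    exact risingPoly_map _ _
  have hoff : #{P ∈ S | P.1 ≠ P.2} ≤ p + 4 * G * Nat.sqrt p := by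
    rw [← Finset.card_image_of_injective _ hE]
    refine card_rational_points_le (by omega) le_rfl ht hv hmap (by simp) ?_
      (by rw [mul_one, Nat.sub_add_cancel (by omega)]; exact hG) hp
    intro P hP
    obtain ⟨⟨x, y⟩, hxy, rfl⟩ := Finset.mem_image.1 hP
    simp only [S, Finset.mem_filter, Finset.mem_univ, true_and] at hxy
    refine ⟨?_, by simp [E], fun i => ?_⟩
    · rw [map_dividedDifference, MvPolynomial.aeval_X, MvPolynomial.aeval_X]
      have h1 := dividedDifference_mul (risingPoly F k) (ι x) (ι y)
      rw [← hlift, aeval_liftPoly_algebraMap, aeval_liftPoly_algebraMap, hxy.1, sub_self,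
        hlift] at h1
      exact (mul_eq_zero.1 h1).resolve_right (sub_ne_zero.2 fun h => hxy.2 (hι h))
    · fin_cases i
      exacts [algebraMap_pow_char x, algebraMap_pow_char y, one_pow p]
  have hdiag : #{P ∈ S | ¬P.1 ≠ P.2} ≤ p := by
    calc #{P ∈ S | ¬P.1 ≠ P.2} ≤ #(Finset.univ.image fun x : ZMod p => (x, x)) := by
          refine Finset.card_le_card fun P hP => ?_
          have := not_not.1 (Finset.mem_filter.1 hP).2
          exact Finset.mem_image.2 ⟨P.1, Finset.mem_univ _, Prod.ext rfl this⟩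
      _ ≤ #(Finset.univ : Finset (ZMod p)) := Finset.card_image_le
      _ = p := by rw [Finset.card_univ, ZMod.card]
  have := Finset.card_filter_add_card_filter_not (s := S) (fun P => P.1 ≠ P.2)
  change #S ≤ _
  omega

/-- The points of `P_l(y) = P_k(x)`, where `P_k = (X + 1)⋯(X + k)`. -/
noncomputable def risingCurve (p k l : ℕ) [Fact p.Prime] : Finset (ZMod p × ZMod p) :=
  {P | (risingPoly (ZMod p) l).eval P.2 = (risingPoly (ZMod p) k).eval P.1}

theorem mem_risingCurve {k l : ℕ} {P : ZMod p × ZMod p} : P ∈ risingCurve p k l ↔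
    (risingPoly (ZMod p) l).eval P.2 = (risingPoly (ZMod p) k).eval P.1 := by
  rw [risingCurve, Finset.mem_filter_univ]

omit hpF in
theorem six_mul_sq_le {D : ℕ} (hD : 1764 * D ^ 8 ≤ p) : (6 * (7 * D ^ 3)) ^ 2 ≤ p := by
  rcases Nat.eq_zero_or_pos D with rfl | h
  · simp
  · have : D ^ 6 ≤ D ^ 8 := Nat.pow_le_pow_right h (by norm_num)
    have e : (6 * (7 * D ^ 3)) ^ 2 = 1764 * D ^ 6 := by ring
    omega

variable {D : ℕ} (hD : 1764 * D ^ 8 ≤ p)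
include hD

theorem card_risingCurve_self_le {k : ℕ} (hk : k.Prime) (hkD : k ≤ D) :
    #(risingCurve p k k) ≤ 2 * p + 28 * D ^ 3 * Nat.sqrt p := by
  have := card_diagonal_le (p := p) hk (G := 7 * D ^ 3) ?_ (six_mul_sq_le hD)
  · calc _ ≤ _ := this
      _ = _ := by ring
  · have h2 := hk.two_le
    calc 2 * ((k - 1) * k) + (k - 1) + 2 ≤ 2 * (D * D) + D + 2 := by gcongr <;> omega
      _ ≤ 7 * D ^ 3 := by
        have h3 : 1 ≤ D := by omega
        have h4 : D ≤ D ^ 3 := Nat.le_self_pow (by norm_num) D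
        have h5 : D * D ≤ D ^ 3 := by rw [← sq]; exact Nat.pow_le_pow_right h3 (by norm_num)
        omega

variable {k l : ℕ} (hk : k.Prime) (hl : l.Prime) (hkl : k < l) (hlD : l ≤ D)
include hk hl hkl hlD

theorem card_risingCurve_le : #(risingCurve p k l) ≤ p + 28 * D ^ 3 * Nat.sqrt p := by
  have h2 := hk.two_le
  have dk := natDegree_risingPoly (ZMod p) k
  have dl := natDegree_risingPoly (ZMod p) l
  have := card_curve_le (p := p) (f := risingPoly _ k) (g := risingPoly _ l) (by omega)
    (risingPoly_monic _ _) (by omega)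
    (by rw [dk, dl]; exact (Nat.coprime_primes hl hk).2 hkl.ne') (G := 7 * D ^ 3) ?_
    (six_mul_sq_le hD)
  · calc _ ≤ _ := this
      _ = _ := by ring
  · rw [dl]
    calc 2 * (l * (l + 1)) + l + 2 ≤ 2 * (D * (D + 1)) + D + 2 := by gcongr
      _ ≤ 7 * D ^ 3 := by
        have h3 : 1 ≤ D := by omega
        have h4 : D ≤ D ^ 3 := Nat.le_self_pow (by norm_num) D
        have h5 : D * D ≤ D ^ 3 := by rw [← sq]; exact Nat.pow_le_pow_right h3 (by norm_num)
        have h6 : D * (D + 1) = D * D + D := by ring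
        omega

theorem le_card_risingCurve_add :
    p ≤ #(risingCurve p k l) + D ^ 3 + 28 * D ^ 3 * Nat.sqrt p := by
  have h2 := hk.two_le
  have dk := natDegree_risingPoly (ZMod p) k
  have dl := natDegree_risingPoly (ZMod p) l
  have h3 : 1 ≤ D := by omega
  have := le_card_curve_add (p := p) (f := risingPoly _ k) (g := risingPoly _ l) (by omega)
    (risingPoly_monic _ _) (by omega) (by omega)
    (by rw [dk, dl]; exact (Nat.coprime_primes hl hk).2 hkl.ne') (G := 7 * D ^ 3) ?_ ?_
  · rw [dk, dl] at this
    have h4 : l * ((l - 1) * k) ≤ D * (D * D) := by gcongr <;> omega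
    calc p ≤ _ := this
      _ ≤ #(risingCurve p k l) + D * (D * D) + 4 * (7 * D ^ 3) * Nat.sqrt p := by
        gcongr
        rfl
      _ = _ := by ring
  · rw [dl]
    have h4 : l * (l + 1) ≤ D * (D + 1) := by gcongr
    have h5 : (l - 1) ^ 2 ≤ D ^ 2 := by gcongr; omega
    have h6 : (l - 1) * (l * (l + 1)) ≤ D * (D * (D + 1)) := by gcongr; omega
    calc l * (l + 1) + (l - 1) ^ 2 + (l - 1) * (l * (l + 1)) + l + 1
        ≤ D * (D + 1) + D ^ 2 + D * (D * (D + 1)) + D + 1 := by omega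
      _ ≤ 7 * D ^ 3 := by
        have h4 : D ≤ D ^ 3 := Nat.le_self_pow (by norm_num) D
        have h5 : D ^ 2 ≤ D ^ 3 := Nat.pow_le_pow_right h3 (by norm_num)
        have h6 : D * (D + 1) = D ^ 2 + D := by ring
        have h7 : D * (D * (D + 1)) = D ^ 3 + D ^ 2 := by ring
        omega
  · rw [dl]
    calc (6 * (7 * D ^ 3) * (l - 1)) ^ 2 ≤ (6 * (7 * D ^ 3) * D) ^ 2 := by gcongr; omega
      _ = 1764 * D ^ 8 := by ring
      _ ≤ p := hD

theorem card_risingCurve_shift_le {k' l' : ℕ} (hk' : k'.Prime) (hl' : l'.Prime) (hkl' : k' < l')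
    (hlD' : l' ≤ D) (hne : l ≠ l') (τ : ZMod p) :
    #{P ∈ risingCurve p k l ×ˢ risingCurve p k' l' | (P.1.1 - P.1.2) - (P.2.1 - P.2.2) = τ} ≤
      p + 28 * D ^ 3 * Nat.sqrt p := by
  have h2 := hk.two_le
  have h2' := hk'.two_le
  have dk := natDegree_risingPoly (ZMod p) k
  have dl := natDegree_risingPoly (ZMod p) l
  have dk' := natDegree_risingPoly (ZMod p) k'
  have dl' := natDegree_risingPoly (ZMod p) l'
  have h3 : 1 ≤ D := by omega
  have cop : ∀ {a b : ℕ}, a.Prime → b.Prime → a ≠ b → Nat.Coprime a b :=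
    fun ha hb h => (Nat.coprime_primes ha hb).2 h
  have := card_shift_le (p := p) (f := risingPoly _ k) (g := risingPoly _ l)
    (f' := risingPoly _ k') (g' := risingPoly _ l') (by omega)
    (risingPoly_monic _ _) (by omega) (by omega) (risingPoly_monic _ _) (by omega)
    (by rw [dk, dl, dl']; exact (cop hl hk hkl.ne').mul_right (cop hl hl' hne))
    (by rw [dl', dk', dl]; exact (cop hl' hk' hkl'.ne').mul_right (cop hl' hl hne.symm))
    (G := 7 * D ^ 3) ?_ (six_mul_sq_le hD) τ
  · calc _ ≤ _ := Finset.card_le_card fun P hP => ?_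
      _ ≤ _ := this
      _ = _ := by ring
    rw [Finset.mem_filter, Finset.mem_product, mem_risingCurve, mem_risingCurve] at hP
    exact Finset.mem_filter.2 ⟨Finset.mem_univ _, hP.1.1, hP.1.2, hP.2⟩
  · rw [dl, dl']
    calc 2 * (l * l' * (l + l')) + l * l' + 2 ≤ 2 * (D * D * (D + D)) + D * D + 2 := by gcongr
      _ ≤ 7 * D ^ 3 := by
        have h5 : D * D ≤ D ^ 3 := by rw [← sq]; exact Nat.pow_le_pow_right h3 (by norm_num)
        have h6 : D * D * (D + D) = 2 * D ^ 3 := by ring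
        have h7 : 1 ≤ D ^ 3 := Nat.one_le_pow _ _ h3
        omega

end FactorialCurves

section CharacterSums

variable {p : ℕ} [hpF : Fact p.Prime]

theorem sum_stdAddChar_mul (b : ZMod p) :
    ∑ h : ZMod p, ZMod.stdAddChar (h * b) = if b = 0 then (p : ℂ) else 0 := by
  rw [AddChar.sum_mulShift b (ZMod.isPrimitive_stdAddChar p), ZMod.card]
  split_ifs <;> simp

theorem conj_stdAddChar (x : ZMod p) :
    (starRingEnd ℂ) (ZMod.stdAddChar x) = ZMod.stdAddChar (-x) :=
  (AddChar.map_neg_eq_conj _ _).symm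

/-- The twisted number of preimages of `a` under the functions `φ k`, `k ∈ K`. -/
noncomputable def fiberSum {ι : Type*} (K : Finset ι) (φ : ι → ZMod p → ZMod p) (h a : ZMod p) : ℂ :=
  ∑ k ∈ K, ∑ x, if φ k x = a then ZMod.stdAddChar (h * x) else 0

/-- The character sum of `h (x - y)` over a set of pairs. -/
noncomputable def differenceSum (S : Finset (ZMod p × ZMod p)) (h : ZMod p) : ℂ :=
  ∑ P ∈ S, ZMod.stdAddChar (h * (P.1 - P.2))

theorem norm_differenceSum_le (S : Finset (ZMod p × ZMod p)) (h : ZMod p) :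
    ‖differenceSum S h‖ ≤ #S := by
  refine (norm_sum_le _ _).trans_eq ?_
  simp

theorem differenceSum_zero (S : Finset (ZMod p × ZMod p)) : differenceSum S 0 = #S := by
  simp [differenceSum]

variable {ι : Type*} {K : Finset ι} {φ : ι → ZMod p → ZMod p}

theorem sum_norm_sq_fiberSum (h : ZMod p) :
    ((∑ a, ‖fiberSum K φ h a‖ ^ 2 : ℝ) : ℂ) =
      ∑ k ∈ K, ∑ l ∈ K, differenceSum {P : ZMod p × ZMod p | φ l P.2 = φ k P.1} h := by
  push_cast
  have e1 : ∀ a, ((‖fiberSum K φ h a‖ : ℂ)) ^ 2 = ∑ k ∈ K, ∑ l ∈ K, ∑ x, ∑ y,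
      if φ k x = a ∧ φ l y = a then ZMod.stdAddChar (h * (x - y)) else 0 := by
    intro a
    rw [← Complex.mul_conj', fiberSum, map_sum, Finset.sum_mul_sum]
    refine Finset.sum_congr rfl fun k _ => Finset.sum_congr rfl fun l _ => ?_
    rw [map_sum, Finset.sum_mul_sum]
    refine Finset.sum_congr rfl fun x _ => Finset.sum_congr rfl fun y _ => ?_
    by_cases h1 : φ k x = a <;> by_cases h2 : φ l y = a <;> simp only [h1, h2, if_true, if_false,
      and_true, and_false, zero_mul, mul_zero, map_zero]
    rw [conj_stdAddChar, ← AddChar.map_add_eq_mul]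
    congr 1
    ring
  simp only [e1]
  rw [Finset.sum_comm]
  refine Finset.sum_congr rfl fun k _ => ?_
  rw [Finset.sum_comm]
  refine Finset.sum_congr rfl fun l _ => ?_
  rw [Finset.sum_comm, differenceSum, Finset.sum_filter, ← Finset.univ_product_univ,
    Finset.sum_product]
  refine Finset.sum_congr rfl fun x _ => ?_
  rw [Finset.sum_comm]
  refine Finset.sum_congr rfl fun y _ => ?_
  rw [Finset.sum_eq_single (φ k x)]
  · simp
  · intro b _ hb
    exact if_neg fun h => hb h.1.symm
  · simp

/-- The Fourier transform of the indicator function of `J`. -/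
noncomputable def indicatorTransform (J : Finset (ZMod p)) (h : ZMod p) : ℂ :=
  ∑ j ∈ J, ZMod.stdAddChar (-(h * j))

theorem sum_norm_sq_indicatorTransform (J : Finset (ZMod p)) :
    ∑ h, ‖indicatorTransform J h‖ ^ 2 = p * #J := by
  have : ((∑ h, ‖indicatorTransform J h‖ ^ 2 : ℝ) : ℂ) = ((p * #J : ℝ) : ℂ) := by
    push_cast
    have e1 : ∀ h, ((‖indicatorTransform J h‖ : ℂ)) ^ 2 =
        ∑ i ∈ J, ∑ j ∈ J, ZMod.stdAddChar (h * (j - i)) := by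
      intro h
      rw [← Complex.mul_conj', indicatorTransform, map_sum, Finset.sum_mul_sum]
      refine Finset.sum_congr rfl fun i _ => Finset.sum_congr rfl fun j _ => ?_
      rw [conj_stdAddChar, ← AddChar.map_add_eq_mul]
      congr 1
      ring
    simp only [e1]
    rw [Finset.sum_comm]
    have e2 : ∀ i ∈ J, ∑ h : ZMod p, ∑ j ∈ J, ZMod.stdAddChar (h * (j - i)) = (p : ℂ) := by
      intro i hi
      rw [Finset.sum_comm]
      simp only [sum_stdAddChar_mul, sub_eq_zero]
      rw [Finset.sum_ite_eq' J i, if_pos hi]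
    rw [Finset.sum_congr rfl e2, Finset.sum_const, nsmul_eq_mul, mul_comm]
  exact_mod_cast this

theorem sum_indicatorTransform_mul_fiberSum {J : Finset (ZMod p)} {a : ZMod p}
    (ha : ∀ k ∈ K, ∀ i ∈ J, ∀ j ∈ J, φ k (i + j) ≠ a) :
    ∑ h, indicatorTransform J h ^ 2 * fiberSum K φ h a = 0 := by
  have e1 : ∀ h, indicatorTransform J h ^ 2 * fiberSum K φ h a =
      ∑ i ∈ J, ∑ j ∈ J, ∑ k ∈ K, ∑ x,
        if φ k x = a then ZMod.stdAddChar (h * (x - (i + j))) else 0 := by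
    intro h
    rw [sq, indicatorTransform, fiberSum, Finset.sum_mul_sum, Finset.sum_mul]
    refine Finset.sum_congr rfl fun i _ => ?_
    rw [Finset.sum_mul]
    refine Finset.sum_congr rfl fun j _ => ?_
    rw [Finset.mul_sum]
    refine Finset.sum_congr rfl fun k _ => ?_
    rw [Finset.mul_sum]
    refine Finset.sum_congr rfl fun x _ => ?_
    rw [mul_ite, mul_zero, ← AddChar.map_add_eq_mul, ← AddChar.map_add_eq_mul]
    congr 2
    ring
  simp only [e1]
  rw [Finset.sum_comm]
  refine Finset.sum_eq_zero fun i hi => ?_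
  rw [Finset.sum_comm]
  refine Finset.sum_eq_zero fun j hj => ?_
  rw [Finset.sum_comm]
  refine Finset.sum_eq_zero fun k hk => ?_
  rw [Finset.sum_comm]
  refine Finset.sum_eq_zero fun x _ => ?_
  by_cases hx : φ k x = a
  · simp only [if_pos hx]
    rw [sum_stdAddChar_mul, if_neg]
    intro h
    rw [sub_eq_zero] at h
    exact ha k hk i hi j hj (h ▸ hx)
  · simp only [if_neg hx, Finset.sum_const_zero]

theorem sum_norm_le_sqrt {α : Type*} [Fintype α] (M : Finset α) (g : α → ℂ) {T : ℝ}
    (hT : ∑ a, ‖g a‖ ^ 2 ≤ T) : ∑ a ∈ M, ‖g a‖ ≤ √(#M : ℝ) * √T := by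
  have h1 := sq_sum_le_card_mul_sum_sq (s := M) (f := fun a => ‖g a‖)
  have h2 : ∑ a ∈ M, ‖g a‖ ^ 2 ≤ T := (Finset.sum_le_sum_of_subset_of_nonneg
    (Finset.subset_univ M) fun _ _ _ => sq_nonneg _).trans hT
  rw [← Real.sqrt_mul (Nat.cast_nonneg _)]
  refine Real.le_sqrt_of_sq_le (h1.trans ?_)
  gcongr

/-- A set missed by all `φ k` on `J + J` is small if the fibre sums are small in mean square. -/
theorem card_mul_sqrt_card_le {J M : Finset (ZMod p)}
    (hM : ∀ a ∈ M, ∀ k ∈ K, ∀ i ∈ J, ∀ j ∈ J, φ k (i + j) ≠ a) (hJ : J.Nonempty) {T : ℝ}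
    (h0 : ∑ a, ‖fiberSum K φ 0 a - #K‖ ^ 2 ≤ T)
    (h1 : ∀ h ≠ 0, ∑ a, ‖fiberSum K φ h a‖ ^ 2 ≤ T) :
    #J * #K * √(#M : ℝ) ≤ (#J + p) * √T := by
  rcases M.eq_empty_or_nonempty with rfl | hMne
  · simp only [Finset.card_empty, Nat.cast_zero, Real.sqrt_zero, mul_zero]
    positivity
  have hJ0 : (0 : ℝ) < #J := by exact_mod_cast hJ.card_pos
  have hM0 : (0 : ℝ) < #M := by exact_mod_cast hMne.card_pos
  have hB0 : indicatorTransform J (0 : ZMod p) = #J := by simp [indicatorTransform]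
  have hpt : ∀ a ∈ M, (#J : ℝ) ^ 2 * #K ≤ #J ^ 2 * ‖fiberSum K φ 0 a - #K‖ +
      ∑ h ∈ Finset.univ.erase 0, ‖indicatorTransform J h‖ ^ 2 * ‖fiberSum K φ h a‖ := by
    intro a ha
    have e1 := sum_indicatorTransform_mul_fiberSum (hM a ha)
    rw [← Finset.add_sum_erase _ _ (Finset.mem_univ 0), hB0] at e1
    have e2 : (#J : ℂ) ^ 2 * #K = -((#J : ℂ) ^ 2 * (fiberSum K φ 0 a - #K)) -
        ∑ h ∈ Finset.univ.erase 0, indicatorTransform J h ^ 2 * fiberSum K φ h a := by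
      linear_combination e1
    have e3 := congrArg norm e2
    rw [norm_mul, norm_pow, Complex.norm_natCast, Complex.norm_natCast] at e3
    rw [e3]
    refine (norm_sub_le _ _).trans (add_le_add ?_ ((norm_sum_le _ _).trans ?_))
    · rw [norm_neg, norm_mul, norm_pow, Complex.norm_natCast]
    · simp only [norm_mul, norm_pow, le_refl]
  have hsum := Finset.sum_le_sum hpt
  rw [Finset.sum_const, nsmul_eq_mul, Finset.sum_add_distrib, ← Finset.mul_sum,
    Finset.sum_comm] at hsum
  have h3 : ∑ h ∈ Finset.univ.erase 0, ∑ a ∈ M,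
      ‖indicatorTransform J h‖ ^ 2 * ‖fiberSum K φ h a‖ ≤ p * #J * (√(#M : ℝ) * √T) := by
    rw [← sum_norm_sq_indicatorTransform, Finset.sum_mul]
    calc _ ≤ ∑ h ∈ Finset.univ.erase 0, ‖indicatorTransform J h‖ ^ 2 * (√(#M : ℝ) * √T) := by
          refine Finset.sum_le_sum fun h hh => ?_
          rw [← Finset.mul_sum]
          gcongr
          exact sum_norm_le_sqrt M _ (h1 h (Finset.ne_of_mem_erase hh))
      _ ≤ _ := Finset.sum_le_sum_of_subset_of_nonneg (Finset.subset_univ _) fun _ _ _ => by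
          positivity
  have h4 := sum_norm_le_sqrt M _ h0
  have h5 : (#M : ℝ) * (#J ^ 2 * #K) ≤ #J ^ 2 * (√(#M : ℝ) * √T) + p * #J * (√(#M : ℝ) * √T) :=
    hsum.trans (by gcongr)
  have h6 : √(#M : ℝ) * √(#M : ℝ) = (#M : ℝ) := Real.mul_self_sqrt hM0.le
  have h7 : 0 < √(#M : ℝ) := Real.sqrt_pos.2 hM0
  refine le_of_mul_le_mul_left (a := #J * √(#M : ℝ)) ?_ (by positivity)
  calc #J * √(#M : ℝ) * (#J * #K * √(#M : ℝ)) = (√(#M : ℝ) * √(#M : ℝ)) * (#J ^ 2 * #K) := by ring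
    _ = #M * (#J ^ 2 * #K) := by rw [h6]
    _ ≤ _ := h5
    _ = _ := by ring

theorem sum_norm_sq_fiberSum_sub :
    ∑ a, ‖fiberSum K φ 0 a - #K‖ ^ 2 = ∑ a, ‖fiberSum K φ 0 a‖ ^ 2 - #K ^ 2 * p := by
  classical
  let N : ZMod p → ℝ := fun a => ∑ k ∈ K, ∑ x, if φ k x = a then 1 else 0
  have hN : ∀ a, fiberSum K φ 0 a = (N a : ℂ) := by
    intro a
    simp only [fiberSum, N, zero_mul, AddChar.map_zero_eq_one]
    push_cast
    exact Finset.sum_congr rfl fun k _ => Finset.sum_congr rfl fun x _ => by split_ifs <;> simp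
  have hsum : ∑ a, N a = #K * p := by
    simp only [N]
    rw [Finset.sum_comm, ← nsmul_eq_mul, ← Finset.sum_const]
    refine Finset.sum_congr rfl fun k _ => ?_
    rw [Finset.sum_comm]
    simp [ZMod.card]
  have h1 : ∀ a, ‖fiberSum K φ 0 a - #K‖ ^ 2 = N a ^ 2 - 2 * #K * N a + #K ^ 2 := by
    intro a
    have : fiberSum K φ 0 a - #K = ((N a - #K : ℝ) : ℂ) := by rw [hN]; push_cast; rfl
    rw [this, Complex.norm_real, Real.norm_eq_abs, sq_abs]
    ring
  have h2 : ∀ a, ‖fiberSum K φ 0 a‖ ^ 2 = N a ^ 2 := by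
    intro a
    rw [hN, Complex.norm_real, Real.norm_eq_abs, sq_abs]
  simp only [h1, h2]
  rw [Finset.sum_add_distrib, Finset.sum_sub_distrib, ← Finset.mul_sum, hsum, Finset.sum_const,
    Finset.card_univ, ZMod.card, nsmul_eq_mul]
  ring

/-- Two difference sums cannot both be large if the differences of differences are
equidistributed from above. -/
theorem norm_differenceSum_mul_le {A B : Finset (ZMod p × ZMod p)} {R : ℕ}
    (hR : ∀ τ, #{P ∈ A ×ˢ B | (P.1.1 - P.1.2) - (P.2.1 - P.2.2) = τ} ≤ R) {h : ZMod p}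
    (hh : h ≠ 0) :
    ‖differenceSum A h‖ * ‖differenceSum B h‖ ≤ p * R - #A * #B := by
  classical
  let d : (ZMod p × ZMod p) × (ZMod p × ZMod p) → ZMod p :=
    fun P => (P.1.1 - P.1.2) - (P.2.1 - P.2.2)
  have e1 : differenceSum A h * (starRingEnd ℂ) (differenceSum B h) =
      ∑ τ, (#{P ∈ A ×ˢ B | d P = τ} : ℂ) * ZMod.stdAddChar (τ * h) := by
    rw [differenceSum, differenceSum, map_sum, Finset.sum_mul_sum, ← Finset.sum_product',
      ← Finset.sum_fiberwise (A ×ˢ B) d]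
    refine Finset.sum_congr rfl fun τ _ => ?_
    rw [← nsmul_eq_mul, ← Finset.sum_const]
    refine Finset.sum_congr rfl fun P hP => ?_
    rw [conj_stdAddChar, ← AddChar.map_add_eq_mul, ← (Finset.mem_filter.1 hP).2]
    congr 1
    ring
  have e2 : differenceSum A h * (starRingEnd ℂ) (differenceSum B h) =
      ∑ τ, ((#{P ∈ A ×ˢ B | d P = τ} - R : ℝ) : ℂ) * ZMod.stdAddChar (τ * h) := by
    rw [e1]
    push_cast
    simp only [sub_mul, Finset.sum_sub_distrib]
    rw [← Finset.mul_sum, sum_stdAddChar_mul, if_neg hh, mul_zero, sub_zero]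
  have e3 : ∑ τ, #{P ∈ A ×ˢ B | d P = τ} = #A * #B := by
    rw [← Finset.card_product]
    exact (Finset.card_eq_sum_card_fiberwise fun P _ => Finset.mem_coe.2 (Finset.mem_univ (d P))).symm
  have e4 : ∑ τ, (#{P ∈ A ×ˢ B | d P = τ} : ℝ) = #A * #B := by exact_mod_cast e3
  calc ‖differenceSum A h‖ * ‖differenceSum B h‖
      = ‖differenceSum A h * (starRingEnd ℂ) (differenceSum B h)‖ := by
        rw [norm_mul, RCLike.norm_conj]
    _ ≤ ∑ τ, (R - #{P ∈ A ×ˢ B | d P = τ} : ℝ) := by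
        rw [e2]
        refine (norm_sum_le _ _).trans (Finset.sum_le_sum fun τ _ => ?_)
        rw [norm_mul, AddChar.norm_apply, mul_one, Complex.norm_real, Real.norm_eq_abs, abs_sub_comm,
          abs_of_nonneg]
        exact sub_nonneg.2 (by exact_mod_cast hR τ)
    _ = p * R - #A * #B := by
        rw [Finset.sum_sub_distrib, e4, Finset.sum_const, Finset.card_univ, ZMod.card, nsmul_eq_mul]

theorem sum_le_of_mul_le {K : Finset ℕ} {S : ℕ × ℕ → ℝ} {ε U : ℝ}
    (hε : 0 ≤ ε) (hU : 0 ≤ U) {Q : Finset (ℕ × ℕ)} (hQ : Q ⊆ K ×ˢ K) (hS : ∀ a ∈ Q, S a ≤ U)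
    (hmul : ∀ a ∈ Q, ∀ b ∈ Q, a.2 ≠ b.2 → S a * S b ≤ ε ^ 2) :
    ∑ a ∈ Q, S a ≤ #K ^ 2 * ε + #K * U := by
  have hcard : (#Q : ℝ) ≤ #K ^ 2 := by
    have := Finset.card_le_card hQ
    rw [Finset.card_product, ← sq] at this
    exact_mod_cast this
  by_cases hall : ∀ a ∈ Q, S a ≤ ε
  · have h1 := Finset.sum_le_card_nsmul Q S ε hall
    rw [nsmul_eq_mul] at h1
    have : (#Q : ℝ) * ε ≤ #K ^ 2 * ε := by gcongr
    have : 0 ≤ #K * U := by positivity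
    linarith
  · push Not at hall
    obtain ⟨a, ha, hlt⟩ := hall
    rw [← Finset.sum_filter_add_sum_filter_not Q fun b => b.2 ≠ a.2]
    refine add_le_add ?_ ?_
    · have h1 : ∀ b ∈ Q.filter (fun b => b.2 ≠ a.2), S b ≤ ε := by
        intro b hb
        rw [Finset.mem_filter] at hb
        by_contra! h
        have := hmul a ha b hb.1 (Ne.symm hb.2)
        nlinarith only [this, h, hlt, hε]
      have h2 := Finset.sum_le_card_nsmul _ S ε h1
      rw [nsmul_eq_mul] at h2
      refine h2.trans ?_
      have : (#(Q.filter fun b => b.2 ≠ a.2) : ℝ) ≤ #Q := by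
        exact_mod_cast Finset.card_filter_le _ _
      gcongr
      exact this.trans hcard
    · have h2 := Finset.sum_le_card_nsmul (Q.filter fun b => ¬b.2 ≠ a.2) S U
        fun b hb => hS b (Finset.mem_filter.1 hb).1
      rw [nsmul_eq_mul] at h2
      refine h2.trans ?_
      gcongr
      calc #(Q.filter fun b => ¬b.2 ≠ a.2) ≤ #(K.image fun k => (k, a.2)) := by
            refine Finset.card_le_card fun b hb => ?_
            rw [Finset.mem_filter, not_not] at hb
            have := Finset.mem_product.1 (hQ hb.1)
            exact Finset.mem_image.2 ⟨b.1, this.1, Prod.ext rfl hb.2.symm⟩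
        _ ≤ #K := Finset.card_image_le

end CharacterSums

section MeanSquare

theorem sum_sum_eq_diagonal_add {K : Finset ℕ} (g : ℕ → ℕ → ℝ) (hg : ∀ k l, g k l = g l k) :
    ∑ k ∈ K, ∑ l ∈ K, g k l =
      ∑ k ∈ K, g k k + 2 * ∑ a ∈ K ×ˢ K with a.1 < a.2, g a.1 a.2 := by
  rw [← Finset.sum_product', ← Finset.sum_filter_add_sum_filter_not (K ×ˢ K) fun a => a.1 < a.2,
    ← Finset.sum_filter_add_sum_filter_not ((K ×ˢ K).filter fun a => ¬a.1 < a.2)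
      fun a => a.1 = a.2, Finset.filter_filter, Finset.filter_filter]
  have h1 : ∑ a ∈ K ×ˢ K with ¬a.1 < a.2 ∧ a.1 = a.2, g a.1 a.2 = ∑ k ∈ K, g k k := by
    refine Finset.sum_nbij' (fun a => a.1) (fun k => (k, k)) ?_ ?_ ?_ ?_ ?_
    · intro a ha
      exact (Finset.mem_product.1 (Finset.mem_filter.1 ha).1).1
    · intro k hk
      simp [hk]
    · intro a ha
      exact Prod.ext rfl (Finset.mem_filter.1 ha).2.2
    · intro k _
      rfl
    · intro a ha
      rw [← (Finset.mem_filter.1 ha).2.2]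
  have h2 : ∑ a ∈ K ×ˢ K with ¬a.1 < a.2 ∧ ¬a.1 = a.2, g a.1 a.2 =
      ∑ a ∈ K ×ˢ K with a.1 < a.2, g a.1 a.2 := by
    refine Finset.sum_nbij' Prod.swap Prod.swap ?_ ?_ (fun _ _ => rfl) (fun _ _ => rfl)
      fun a _ => hg _ _
    · intro a ha
      simp only [Finset.mem_filter, Finset.mem_product, Prod.fst_swap, Prod.snd_swap] at ha ⊢
      exact ⟨⟨ha.1.2, ha.1.1⟩, by omega⟩
    · intro a ha
      simp only [Finset.mem_filter, Finset.mem_product, Prod.fst_swap, Prod.snd_swap] at ha ⊢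
      exact ⟨⟨ha.1.2, ha.1.1⟩, by omega⟩
  rw [h1, h2]
  ring

variable {p : ℕ} [hpF : Fact p.Prime]

theorem risingCurve_image_swap (k l : ℕ) :
    (risingCurve p k l).image Prod.swap = risingCurve p l k := by
  ext P
  rw [Finset.mem_image, mem_risingCurve]
  constructor
  · rintro ⟨Q, hQ, rfl⟩
    exact (mem_risingCurve.1 hQ).symm
  · intro h
    exact ⟨P.swap, mem_risingCurve.2 h.symm, rfl⟩

theorem card_risingCurve_comm (k l : ℕ) : #(risingCurve p k l) = #(risingCurve p l k) := by
  rw [← risingCurve_image_swap k l, Finset.card_image_of_injective _ Prod.swap_injective]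

theorem norm_differenceSum_risingCurve_comm (k l : ℕ) (h : ZMod p) :
    ‖differenceSum (risingCurve p k l) h‖ = ‖differenceSum (risingCurve p l k) h‖ := by
  rw [← RCLike.norm_conj (differenceSum (risingCurve p l k) h)]
  congr 1
  rw [← risingCurve_image_swap k l, differenceSum, differenceSum,
    Finset.sum_image Prod.swap_injective.injOn, map_sum]
  refine Finset.sum_congr rfl fun P _ => ?_
  rw [conj_stdAddChar]
  congr 1
  simp only [Prod.fst_swap, Prod.snd_swap]
  ring

/-- The values of `P_k = (X + 1)⋯(X + k)`. -/
noncomputable def risingValue (p k : ℕ) (x : ZMod p) : ZMod p := (risingPoly (ZMod p) k).eval x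

variable {D : ℕ} (hD : 1764 * D ^ 8 ≤ p) {K : Finset ℕ} (hK : ∀ k ∈ K, k.Prime ∧ k ≤ D)
include hD hK

theorem sum_norm_sq_fiberSum_sub_le :
    ∑ a, ‖fiberSum K (risingValue p) 0 a - #K‖ ^ 2 ≤
      #K * p + #K ^ 2 * (28 * D ^ 3 * Nat.sqrt p : ℕ) := by
  set E := 28 * D ^ 3 * Nat.sqrt p
  have e1 : ∑ a, ‖fiberSum K (risingValue p) 0 a‖ ^ 2 =
      ∑ k ∈ K, ∑ l ∈ K, (#(risingCurve p k l) : ℝ) := by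
    have := sum_norm_sq_fiberSum (K := K) (φ := risingValue p) 0
    simp only [differenceSum_zero] at this
    exact_mod_cast this
  have e2 : ∀ k ∈ K, ∑ l ∈ K, (#(risingCurve p k l) : ℝ) ≤ p + #K * (p + E : ℕ) := by
    intro k hk
    rw [← nsmul_eq_mul, ← Finset.sum_const, ← Finset.add_sum_erase _ _ hk,
      ← Finset.add_sum_erase _ _ hk, ← add_assoc]
    refine add_le_add ?_ (Finset.sum_le_sum fun l hl => ?_)
    · have := card_risingCurve_self_le hD (hK k hk).1 (hK k hk).2
      have h : #(risingCurve p k k) ≤ p + (p + E) := by omega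
      exact_mod_cast h
    · obtain ⟨hne, hl⟩ := Finset.mem_erase.1 hl
      have hle : #(risingCurve p k l) ≤ p + E := by
        rcases lt_or_gt_of_ne hne with h | h
        · rw [card_risingCurve_comm]
          exact card_risingCurve_le hD (hK l hl).1 (hK k hk).1 h (hK k hk).2
        · exact card_risingCurve_le hD (hK k hk).1 (hK l hl).1 h (hK l hl).2
      exact_mod_cast hle
  rw [sum_norm_sq_fiberSum_sub, e1]
  have e3 := Finset.sum_le_sum e2
  rw [Finset.sum_const, nsmul_eq_mul] at e3
  push_cast at e3 ⊢
  nlinarith only [e3]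

theorem sum_norm_sq_fiberSum_le {h : ZMod p} (hh : h ≠ 0) :
    ∑ a, ‖fiberSum K (risingValue p) h a‖ ^ 2 ≤
      #K * (4 * p + 3 * (28 * D ^ 3 * Nat.sqrt p : ℕ)) +
        2 * (#K ^ 2 * √(p * (3 * (28 * D ^ 3 * Nat.sqrt p : ℕ) + 2 * D ^ 3))) := by
  set E := 28 * D ^ 3 * Nat.sqrt p with hE
  set ε := √((p : ℝ) * (3 * E + 2 * D ^ 3))
  have hε : ε ^ 2 = (p : ℝ) * (3 * E + 2 * D ^ 3) := Real.sq_sqrt (by positivity)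
  have e1 : ∑ a, ‖fiberSum K (risingValue p) h a‖ ^ 2 ≤
      ∑ k ∈ K, ∑ l ∈ K, ‖differenceSum (risingCurve p k l) h‖ := by
    have := congrArg norm (sum_norm_sq_fiberSum (K := K) (φ := risingValue p) h)
    rw [Complex.norm_real, Real.norm_of_nonneg (Finset.sum_nonneg fun _ _ => sq_nonneg _)] at this
    rw [this]
    exact (norm_sum_le _ _).trans (Finset.sum_le_sum fun k _ => norm_sum_le _ _)
  rw [sum_sum_eq_diagonal_add _ fun k l => norm_differenceSum_risingCurve_comm k l h] at e1
  have e2 : ∑ k ∈ K, ‖differenceSum (risingCurve p k k) h‖ ≤ #K * (2 * p + E) := by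
    rw [← nsmul_eq_mul]
    refine Finset.sum_le_card_nsmul _ _ _ fun k hk => (norm_differenceSum_le _ _).trans ?_
    exact_mod_cast card_risingCurve_self_le hD (hK k hk).1 (hK k hk).2
  have e3 := sum_le_of_mul_le (K := K) (S := fun a => ‖differenceSum (risingCurve p a.1 a.2) h‖)
    (ε := ε) (U := p + E) (Real.sqrt_nonneg _) (by positivity)
    (Q := (K ×ˢ K).filter fun a => a.1 < a.2) (Finset.filter_subset _ _) ?_ ?_
  · linarith
  · intro a ha
    obtain ⟨ha, hlt⟩ := Finset.mem_filter.1 ha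
    obtain ⟨h1, h2⟩ := Finset.mem_product.1 ha
    refine (norm_differenceSum_le _ _).trans ?_
    exact_mod_cast card_risingCurve_le hD (hK _ h1).1 (hK _ h2).1 hlt (hK _ h2).2
  · intro a ha b hb hab
    obtain ⟨ha, hlt⟩ := Finset.mem_filter.1 ha
    obtain ⟨h1, h2⟩ := Finset.mem_product.1 ha
    obtain ⟨hb, hlt'⟩ := Finset.mem_filter.1 hb
    obtain ⟨h1', h2'⟩ := Finset.mem_product.1 hb
    have f1 := norm_differenceSum_mul_le (card_risingCurve_shift_le hD (hK _ h1).1 (hK _ h2).1 hlt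
      (hK _ h2).2 (hK _ h1').1 (hK _ h2').1 hlt' (hK _ h2').2 hab) hh
    have f2 := le_card_risingCurve_add hD (hK _ h1).1 (hK _ h2).1 hlt (hK _ h2).2
    have f3 := le_card_risingCurve_add hD (hK _ h1').1 (hK _ h2').1 hlt' (hK _ h2').2
    have f2' : (p : ℝ) ≤ #(risingCurve p a.1 a.2) + D ^ 3 + E := by exact_mod_cast f2
    have f3' : (p : ℝ) ≤ #(risingCurve p b.1 b.2) + D ^ 3 + E := by exact_mod_cast f3
    rw [hε]
    refine f1.trans ?_
    rw [← hE]
    push_cast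
    have hp0 : (0 : ℝ) ≤ p := Nat.cast_nonneg _
    have hE0 : (0 : ℝ) ≤ E := Nat.cast_nonneg _
    have hD0 : (0 : ℝ) ≤ (D : ℝ) ^ 3 := by positivity
    have hA0 : (0 : ℝ) ≤ #(risingCurve p a.1 a.2) := Nat.cast_nonneg _
    have hB0 : (0 : ℝ) ≤ #(risingCurve p b.1 b.2) := Nat.cast_nonneg _
    generalize (#(risingCurve p a.1 a.2) : ℝ) = A at *
    generalize (#(risingCurve p b.1 b.2) : ℝ) = B at *
    generalize (D : ℝ) ^ 3 = D3 at *
    generalize (E : ℝ) = E' at *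
    generalize (p : ℝ) = p' at *
    rcases le_total p' (D3 + E') with hle | hle
    · have := mul_nonneg hA0 hB0
      nlinarith only [this, hle, hp0, hE0, hD0, mul_le_mul_of_nonneg_left hle hp0,
        mul_nonneg hp0 hE0, mul_nonneg hp0 hD0]
    · have : (p' - (D3 + E')) * (p' - (D3 + E')) ≤ A * B :=
        mul_le_mul (by linarith) (by linarith) (by linarith) hA0
      nlinarith only [this, sq_nonneg (D3 + E')]

/-- The set of residues missed by all `P_k` on `J + J` is small. -/
theorem card_mul_sq_card_le {J M : Finset (ZMod p)} (hJ : p ≤ 8 * #J)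
    (hM : ∀ a ∈ M, ∀ k ∈ K, ∀ i ∈ J, ∀ j ∈ J, risingValue p k (i + j) ≠ a) :
    (#M : ℝ) * #K ^ 2 ≤ 81 * (#K * (4 * p + 3 * (28 * D ^ 3 * Nat.sqrt p : ℕ)) +
      2 * (#K ^ 2 * √(p * (3 * (28 * D ^ 3 * Nat.sqrt p : ℕ) + 2 * D ^ 3))) +
      #K ^ 2 * (28 * D ^ 3 * Nat.sqrt p : ℕ)) := by
  have h0 := sum_norm_sq_fiberSum_sub_le hD hK
  have h1 := fun (h : ZMod p) (hh : h ≠ 0) => sum_norm_sq_fiberSum_le hD hK hh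
  generalize 28 * D ^ 3 * Nat.sqrt p = E at *
  set T := #K * (4 * p + 3 * (E : ℝ)) + 2 * (#K ^ 2 * √(p * (3 * (E : ℝ) + 2 * D ^ 3))) +
    #K ^ 2 * (E : ℝ) with hT
  have t1 : (0 : ℝ) ≤ #K * E := by positivity
  have t2 : (0 : ℝ) ≤ #K * p := by positivity
  have t3 : (0 : ℝ) ≤ #K ^ 2 * E := by positivity
  have t4 : (0 : ℝ) ≤ #K ^ 2 * √(p * (3 * (E : ℝ) + 2 * D ^ 3)) := by positivity
  have hJ0 : 0 < #J := by
    have := hpF.out.pos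
    omega
  have hJ1 : (0 : ℝ) < #J := by exact_mod_cast hJ0
  have hJ2 : (p : ℝ) ≤ 8 * #J := by exact_mod_cast hJ
  have h2 := card_mul_sqrt_card_le (K := K) (φ := risingValue p) (T := T) hM
    (Finset.card_pos.1 hJ0) (h0.trans (by linarith)) fun h hh => (h1 h hh).trans (by linarith)
  have hT0 : 0 ≤ T := by positivity
  have h3 : #K * √(#M : ℝ) ≤ 9 * √T := by
    refine le_of_mul_le_mul_left ?_ hJ1
    have := mul_le_mul_of_nonneg_right hJ2 (Real.sqrt_nonneg T)
    linarith
  have h4 : (#K * √(#M : ℝ)) ^ 2 ≤ (9 * √T) ^ 2 := by gcongr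
  rw [mul_pow, mul_pow, Real.sq_sqrt hT0, Real.sq_sqrt (Nat.cast_nonneg _)] at h4
  linarith

end MeanSquare

section Wilson

variable {p : ℕ} [hpF : Fact p.Prime]

theorem natCast_factorial_mul_factorial {m n : ℕ} (h : m + n + 1 = p) :
    ((m.factorial : ℕ) : ZMod p) * (n.factorial : ℕ) = (-1) ^ (m + 1) := by
  induction m generalizing n with
  | zero =>
    have h1 := ZMod.wilsons_lemma p
    have h2 : p - 1 = n := by omega
    rw [h2] at h1
    simpa using h1
  | succ m ih =>
    have h1 := ih (n := n + 1) (by omega)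
    have h2 : ((m + 1 + n + 1 : ℕ) : ZMod p) = 0 := by rw [h, ZMod.natCast_self]
    rw [Nat.factorial_succ] at h1 ⊢
    push_cast at h1 h2 ⊢
    rw [pow_succ, ← h1]
    linear_combination (m.factorial : ZMod p) * n.factorial * h2

theorem risingValue_natCast (k m : ℕ) :
    risingValue p k (m : ZMod p) = ((m + 1).ascFactorial k : ℕ) := by
  have h := aeval_risingPoly (R := ZMod p) (A := ZMod p) k (m : ZMod p)
  rw [Polynomial.coe_aeval_eq_eval] at h
  rw [risingValue, h, Nat.ascFactorial_eq_prod_range]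
  push_cast
  exact Finset.prod_congr rfl fun i _ => by ring

theorem factorial_mul_factorial_eq_neg_risingValue {m n k : ℕ} (hm : Even m) (h : m + n + 1 = p) :
    (((m + k).factorial : ℕ) : ZMod p) * (n.factorial : ℕ) = -risingValue p k m := by
  have h1 := natCast_factorial_mul_factorial h
  rw [pow_succ, hm.neg_one_pow] at h1
  rw [risingValue_natCast, ← Nat.factorial_mul_ascFactorial]
  push_cast
  linear_combination ((m + 1).ascFactorial k : ZMod p) * h1

theorem lt_of_risingValue_ne_zero {m k : ℕ} (hm : m < p) (h : risingValue p k (m : ZMod p) ≠ 0) :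
    m + k < p := by
  by_contra hk
  apply h
  rw [risingValue_natCast, ZMod.natCast_eq_zero_iff, Nat.ascFactorial_eq_prod_range]
  have h1 : m + 1 + (p - (m + 1)) = p := by omega
  have h2 := Finset.dvd_prod_of_mem (fun i => m + 1 + i)
    (Finset.mem_range.2 (show p - (m + 1) < k by omega))
  simp only [h1] at h2
  exact h2

/-- The nonzero residues whose negatives are not products of two factorials. -/
noncomputable def missedResidues (p : ℕ) [Fact p.Prime] : Finset (ZMod p) :=
  Finset.univ.filter fun a => a ≠ 0 ∧
    -a ∉ Finset.image₂ (fun a b => a * b) (factorialResidues p) (factorialResidues p)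

theorem risingValue_ne_of_mem_missedResidues {a : ZMod p} (ha : a ∈ missedResidues p) {m k : ℕ}
    (hm : Even m) (hm1 : m + 2 ≤ p) (hk : 0 < k) : risingValue p k (m : ZMod p) ≠ a := by
  rintro rfl
  rw [missedResidues, Finset.mem_filter] at ha
  have h1 := lt_of_risingValue_ne_zero (by omega) ha.2.1
  apply ha.2.2
  rw [← factorial_mul_factorial_eq_neg_risingValue hm (n := p - 1 - m) (by omega)]
  refine Finset.mem_image₂_of_mem ?_ ?_ <;> unfold factorialResidues
  · exact Finset.mem_image_of_mem _ (Finset.mem_Icc.2 ⟨by omega, by omega⟩)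
  · exact Finset.mem_image_of_mem _ (Finset.mem_Icc.2 ⟨by omega, by omega⟩)

theorem le_card_missedResidues_add :
    p ≤ #(missedResidues p) + 1 +
      #(Finset.image₂ (fun a b => a * b) (factorialResidues p) (factorialResidues p)) := by
  set S := Finset.image₂ (fun a b => a * b) (factorialResidues p) (factorialResidues p) with hS
  have h : (Finset.univ : Finset (ZMod p)) ⊆ (missedResidues p ∪ {0}) ∪ S.image fun x => -x := by
    intro a _
    by_cases h0 : a = 0
    · simp [h0]
    by_cases h1 : -a ∈ S
    · exact Finset.mem_union_right _ (Finset.mem_image.2 ⟨-a, h1, neg_neg a⟩)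
    · exact Finset.mem_union_left _ (Finset.mem_union_left _
        (Finset.mem_filter.2 ⟨Finset.mem_univ _, h0, h1⟩))
  have h1 := Finset.card_le_card h
  rw [Finset.card_univ, ZMod.card] at h1
  have h2 := Finset.card_union_le (missedResidues p ∪ {0}) (S.image fun x => -x)
  have h3 := Finset.card_union_le (missedResidues p) {0}
  have h4 : #(S.image fun x => -x) ≤ #S := Finset.card_image_le
  rw [Finset.card_singleton] at h3
  omega

/-- The residues of the even integers up to `p / 4`. -/
def smallEvens (p : ℕ) : Finset (ZMod p) :=
  (Finset.range (p / 8 + 1)).image fun j => ((2 * j : ℕ) : ZMod p)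

omit hpF in
theorem card_smallEvens (hp : 3 ≤ p) : #(smallEvens p) = p / 8 + 1 := by
  rw [smallEvens, Finset.card_image_of_injOn, Finset.card_range]
  intro i hi j hj h
  rw [Finset.coe_range, Set.mem_Iio] at hi hj
  have h1 := (ZMod.natCast_eq_natCast_iff' _ _ _).1 h
  rw [Nat.mod_eq_of_lt (by omega), Nat.mod_eq_of_lt (by omega)] at h1
  omega

theorem risingValue_add_ne_of_mem_smallEvens (hp : 4 ≤ p) {a i j : ZMod p}
    (ha : a ∈ missedResidues p) {k : ℕ} (hk : 0 < k) (hi : i ∈ smallEvens p)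
    (hj : j ∈ smallEvens p) : risingValue p k (i + j) ≠ a := by
  obtain ⟨m, hm, rfl⟩ := Finset.mem_image.1 hi
  obtain ⟨n, hn, rfl⟩ := Finset.mem_image.1 hj
  rw [Finset.mem_range] at hm hn
  rw [← Nat.cast_add]
  exact risingValue_ne_of_mem_missedResidues ha ⟨m + n, by ring⟩ (by omega) hk

end Wilson

section Numerics

theorem exists_forall_rpow_le_primeCounting :
    ∃ N : ℕ, ∀ n : ℕ, N ≤ n → (n : ℝ) ^ ((6 : ℝ) / 7) ≤ Nat.primeCounting n := by
  have h1 := (isLittleO_log_rpow_atTop (r := (1 : ℝ) / 7) (by norm_num)).bound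
    (show (0 : ℝ) < 1 / 10 by norm_num)
  have h2 := (tendsto_natCast_atTop_atTop (R := ℝ)).eventually h1
  obtain ⟨N, hN⟩ := Filter.eventually_atTop.1 h2
  refine ⟨max N 3, fun n hn => ?_⟩
  have hn3 : (3 : ℝ) ≤ n := by exact_mod_cast (le_max_right N 3).trans hn
  have hn0 : (0 : ℝ) < n := by linarith
  have h3 := hN n ((le_max_left _ _).trans hn)
  have hlog : 0 < Real.log n := Real.log_pos (by linarith)
  rw [Real.norm_of_nonneg hlog.le, Real.norm_of_nonneg (by positivity)] at h3
  refine le_trans ?_ (Chebyshev.pi_ge n)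
  rw [le_div_iff₀ hlog]
  have h4 : Real.log (n + 1) ≤ 2 * Real.log n := by
    rw [← Real.log_rpow hn0]
    refine Real.log_le_log (by linarith) ?_
    rw [Real.rpow_two]
    nlinarith only [hn3]
  have h5 : (n : ℝ) ^ ((6 : ℝ) / 7) * (n : ℝ) ^ ((1 : ℝ) / 7) = n := by
    rw [← Real.rpow_add hn0]
    norm_num
  have h6 : (n : ℝ) ^ ((1 : ℝ) / 7) ≤ n := by
    calc (n : ℝ) ^ ((1 : ℝ) / 7) ≤ (n : ℝ) ^ (1 : ℝ) :=
          Real.rpow_le_rpow_of_exponent_le (by linarith) (by norm_num)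
      _ = n := Real.rpow_one _
  have h7 := Real.log_two_gt_d9
  have h8 : (n : ℝ) ^ ((6 : ℝ) / 7) * Real.log n ≤
      (n : ℝ) ^ ((6 : ℝ) / 7) * (1 / 10 * (n : ℝ) ^ ((1 : ℝ) / 7)) := by gcongr
  have h9 : (n : ℝ) * 0.6 ≤ n * Real.log 2 := by gcongr; linarith
  linarith

theorem le_pow_of_mul_sq_le {M K E S D t p : ℝ} (ht : 1 ≤ t) (hp : p = t ^ 168)
    (hD0 : 0 ≤ D) (hD : D ≤ t ^ 14) (hE : E ≤ 28 * D ^ 3 * S) (hS : S ≤ t ^ 84)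
    (hK : t ^ 12 ≤ 2 * K)
    (h : M * K ^ 2 ≤ 81 * (K * (4 * p + 3 * E) + 2 * (K ^ 2 * √(p * (3 * E + 2 * D ^ 3))) +
      K ^ 2 * E)) :
    M ≤ 18144 * t ^ 156 := by
  have ht0 : 0 < t := by linarith
  have hK0 : 0 < K := by
    have : 0 < t ^ 12 := by positivity
    linarith
  have hD3 : D ^ 3 ≤ t ^ 42 := by
    calc D ^ 3 ≤ (t ^ 14) ^ 3 := by gcongr
      _ = t ^ 42 := by ring
  have hE1 : E ≤ 28 * t ^ 126 := by
    calc E ≤ 28 * D ^ 3 * S := hE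
      _ ≤ 28 * D ^ 3 * t ^ 84 := by gcongr
      _ ≤ 28 * t ^ 42 * t ^ 84 := by gcongr
      _ = 28 * t ^ 126 := by ring
  have q1 : t ^ 42 ≤ t ^ 126 := pow_le_pow_right₀ ht (by norm_num)
  have q2 : t ^ 126 ≤ t ^ 156 := pow_le_pow_right₀ ht (by norm_num)
  have q4 : 0 < t ^ 126 := by positivity
  have q3 : t ^ 147 ≤ t ^ 156 := pow_le_pow_right₀ ht (by norm_num)
  have hsq : √(p * (3 * E + 2 * D ^ 3)) ≤ 10 * t ^ 147 := by
    rw [Real.sqrt_le_left (by positivity), hp]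
    calc t ^ 168 * (3 * E + 2 * D ^ 3) ≤ t ^ 168 * (100 * t ^ 126) := by
          gcongr
          linarith
      _ = (10 * t ^ 147) ^ 2 := by ring
  have hK1 : 1 ≤ 2 * K := (one_le_pow₀ ht).trans hK
  have k1 : K * (4 * p) ≤ K ^ 2 * (8 * t ^ 156) := by
    calc K * (4 * p) = K * (4 * t ^ 156) * t ^ 12 := by rw [hp]; ring
      _ ≤ K * (4 * t ^ 156) * (2 * K) := by gcongr
      _ = K ^ 2 * (8 * t ^ 156) := by ring
  have k2 : K * (3 * E) ≤ K ^ 2 * (168 * t ^ 156) := by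
    calc K * (3 * E) ≤ K * (84 * t ^ 156) :=
          mul_le_mul_of_nonneg_left (by linarith) hK0.le
      _ = K * (84 * t ^ 156) * 1 := by ring
      _ ≤ K * (84 * t ^ 156) * (2 * K) := by gcongr
      _ = K ^ 2 * (168 * t ^ 156) := by ring
  have k3 : K ^ 2 * √(p * (3 * E + 2 * D ^ 3)) ≤ K ^ 2 * (10 * t ^ 156) := by
    gcongr
    linarith
  have k4 : K ^ 2 * E ≤ K ^ 2 * (28 * t ^ 156) := by
    gcongr
    linarith
  have k5 : M * K ^ 2 ≤ (18144 * t ^ 156) * K ^ 2 := by linarith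
  exact le_of_mul_le_mul_right k5 (by positivity)

theorem exists_forall_card_missedResidues_le :
    ∃ P : ℕ, ∀ (p : ℕ) [Fact p.Prime], P ≤ p →
      (#(missedResidues p) : ℝ) ≤ 18144 * (p : ℝ) ^ ((13 : ℝ) / 14) := by
  obtain ⟨N, hN⟩ := exists_forall_rpow_le_primeCounting
  refine ⟨(max N 7) ^ 12, fun p hpF hp => ?_⟩
  have hp0 : (0 : ℝ) ≤ p := Nat.cast_nonneg _
  have hp1 : (1 : ℝ) ≤ p := by exact_mod_cast hpF.out.one_le
  set t : ℝ := (p : ℝ) ^ ((1 : ℝ) / 168) with ht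
  have ht1 : 1 ≤ t := Real.one_le_rpow hp1 (by norm_num)
  have htp : ∀ n : ℕ, t ^ n = (p : ℝ) ^ ((n : ℝ) / 168) := fun n => by
    rw [ht, ← Real.rpow_natCast, ← Real.rpow_mul hp0]
    ring_nf
  have ht168 : (p : ℝ) = t ^ 168 := by rw [htp]; norm_num
  have ht156 : (p : ℝ) ^ ((13 : ℝ) / 14) = t ^ 156 := by rw [htp]; norm_num
  have ht0 : 0 < t := by linarith
  set D := ⌊t ^ 14⌋₊ with hD
  have hDt : (D : ℝ) ≤ t ^ 14 := Nat.floor_le (by positivity)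
  have hDN : max N 7 ≤ D := by
    refine Nat.le_floor ?_
    rw [← pow_le_pow_iff_left₀ (by positivity) (by positivity) (show 12 ≠ 0 by norm_num), ← pow_mul,
      ← ht168]
    exact_mod_cast hp
  have hD7 : 7 ≤ D := (le_max_right _ _).trans hDN
  have hD7' : (7 : ℝ) ≤ D := by exact_mod_cast hD7
  have hD12 : D ^ 12 ≤ p := by
    have : (D : ℝ) ^ 12 ≤ p := by
      rw [ht168]
      calc (D : ℝ) ^ 12 ≤ (t ^ 14) ^ 12 := by gcongr
        _ = t ^ 168 := by ring
    exact_mod_cast this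
  have hD8 : 1764 * D ^ 8 ≤ p := by
    refine le_trans ?_ hD12
    calc 1764 * D ^ 8 ≤ 7 ^ 4 * D ^ 8 := by gcongr; norm_num
      _ ≤ D ^ 4 * D ^ 8 := by gcongr
      _ = D ^ 12 := by ring
  have hp4 : 4 ≤ p := by
    have : 7 ^ 8 ≤ D ^ 8 := Nat.pow_le_pow_left hD7 8
    omega
  have hK : t ^ 12 ≤ 2 * (#(Nat.primesLE D) : ℝ) := by
    rw [Nat.primesLE_card_eq_primeCounting]
    have h1 := hN D ((le_max_left _ _).trans hDN)
    have h2 : t ^ 14 ≤ 2 * D := by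
      have := Nat.lt_floor_add_one (t ^ 14)
      linarith
    have h3 : t ^ 12 = (t ^ 14) ^ ((6 : ℝ) / 7) := by
      rw [← Real.rpow_natCast, ← Real.rpow_natCast, ← Real.rpow_mul ht0.le]
      norm_num
    calc t ^ 12 ≤ (2 * (D : ℝ)) ^ ((6 : ℝ) / 7) := by
          rw [h3]
          gcongr
      _ = 2 ^ ((6 : ℝ) / 7) * (D : ℝ) ^ ((6 : ℝ) / 7) :=
          Real.mul_rpow (by norm_num) (by positivity)
      _ ≤ 2 ^ (1 : ℝ) * (Nat.primeCounting D : ℝ) := by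
          gcongr
          · norm_num
          · norm_num
      _ = 2 * (Nat.primeCounting D : ℝ) := by rw [Real.rpow_one]
  have hS : (Nat.sqrt p : ℝ) ≤ t ^ 84 := by
    refine Real.nat_sqrt_le_real_sqrt.trans ?_
    rw [Real.sqrt_le_left (by positivity), ht168]
    exact le_of_eq (by ring)
  have h := card_mul_sq_card_le hD8 (K := Nat.primesLE D) (J := smallEvens p)
    (M := missedResidues p)
    (fun k hk => by rw [Nat.mem_primesLE] at hk; exact ⟨hk.2, hk.1⟩)
    (by rw [card_smallEvens (by omega)]; omega)
    (fun a ha k hk i hi j hj => risingValue_add_ne_of_mem_smallEvens hp4 ha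
      (by rw [Nat.mem_primesLE] at hk; exact hk.2.pos) hi hj)
  rw [ht156]
  exact le_pow_of_mul_sq_le ht1 ht168 (Nat.cast_nonneg _) hDt
    (by push_cast; exact le_rfl) hS hK h

end Numerics

/-- **Theorem 1.** `|A(p)·A(p)| ≥ p − C·p^{13/14}·(log p)^{4/7}` for an absolute `C > 0`. -/
theorem card_product_factorialResidues_ge :
    ∃ C : ℝ, C > 0 ∧ ∀ p : ℕ, p.Prime →
      ((Finset.image₂ (fun a b => a * b) (factorialResidues p) (factorialResidues p)).card : ℝ) ≥
        (p : ℝ) - C * (p : ℝ) ^ ((13 : ℝ) / 14) * (Real.log p) ^ ((4 : ℝ) / 7) := by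
  obtain ⟨P, hP⟩ := exists_forall_card_missedResidues_le
  have hlog2 : 0 < Real.log 2 := Real.log_pos (by norm_num)
  set c : ℝ := Real.log 2 ^ ((4 : ℝ) / 7) with hc
  have hc0 : 0 < c := by positivity
  refine ⟨(18145 + P) / c, by positivity, fun p hp => ?_⟩
  have hpF : Fact p.Prime := ⟨hp⟩
  have hp2 : (2 : ℝ) ≤ p := by exact_mod_cast hp.two_le
  have hpow : 1 ≤ (p : ℝ) ^ ((13 : ℝ) / 14) := Real.one_le_rpow (by linarith) (by norm_num)
  have hlog : c ≤ Real.log p ^ ((4 : ℝ) / 7) := by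
    rw [hc]
    gcongr
  have h1 : (18145 + P) * (p : ℝ) ^ ((13 : ℝ) / 14) ≤
      (18145 + P) / c * (p : ℝ) ^ ((13 : ℝ) / 14) * Real.log p ^ ((4 : ℝ) / 7) := by
    calc (18145 + P) * (p : ℝ) ^ ((13 : ℝ) / 14)
        = (18145 + P) / c * (p : ℝ) ^ ((13 : ℝ) / 14) * c := by field_simp
      _ ≤ _ := by gcongr
  refine (sub_le_sub_left h1 _).trans ?_
  have hP0 : (0 : ℝ) ≤ P := Nat.cast_nonneg _
  rcases le_total P p with hle | hle
  · have h2 := hP p hle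
    have h3 : (p : ℝ) ≤ #(missedResidues p) + 1 +
        #(Finset.image₂ (fun a b => a * b) (factorialResidues p) (factorialResidues p)) := by
      exact_mod_cast le_card_missedResidues_add (p := p)
    have h4 := mul_nonneg hP0 (zero_le_one.trans hpow)
    linarith
  · have h2 : (p : ℝ) ≤ P := by exact_mod_cast hle
    have h3 : (0 : ℝ) ≤
        #(Finset.image₂ (fun a b => a * b) (factorialResidues p) (factorialResidues p)) :=
      Nat.cast_nonneg _
    have h4 : (18145 + P : ℝ) * 1 ≤ (18145 + P) * (p : ℝ) ^ ((13 : ℝ) / 14) := by gcongr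
    linarith
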